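/- Let 1 < q⃗ = (q_1,…,q_n) < ∞ (componentwise) and b ∈ BMO(ℝ^n). Then the maximal commutator M^b is bounded on L^{q⃗}(ℝ^n): there is a constant C > 0, independent of b and f, such that ‖M^b f‖_{L^{q⃗}} ≤ C ‖b‖_{BMO} ‖f‖_{L^{q⃗}} for all f ∈ L^{q⃗}(ℝ^n). -/

import Mathlib

open MeasureTheory ENNReal Set

noncomputable section

/-- Euclidean distance on `Fin n → ℝ`. -/
def eudist (n : ℕ) (x y : Fin n → ℝ) : ℝ :=
  Real.sqrt (∑ i, (x i - y i) ^ 2)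

/-- Open Euclidean ball in `Fin n → ℝ`. -/
def eball (n : ℕ) (x : Fin n → ℝ) (r : ℝ) : Set (Fin n → ℝ) :=
  {y | eudist n x y < r}

/-- Iterated mixed Lebesgue "norm" of an `ℝ≥0∞`-valued function: the innermost
integration is in the first coordinate with exponent `q 0`, the outermost in the
last coordinate with exponent `q (n-1)`. -/
def mixedLnorm : (n : ℕ) → (Fin n → ℝ) → ((Fin n → ℝ) → ℝ≥0∞) → ℝ≥0∞
  | 0, _, g => g (fun i => i.elim0)
  | (n + 1), q, g =>
      (∫⁻ t : ℝ, (mixedLnorm n (fun i => q i.castSucc)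
          (fun y => g (Fin.snoc y t))) ^ q (Fin.last n)) ^ (1 / q (Fin.last n))

/-- Mixed Lebesgue norm `‖f‖_{L^{q⃗}}` of a real-valued function on `ℝ^n`. -/
def mixedNorm (n : ℕ) (q : Fin n → ℝ) (f : (Fin n → ℝ) → ℝ) : ℝ≥0∞ :=
  mixedLnorm n q (fun x => ENNReal.ofReal |f x|)

/-- Generalized mixed Morrey norm of an `ℝ≥0∞`-valued function. -/
def morreyLnorm (n : ℕ) (q : Fin n → ℝ) (φ : (Fin n → ℝ) → ℝ → ℝ)
    (g : (Fin n → ℝ) → ℝ≥0∞) : ℝ≥0∞ :=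
  ⨆ (x : Fin n → ℝ) (r : ℝ) (_ : 0 < r),
    (ENNReal.ofReal (φ x r))⁻¹
      * (mixedNorm n q ((eball n x r).indicator fun _ => (1 : ℝ)))⁻¹
      * mixedLnorm n q ((eball n x r).indicator g)

/-- Generalized mixed Morrey norm `‖f‖_{M^φ_{q⃗}}` of a real-valued function. -/
def morreyNorm (n : ℕ) (q : Fin n → ℝ) (φ : (Fin n → ℝ) → ℝ → ℝ)
    (f : (Fin n → ℝ) → ℝ) : ℝ≥0∞ :=
  morreyLnorm n q φ (fun x => ENNReal.ofReal |f x|)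

/-- The BMO norm (as an extended real number). -/
def bmoNorm (n : ℕ) (b : (Fin n → ℝ) → ℝ) : ℝ≥0∞ :=
  ⨆ (x : Fin n → ℝ) (r : ℝ) (_ : 0 < r),
    ENNReal.ofReal ((volume (eball n x r)).toReal⁻¹
      * ∫ y in eball n x r, |b y - ⨍ z in eball n x r, b z|)

/-- Sublinearity in each entry of a multi-(sub)linear operator. -/
def EntrywiseSublinear (n m : ℕ)
    (T : (Fin m → ((Fin n → ℝ) → ℝ)) → ((Fin n → ℝ) → ℝ)) : Prop :=
  (∀ (f : Fin m → ((Fin n → ℝ) → ℝ)) (i : Fin m) (g h : (Fin n → ℝ) → ℝ)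
      (x : Fin n → ℝ),
      |T (Function.update f i (g + h)) x|
        ≤ |T (Function.update f i g) x| + |T (Function.update f i h) x|) ∧
  (∀ (f : Fin m → ((Fin n → ℝ) → ℝ)) (i : Fin m) (c : ℝ) (g : (Fin n → ℝ) → ℝ)
      (x : Fin n → ℝ),
      |T (Function.update f i (c • g)) x| = |c| * |T (Function.update f i g) x|)

/-- The multi-sublinear size condition (1.1) with constant `C`. -/
def SizeCond (n m : ℕ)
    (T : (Fin m → ((Fin n → ℝ) → ℝ)) → ((Fin n → ℝ) → ℝ)) (C : ℝ) : Prop :=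
  ∀ f : Fin m → ((Fin n → ℝ) → ℝ),
    (∀ i, Integrable (f i)) → (∀ i, HasCompactSupport (f i)) →
    ∀ x, x ∉ ⋂ j, Function.support (f j) →
      |T f x| ≤ C * ∫ y : Fin m → (Fin n → ℝ),
        (∏ i, |f i (y i)|) / Real.sqrt (∑ i, eudist n x (y i) ^ 2) ^ (m * n)

/-- The multi-sublinear commutator size condition (1.2), with symbol `b` and
distinguished index `i`, with constant `C`. -/
def CommSizeCond (n m : ℕ) (b : (Fin n → ℝ) → ℝ) (i : Fin m)
    (T : (Fin m → ((Fin n → ℝ) → ℝ)) → ((Fin n → ℝ) → ℝ)) (C : ℝ) : Prop :=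
  ∀ f : Fin m → ((Fin n → ℝ) → ℝ),
    (∀ k, Integrable (f k)) → (∀ k, HasCompactSupport (f k)) →
    ∀ x, x ∉ ⋂ j, Function.support (f j) →
      |T f x| ≤ C * ∫ y : Fin m → (Fin n → ℝ),
        |b x - b (y i)| * (∏ k, |f k (y k)|)
          / Real.sqrt (∑ k, eudist n x (y k) ^ 2) ^ (m * n)

/-- The Hardy–Littlewood maximal operator. -/
def hlMax (n : ℕ) (f : (Fin n → ℝ) → ℝ) (x : Fin n → ℝ) : ℝ≥0∞ :=
  ⨆ (r : ℝ) (_ : 0 < r),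
    (volume (eball n x r))⁻¹ * ∫⁻ y in eball n x r, ENNReal.ofReal |f y|

/-- The maximal commutator of the Hardy–Littlewood maximal operator. -/
def maxComm (n : ℕ) (b f : (Fin n → ℝ) → ℝ) (x : Fin n → ℝ) : ℝ≥0∞ :=
  ⨆ (r : ℝ) (_ : 0 < r),
    (volume (eball n x r))⁻¹
      * ∫⁻ y in eball n x r, ENNReal.ofReal (|b x - b y| * |f y|)

/-- The multi-sublinear maximal operator `M_m`. -/
def multiMax (n m : ℕ) (f : Fin m → ((Fin n → ℝ) → ℝ)) (x : Fin n → ℝ) : ℝ≥0∞ :=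
  ⨆ (r : ℝ) (_ : 0 < r),
    ∏ i, (volume (eball n x r))⁻¹ * ∫⁻ y in eball n x r, ENNReal.ofReal |f i y|

/-- The multi-sublinear maximal commutator `M^{b⃗}_{m,i}`. -/
def multiMaxComm (n m : ℕ) (b : Fin m → ((Fin n → ℝ) → ℝ)) (i : Fin m)
    (f : Fin m → ((Fin n → ℝ) → ℝ)) (x : Fin n → ℝ) : ℝ≥0∞ :=
  (⨆ (r : ℝ) (_ : 0 < r),
      (volume (eball n x r))⁻¹
        * ∫⁻ y in eball n x r, ENNReal.ofReal (|b i x - b i y| * |f i y|)) *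
  (⨆ (r : ℝ) (_ : 0 < r),
      ∏ k ∈ Finset.univ.erase i,
        (volume (eball n x r))⁻¹ * ∫⁻ y in eball n x r, ENNReal.ofReal |f k y|)

/-- `w` is an `A₁` weight with constant `c`. -/
def IsA1Weight (n : ℕ) (w : (Fin n → ℝ) → ℝ) (c : ℝ) : Prop :=
  (∀ x, 0 < w x) ∧ LocallyIntegrable w ∧
    ∀ (x : Fin n → ℝ) (r : ℝ), 0 < r →
      ∀ᵐ y ∂(volume.restrict (eball n x r)),
        (volume (eball n x r)).toReal⁻¹ * ∫ z in eball n x r, w z ≤ c * w y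

/-- `T` is an `m`-linear Calderón–Zygmund operator. -/
def IsCZOperator (n m : ℕ)
    (T : (Fin m → ((Fin n → ℝ) → ℝ)) → ((Fin n → ℝ) → ℝ)) : Prop :=
  -- additivity in each entry
  (∀ (f : Fin m → ((Fin n → ℝ) → ℝ)) (i : Fin m) (g h : (Fin n → ℝ) → ℝ),
      T (Function.update f i (g + h))
        = T (Function.update f i g) + T (Function.update f i h)) ∧
  -- homogeneity in each entry
  (∀ (f : Fin m → ((Fin n → ℝ) → ℝ)) (i : Fin m) (c : ℝ) (g : (Fin n → ℝ) → ℝ),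
      T (Function.update f i (c • g)) = c • T (Function.update f i g)) ∧
  -- boundedness from a product of Lebesgue spaces
  (∃ (s : Fin m → ℝ) (s₀ A : ℝ), (∀ i, 1 ≤ s i) ∧ 0 < s₀ ∧
      (1 / s₀ = ∑ i, 1 / s i) ∧ 0 < A ∧
      ∀ f : Fin m → ((Fin n → ℝ) → ℝ), (∀ i, Measurable (f i)) →
        (∀ i, mixedNorm n (fun _ => s i) (f i) ≠ ⊤) →
        mixedNorm n (fun _ => s₀) (T f)
          ≤ ENNReal.ofReal A * ∏ i, mixedNorm n (fun _ => s i) (f i)) ∧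
  -- Calderón–Zygmund kernel and representation
  (∃ (K : (Fin n → ℝ) → (Fin m → (Fin n → ℝ)) → ℝ) (ε C : ℝ), 0 < ε ∧ 0 < C ∧
      -- size estimate
      (∀ x y, ¬(∀ k, y k = x) →
        |K x y| ≤ C / (∑ k, eudist n x (y k)) ^ (m * n)) ∧
      -- regularity in the first variable
      (∀ x x' y, ¬(∀ k, y k = x) →
        2 * eudist n x x' ≤ (⨆ k, eudist n x (y k)) →
        |K x y - K x' y|
          ≤ C * eudist n x x' ^ ε / (∑ k, eudist n x (y k)) ^ ((m * n : ℝ) + ε)) ∧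
      -- regularity in each of the remaining variables
      (∀ x y (k : Fin m) (y' : Fin n → ℝ), ¬(∀ j, y j = x) →
        2 * eudist n (y k) y' ≤ (⨆ j, eudist n x (y j)) →
        |K x y - K x (Function.update y k y')|
          ≤ C * eudist n (y k) y' ^ ε / (∑ j, eudist n x (y j)) ^ ((m * n : ℝ) + ε)) ∧
      -- integral representation off the supports
      (∀ f : Fin m → ((Fin n → ℝ) → ℝ),
        (∀ j, Measurable (f j)) → (∀ j, ∃ M : ℝ, ∀ x, |f j x| ≤ M) →
        (∀ j, HasCompactSupport (f j)) →
        ∀ x, x ∉ ⋂ j, Function.support (f j) →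
          T f x = ∫ y : Fin m → (Fin n → ℝ), K x y * ∏ j, f j (y j)))

/-- The commutator `K^{b⃗}_{m,i}` of an `m`-linear operator. -/
def czComm (n m : ℕ) (T : (Fin m → ((Fin n → ℝ) → ℝ)) → ((Fin n → ℝ) → ℝ))
    (b : Fin m → ((Fin n → ℝ) → ℝ)) (i : Fin m)
    (f : Fin m → ((Fin n → ℝ) → ℝ)) : (Fin n → ℝ) → ℝ :=
  fun x => b i x * T f x - T (Function.update f i fun y => b i y * f i y) x

noncomputable section

/-- Abstract dyadic grid. -/
structure DGrid (α : Type) [MeasurableSpace α] where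
  ι : Type
  cnt : Countable ι
  idx : ℤ → α → ι
  meas : ∀ k i, MeasurableSet (idx k ⁻¹' {i})
  nest : ∀ k x y, idx k x = idx k y → idx (k + 1) x = idx (k + 1) y

namespace DGrid
variable {α : Type} [MeasurableSpace α] (G : DGrid α)

/-- the cube of level k containing x -/
def cube (k : ℤ) (x : α) : Set α := {y | G.idx k y = G.idx k x}

lemma mem_cube (k : ℤ) (x : α) : x ∈ G.cube k x := rfl

lemma measurableSet_cube (k : ℤ) (x : α) : MeasurableSet (G.cube k x) := G.meas k (G.idx k x)

lemma cube_eq {k : ℤ} {x y : α} (h : G.idx k x = G.idx k y) : G.cube k x = G.cube k y := by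
  unfold cube; rw [h]

lemma cube_eq_of_mem {k : ℤ} {x y : α} (h : y ∈ G.cube k x) : G.cube k y = G.cube k x :=
  G.cube_eq h

lemma nest_le {k l : ℤ} (hkl : k ≤ l) (x y : α) (h : G.idx k x = G.idx k y) :
    G.idx l x = G.idx l y := by
  obtain ⟨m, rfl⟩ := Int.le.dest hkl
  clear hkl
  induction m with
  | zero => simpa using h
  | succ m ih =>
    have := G.nest _ _ _ ih
    push_cast
    rwa [← add_assoc]

lemma cube_subset {k l : ℤ} (hkl : k ≤ l) (x : α) : G.cube k x ⊆ G.cube l x :=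
  fun y hy => G.nest_le hkl y x hy

/-- average over the cube -/
def av (ν : Measure α) (k : ℤ) (f : α → ℝ≥0∞) (x : α) : ℝ≥0∞ :=
  (ν (G.cube k x))⁻¹ * ∫⁻ y in G.cube k x, f y ∂ν

/-- maximal operator -/
def M (ν : Measure α) (f : α → ℝ≥0∞) (x : α) : ℝ≥0∞ := ⨆ k, G.av ν k f x

lemma av_eq (ν : Measure α) {k : ℤ} (f : α → ℝ≥0∞) {x y : α} (h : G.idx k x = G.idx k y) :
    G.av ν k f x = G.av ν k f y := by
  unfold av; rw [G.cube_eq h]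

lemma av_le_M (ν : Measure α) (k : ℤ) (f : α → ℝ≥0∞) (x : α) : G.av ν k f x ≤ G.M ν f x :=
  le_iSup (fun k => G.av ν k f x) k

lemma measurable_of_idx {β : Type*} [MeasurableSpace β] (k : ℤ) (g : α → β)
    (h : ∀ x y, G.idx k x = G.idx k y → g x = g y) : Measurable g := by
  have := G.cnt
  intro s _
  have : g ⁻¹' s = ⋃ i ∈ {i | ∃ x, G.idx k x = i ∧ g x ∈ s}, G.idx k ⁻¹' {i} := by
    ext x
    simp only [mem_preimage, mem_iUnion, mem_ofPred_eq, mem_singleton_iff, exists_prop]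
    constructor
    · intro hx; exact ⟨_, ⟨x, rfl, hx⟩, rfl⟩
    · rintro ⟨i, ⟨y, hy, hys⟩, hx⟩
      rw [h x y (hx.trans hy.symm)]; exact hys
  rw [this]
  exact MeasurableSet.biUnion (to_countable _) (fun i _ => G.meas k i)

lemma measurable_M (ν : Measure α) (f : α → ℝ≥0∞) : Measurable (G.M ν f) := by
  unfold M
  exact Measurable.iSup (fun k => G.measurable_of_idx k _ (fun x y h => G.av_eq ν f h))

lemma av_mono (ν : Measure α) (k : ℤ) {f g : α → ℝ≥0∞} (h : f ≤ g) (x : α) :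
    G.av ν k f x ≤ G.av ν k g x := by
  unfold av; gcongr; exact h _

lemma M_mono (ν : Measure α) {f g : α → ℝ≥0∞} (h : f ≤ g) (x : α) :
    G.M ν f x ≤ G.M ν g x := iSup_mono fun k => G.av_mono ν k h x

lemma stopping_bound (ν : Measure α) (bad : ℤ → α → Prop)
    (hbad : ∀ k x y, G.idx k x = G.idx k y → bad k x → bad k y) (N : ℤ) (F H : α → ℝ≥0∞)
    (h : ∀ k ≤ N, ∀ x, bad k x → (∀ l, k < l → l ≤ N → ¬ bad l x) →
      ∫⁻ y in G.cube k x, F y ∂ν ≤ ∫⁻ y in G.cube k x, H y ∂ν) :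
    ∫⁻ x in {x | ∃ k ≤ N, bad k x}, F x ∂ν ≤ ∫⁻ x in {x | ∃ k ≤ N, bad k x}, H x ∂ν := by
  have := G.cnt
  set S : ℤ × G.ι → Set α := fun p => {x | p.1 ≤ N ∧ G.idx p.1 x = p.2 ∧ bad p.1 x ∧
    ∀ l, p.1 < l → l ≤ N → ¬ bad l x} with hS
  have hcl : ∀ p x, x ∈ S p → S p = G.cube p.1 x := by
    rintro ⟨k, i⟩ x ⟨h1, h2, h3, h4⟩
    simp only at h1 h2 h3 h4
    ext y
    constructor
    · rintro ⟨_, h2', -, -⟩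
      exact h2'.trans h2.symm
    · intro hy
      have hy' : G.idx k y = G.idx k x := hy
      refine ⟨h1, hy'.trans h2, hbad k x y hy'.symm h3, ?_⟩
      intro l hl hlN hb
      exact h4 l hl hlN (hbad l y x (G.nest_le hl.le _ _ hy') hb)
  have hU : {x | ∃ k ≤ N, bad k x} = ⋃ p, S p := by
    ext x
    simp only [mem_ofPred_eq, mem_iUnion]
    constructor
    · rintro ⟨k, hk, hb⟩
      obtain ⟨m, ⟨hm, hmb⟩, hmax⟩ := Int.exists_greatest_of_bdd (P := fun k => k ≤ N ∧ bad k x)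
        ⟨N, fun z hz => hz.1⟩ ⟨k, hk, hb⟩
      refine ⟨(m, G.idx m x), hm, rfl, hmb, ?_⟩
      intro l hl hlN hb'
      have := hmax l ⟨hlN, hb'⟩
      simp only at hl
      omega
    · rintro ⟨⟨k, i⟩, h1, h2, h3, h4⟩
      exact ⟨k, h1, h3⟩
  have hmeas : ∀ p, MeasurableSet (S p) := by
    intro p
    rcases (S p).eq_empty_or_nonempty with he | ⟨x, hx⟩
    · rw [he]; exact MeasurableSet.empty
    · rw [hcl p x hx]; exact G.measurableSet_cube _ _
  have hdisj : Pairwise (Function.onFun Disjoint S) := by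
    rintro ⟨k, i⟩ ⟨l, j⟩ hne
    rw [Function.onFun, Set.disjoint_left]
    rintro x ⟨h1, h2, h3, h4⟩ ⟨h1', h2', h3', h4'⟩
    simp only at h1 h2 h3 h4 h1' h2' h3' h4'
    rcases lt_trichotomy k l with hlt | heq | hgt
    · exact h4 l hlt h1' h3'
    · subst heq; exact hne (by rw [← h2, ← h2'])
    · exact h4' k hgt h1 h3
  rw [hU, lintegral_iUnion hmeas hdisj, lintegral_iUnion hmeas hdisj]
  refine ENNReal.tsum_le_tsum fun p => ?_
  rcases (S p).eq_empty_or_nonempty with he | ⟨x, hx⟩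
  · rw [he]; simp
  · rw [hcl p x hx]
    exact h p.1 hx.1 x hx.2.2.1 hx.2.2.2

lemma weak (ν : Measure α) (f : α → ℝ≥0∞) (t : ℝ≥0∞) :
    t * ν {x | t < G.M ν f x} ≤ ∫⁻ x, f x ∂ν := by
  have hU : {x | t < G.M ν f x} = ⋃ N : ℕ, {x | ∃ k ≤ (N : ℤ), t < G.av ν k f x} := by
    ext x
    simp only [M, mem_ofPred_eq, lt_iSup_iff, mem_iUnion]
    constructor
    · rintro ⟨k, hk⟩
      exact ⟨k.toNat, k, Int.self_le_toNat k, hk⟩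
    · rintro ⟨N, k, -, hk⟩
      exact ⟨k, hk⟩
  have hmono : Monotone fun N : ℕ => {x | ∃ k ≤ (N : ℤ), t < G.av ν k f x} := by
    intro N N' hN x
    rintro ⟨k, hk, h⟩
    exact ⟨k, hk.trans (by exact_mod_cast hN), h⟩
  rw [hU, hmono.measure_iUnion, ENNReal.mul_iSup]
  refine iSup_le fun N => ?_
  have h1 := G.stopping_bound ν (fun k x => t < G.av ν k f x)
    (fun k x y h hb => by simpa only [G.av_eq ν f h] using hb) N (fun _ => t) f ?_
  · rw [setLIntegral_const] at h1
    exact h1.trans (setLIntegral_le_lintegral _ _)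
  · intro k _ x hx _
    rw [setLIntegral_const]
    unfold av at hx
    by_cases h0 : ν (G.cube k x) = 0
    · rw [h0]; simp
    by_cases hT : ν (G.cube k x) = ∞
    · rw [hT] at hx; simp at hx
    · rw [mul_comm]
      calc ν (G.cube k x) * t ≤ ν (G.cube k x) * ((ν (G.cube k x))⁻¹ * ∫⁻ y in G.cube k x, f y ∂ν) := by
            gcongr
        _ = _ := by rw [← mul_assoc, ENNReal.mul_inv_cancel h0 hT, one_mul]

end DGrid

lemma lintegral_pow_layer (p : ℝ) (hp : 0 < p) (g : ℝ≥0∞) :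
    ∫⁻ t in Ioi (0:ℝ), ENNReal.ofReal (t ^ (p - 1)) * (if ENNReal.ofReal t < g then 1 else 0)
      = ENNReal.ofReal p⁻¹ * g ^ p := by
  have key : ∀ c : ℝ, 0 ≤ c → ∫⁻ t in Ioc 0 c, ENNReal.ofReal (t ^ (p - 1)) = ENNReal.ofReal p⁻¹ * (ENNReal.ofReal c) ^ p := by
    intro c hc
    rw [← ofReal_integral_eq_lintegral_ofReal]
    · rw [← intervalIntegral.integral_of_le hc, integral_rpow (Or.inl (by linarith)),
        ENNReal.ofReal_rpow_of_nonneg hc hp.le, ← ENNReal.ofReal_mul (by positivity)]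
      congr 1
      rw [sub_add_cancel, Real.zero_rpow hp.ne']; ring
    · have := (intervalIntegral.intervalIntegrable_rpow' (a := 0) (b := c) (r := p - 1) (by linarith))
      exact (intervalIntegrable_iff_integrableOn_Ioc_of_le hc).1 this
    · filter_upwards [ae_restrict_mem measurableSet_Ioc] with t ht
      exact Real.rpow_nonneg ht.1.le _
  have key2 : ∀ g : ℝ≥0∞, g ≠ ∞ → ∫⁻ t in Ioi (0:ℝ), ENNReal.ofReal (t ^ (p - 1)) * (if ENNReal.ofReal t < g then 1 else 0)
      = ENNReal.ofReal p⁻¹ * g ^ p := by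
    intro g hg
    obtain ⟨c, hc, rfl⟩ : ∃ c : ℝ, 0 ≤ c ∧ g = ENNReal.ofReal c :=
      ⟨g.toReal, ENNReal.toReal_nonneg, (ENNReal.ofReal_toReal hg).symm⟩
    rw [← key c hc, setLIntegral_congr (Ioo_ae_eq_Ioc (μ := volume) (a := (0:ℝ)) (b := c)).symm]
    rw [← lintegral_indicator measurableSet_Ioi, ← lintegral_indicator measurableSet_Ioo]
    congr 1
    ext t
    by_cases ht : 0 < t
    · simp only [indicator, mem_Ioi, ht, mem_Ioo, true_and, if_true,
        ENNReal.ofReal_lt_ofReal_iff_of_nonneg ht.le]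
      split_ifs <;> simp
    · simp [indicator, ht]
  by_cases hg : g = ∞
  · subst hg
    rw [ENNReal.top_rpow_of_pos hp, ENNReal.mul_top (by simpa using hp)]
    refine ENNReal.eq_top_of_forall_nnreal_le fun r => ?_
    have hle : ENNReal.ofReal p⁻¹ * (((ENNReal.ofReal p * r) ^ (1/p)) ^ p) = r := by
      rw [← ENNReal.rpow_mul, one_div, inv_mul_cancel₀ hp.ne', ENNReal.rpow_one, ← mul_assoc,
        ← ENNReal.ofReal_mul (by positivity), inv_mul_cancel₀ hp.ne']
      simp
    rw [← hle, ← key2 _ (by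
      apply ENNReal.rpow_ne_top_of_nonneg (by positivity)
      exact ENNReal.mul_ne_top ENNReal.ofReal_ne_top ENNReal.coe_ne_top)]
    gcongr with t
    split_ifs <;> simp_all
  · exact key2 g hg

namespace DGrid
variable {α : Type} [MeasurableSpace α] (G : DGrid α)

/-- the L^p constant of dyadic maximal operators -/
def MC (p : ℝ) : ℝ≥0∞ := 2 ^ p * (ENNReal.ofReal p * ENNReal.ofReal (p - 1)⁻¹)

lemma MC_ne_top (p : ℝ) (hp : 0 ≤ p) : MC p ≠ ∞ := by
  unfold MC
  exact ENNReal.mul_ne_top (ENNReal.rpow_ne_top_of_nonneg hp (by simp))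
    (ENNReal.mul_ne_top ENNReal.ofReal_ne_top ENNReal.ofReal_ne_top)

lemma weak2 (ν : Measure α) (f : α → ℝ≥0∞) (t : ℝ≥0∞) :
    t * ν {x | 2 * t < G.M ν f x} ≤ ∫⁻ x, f x * (if t < f x then 1 else 0) ∂ν := by
  refine le_trans ?_ (G.weak ν (fun x => f x * (if t < f x then 1 else 0)) t)
  refine mul_le_mul_right (measure_mono fun x hx => ?_) t
  have hle : G.M ν f x ≤ G.M ν (fun x => f x * (if t < f x then 1 else 0)) x + t := by
    refine iSup_le fun k => ?_
    refine le_trans ?_ (add_le_add_left (G.av_le_M ν k _ x) t)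
    unfold av
    calc (ν (G.cube k x))⁻¹ * ∫⁻ y in G.cube k x, f y ∂ν
        ≤ (ν (G.cube k x))⁻¹ * ∫⁻ y in G.cube k x, (f y * (if t < f y then 1 else 0) + t) ∂ν := by
          gcongr with y
          split_ifs with h
          · simp
          · simpa using h
      _ = (ν (G.cube k x))⁻¹ * ∫⁻ y in G.cube k x, (f y * (if t < f y then 1 else 0)) ∂ν
          + (ν (G.cube k x))⁻¹ * ν (G.cube k x) * t := by
          rw [lintegral_add_right _ measurable_const, setLIntegral_const, mul_add]
          congr 1; ring
      _ ≤ _ := by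
          gcongr
          calc _ ≤ 1 * t := by gcongr; exact ENNReal.inv_mul_le_one _
            _ = t := one_mul t
  by_contra hcon
  rw [mem_ofPred_eq, not_lt] at hcon
  have : G.M ν f x ≤ 2 * t := hle.trans (by rw [two_mul]; gcongr)
  exact absurd hx (not_lt.2 this)

lemma strong (ν : Measure α) [SFinite ν] {p : ℝ} (hp : 1 < p) {f : α → ℝ≥0∞} (hf : Measurable f) :
    ∫⁻ x, (G.M ν f x) ^ p ∂ν ≤ MC p * ∫⁻ x, (f x) ^ p ∂ν := by
  have hp0 : 0 < p := by linarith
  have hM := G.measurable_M ν f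
  -- step 1
  have e1 : ∀ x, (G.M ν f x) ^ p = 2 ^ p * (ENNReal.ofReal p * (∫⁻ t in Ioi (0:ℝ),
      ENNReal.ofReal (t ^ (p - 1)) * (if ENNReal.ofReal t < G.M ν f x / 2 then 1 else 0))) := by
    intro x
    rw [lintegral_pow_layer p hp0, ← mul_assoc (ENNReal.ofReal p), ← ENNReal.ofReal_mul hp0.le,
      mul_inv_cancel₀ hp0.ne', ENNReal.ofReal_one, one_mul, ← ENNReal.mul_rpow_of_nonneg _ _ hp0.le,
      ENNReal.mul_div_cancel (by simp) (by simp)]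
  have e2 : ∀ x, ENNReal.ofReal (p - 1)⁻¹ * (f x) ^ p = f x * ∫⁻ t in Ioi (0:ℝ),
      ENNReal.ofReal (t ^ (p - 1 - 1)) * (if ENNReal.ofReal t < f x then 1 else 0) := by
    intro x
    rw [lintegral_pow_layer (p - 1) (by linarith)]
    have : f x ^ p = f x * f x ^ (p - 1) := by
      nth_rewrite 2 [← ENNReal.rpow_one (f x)]
      rw [← ENNReal.rpow_add_of_nonneg _ _ (by simp) (by linarith)]
      congr 1; ring
    rw [this]; ring
  have m1 : Measurable (fun q : α × ℝ => ENNReal.ofReal (q.2 ^ (p - 1)) *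
      (if ENNReal.ofReal q.2 < G.M ν f q.1 / 2 then (1:ℝ≥0∞) else 0)) := by
    refine Measurable.mul (by fun_prop) (Measurable.ite ?_ measurable_const measurable_const)
    exact measurableSet_lt (by fun_prop) (by fun_prop)
  have m2 : Measurable (fun q : α × ℝ => f q.1 * (ENNReal.ofReal (q.2 ^ (p - 1 - 1)) *
      (if ENNReal.ofReal q.2 < f q.1 then (1:ℝ≥0∞) else 0))) := by
    refine Measurable.mul (by fun_prop) (Measurable.mul (by fun_prop) (Measurable.ite ?_ measurable_const measurable_const))
    exact measurableSet_lt (by fun_prop) (by fun_prop)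
  have m3 : ∀ x, Measurable (fun t : ℝ => ENNReal.ofReal (t ^ (p - 1 - 1)) *
      (if ENNReal.ofReal t < f x then (1:ℝ≥0∞) else 0)) := by
    intro x
    refine (Measurable.mul (by fun_prop) (Measurable.ite ?_ measurable_const measurable_const))
    exact measurableSet_lt (by fun_prop) (by fun_prop)
  unfold MC
  simp_rw [e1]
  rw [lintegral_const_mul' _ _ (ENNReal.rpow_ne_top_of_nonneg hp0.le (by simp)),
    lintegral_const_mul' _ _ ENNReal.ofReal_ne_top, mul_assoc, mul_assoc,
    ← lintegral_const_mul' (ENNReal.ofReal (p - 1)⁻¹) _ ENNReal.ofReal_ne_top]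
  simp_rw [e2]
  refine mul_le_mul_right (mul_le_mul_right ?_ _) _
  rw [lintegral_lintegral_swap m1.aemeasurable]
  have e3 : ∀ x, f x * ∫⁻ t in Ioi (0:ℝ),
      ENNReal.ofReal (t ^ (p - 1 - 1)) * (if ENNReal.ofReal t < f x then 1 else 0) = ∫⁻ t in Ioi (0:ℝ),
      f x * (ENNReal.ofReal (t ^ (p - 1 - 1)) * (if ENNReal.ofReal t < f x then 1 else 0)) :=
    fun x => (lintegral_const_mul _ (m3 x)).symm
  simp_rw [e3]
  have e4 := lintegral_lintegral_swap (μ := ν) (ν := volume.restrict (Ioi (0:ℝ)))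
    (f := fun x t => f x * (ENNReal.ofReal (t ^ (p - 1 - 1)) *
      (if ENNReal.ofReal t < f x then (1:ℝ≥0∞) else 0))) m2.aemeasurable
  rw [e4]
  refine setLIntegral_mono' measurableSet_Ioi fun t ht => ?_
  have ht : 0 < t := ht
  rw [lintegral_const_mul' _ _ ENNReal.ofReal_ne_top]
  have h0 : ∫⁻ x, (if ENNReal.ofReal t < G.M ν f x / 2 then (1:ℝ≥0∞) else 0) ∂ν
      = ν {x | 2 * ENNReal.ofReal t < G.M ν f x} := by
    rw [← lintegral_indicator_one (measurableSet_lt measurable_const hM)]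
    congr 1
    ext x
    simp only [indicator, mem_ofPred_eq, Pi.one_apply]
    congr 1
    rw [ENNReal.lt_div_iff_mul_lt (by simp) (by simp), mul_comm]
  rw [h0]
  have h1 := G.weak2 ν f (ENNReal.ofReal t)
  have : ENNReal.ofReal (t ^ (p - 1)) = ENNReal.ofReal (t ^ (p - 1 - 1)) * ENNReal.ofReal t := by
    rw [← ENNReal.ofReal_mul (by positivity)]
    congr 1
    rw [← Real.rpow_add_one ht.ne']; congr 1; ring
  rw [this, mul_assoc]
  calc _ ≤ ENNReal.ofReal (t ^ (p - 1 - 1)) * ∫⁻ x, f x * (if ENNReal.ofReal t < f x then 1 else 0) ∂ν := by gcongr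
    _ = _ := by
      rw [← lintegral_const_mul' _ _ ENNReal.ofReal_ne_top]
      congr 1; ext x; ring

end DGrid
end

noncomputable section

namespace DGrid
variable {α : Type} [MeasurableSpace α] (G : DGrid α)

/-- A measure giving positive finite mass to all cubes. -/
def Good (μ : Measure α) : Prop := ∀ k x, μ (G.cube k x) ≠ 0 ∧ μ (G.cube k x) ≠ ∞

/-- dyadic Muckenhoupt condition -/
def Ap (μ : Measure α) (p : ℝ) (K : ℝ≥0∞) (w : α → ℝ≥0∞) : Prop :=
  Measurable w ∧ (∀ᵐ x ∂μ, w x ≠ 0 ∧ w x ≠ ∞) ∧ ∀ k x,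
    (∫⁻ y in G.cube k x, w y ∂μ) * (∫⁻ y in G.cube k x, (w y) ^ (-(1 / (p - 1))) ∂μ) ^ (p - 1)
      ≤ K * μ (G.cube k x) ^ p

/-- the weighted constant -/
def KC (p : ℝ) (K : ℝ≥0∞) : ℝ≥0∞ := K ^ (p / (p - 1)) * (MC (p / (p - 1)) * MC p)

lemma KC_ne_top {p : ℝ} (hp : 1 < p) {K : ℝ≥0∞} (hK : K ≠ ∞) : KC p K ≠ ∞ := by
  have h : 0 ≤ p / (p - 1) := div_nonneg (by linarith) (by linarith)
  exact ENNReal.mul_ne_top (ENNReal.rpow_ne_top_of_nonneg h hK)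
    (ENNReal.mul_ne_top (MC_ne_top _ h) (MC_ne_top _ (by linarith)))

lemma pos_lint {μ : Measure α} (hG : G.Good μ) {w : α → ℝ≥0∞} (hw : Measurable w)
    (h : ∀ᵐ x ∂μ, w x ≠ 0) (k : ℤ) (x : α) : ∫⁻ y in G.cube k x, w y ∂μ ≠ 0 := by
  intro h0
  rw [lintegral_eq_zero_iff hw] at h0
  have h1 : ∀ᵐ y ∂(μ.restrict (G.cube k x)), False := by
    filter_upwards [h0, ae_restrict_of_ae h] with y hy hy'
    exact hy' hy
  have : μ.restrict (G.cube k x) = 0 := by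
    rw [← ae_eq_bot]; exact Filter.eventually_false_iff_eq_bot.1 h1
  rw [Measure.restrict_eq_zero] at this
  exact (hG k x).1 this

lemma muck {μ : Measure α} [SFinite μ] (hG : G.Good μ) {p : ℝ} (hp : 1 < p) {K : ℝ≥0∞}
    (hK : K ≠ ∞) {w : α → ℝ≥0∞} (hw : G.Ap μ p K w) {f : α → ℝ≥0∞} (hf : Measurable f) :
    ∫⁻ x, (G.M μ f x) ^ p * w x ∂μ ≤ KC p K * ∫⁻ x, (f x) ^ p * w x ∂μ := by
  obtain ⟨hwm, hwae, hA⟩ := hw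
  have hp0 : 0 < p := by linarith
  have hp1 : 0 < p - 1 := by linarith
  have hp1' : p - 1 ≠ 0 := hp1.ne'
  set p' := p / (p - 1) with hp'
  have hp'1 : 1 < p' := by rw [hp', lt_div_iff₀ hp1]; linarith
  set σ : α → ℝ≥0∞ := fun x => w x ^ (-(1 / (p - 1))) with hσ
  have hσm : Measurable σ := by fun_prop
  have hσae : ∀ᵐ x ∂μ, σ x ≠ 0 ∧ σ x ≠ ∞ := by
    filter_upwards [hwae] with x hx
    refine ⟨fun h => ?_, fun h => ?_⟩
    · rw [hσ] at h; simp only [ENNReal.rpow_eq_zero_iff] at h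
      rcases h with h | h
      · exact hx.1 h.1
      · exact hx.2 h.1
    · rw [hσ] at h; simp only [ENNReal.rpow_eq_top_iff] at h
      rcases h with h | h
      · exact hx.1 h.1
      · exact hx.2 h.1
  set g := G.M (μ.withDensity σ) (fun x => f x * (σ x)⁻¹) with hg
  have hgm : Measurable g := G.measurable_M _ _
  set H : α → ℝ≥0∞ := fun x => g x ^ (p - 1) * (w x)⁻¹ with hH
  have hHm : Measurable H := by fun_prop
  have key : ∀ k x, (G.av μ k f x) ^ (p - 1) ≤ K * G.M (μ.withDensity w) H x := by
    intro k x
    set Q := G.cube k x with hQ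
    have hQm : MeasurableSet Q := G.measurableSet_cube k x
    obtain ⟨hm0, hmT⟩ := hG k x
    set m := μ Q with hm
    have hAQ := hA k x
    set W := ∫⁻ y in Q, w y ∂μ with hW
    set S := ∫⁻ y in Q, σ y ∂μ with hS
    have hW0 : W ≠ 0 := G.pos_lint hG hwm (hwae.mono fun _ h => h.1) k x
    have hS0 : S ≠ 0 := G.pos_lint hG hσm (hσae.mono fun _ h => h.1) k x
    have hb : W * S ^ (p - 1) ≠ ∞ := ne_top_of_le_ne_top
      (ENNReal.mul_ne_top hK (ENNReal.rpow_ne_top_of_nonneg hp0.le hmT)) hAQ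
    have hWT : W ≠ ∞ := by
      intro h
      rw [h, ENNReal.top_mul] at hb
      · exact hb rfl
      · intro h'; rw [ENNReal.rpow_eq_zero_iff] at h'
        rcases h' with h' | h'
        · exact hS0 h'.1
        · linarith [h'.2]
    have hST : S ≠ ∞ := by
      intro h
      rw [h, ENNReal.top_rpow_of_pos hp1, ENNReal.mul_top hW0] at hb
      exact hb rfl
    set a := G.av (μ.withDensity σ) k (fun x => f x * (σ x)⁻¹) x with ha
    have hfS : ∫⁻ y in Q, f y ∂μ = S * a := by
      have h1 : a = S⁻¹ * ∫⁻ y in Q, f y ∂μ := by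
        rw [ha, av, withDensity_apply _ hQm, setLIntegral_withDensity_eq_setLIntegral_mul _ hσm
          (by fun_prop) hQm]
        congr 1
        refine lintegral_congr_ae (ae_restrict_of_ae ?_)
        filter_upwards [hσae] with y hy
        simp only [Pi.mul_apply]
        rw [mul_comm, mul_assoc, ENNReal.inv_mul_cancel hy.1 hy.2, mul_one]
      rw [h1, ← mul_assoc, ENNReal.mul_inv_cancel hS0 hST, one_mul]
    set X := G.M (μ.withDensity w) H x with hX
    have h2 : m * a ^ (p - 1) ≤ W * X := by
      calc m * a ^ (p - 1) = ∫⁻ y in Q, a ^ (p - 1) ∂μ := by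
            rw [setLIntegral_const, mul_comm]
        _ ≤ ∫⁻ y in Q, g y ^ (p - 1) ∂μ := by
            refine setLIntegral_mono' hQm fun y hy => ?_
            gcongr
            rw [ha, G.av_eq _ _ (show G.idx k x = G.idx k y from Eq.symm hy)]
            exact G.av_le_M _ _ _ _
        _ = ∫⁻ y in Q, w y * H y ∂μ := by
            refine lintegral_congr_ae (ae_restrict_of_ae ?_)
            filter_upwards [hwae] with y hy
            rw [hH]; simp only
            rw [mul_comm, mul_assoc, ENNReal.inv_mul_cancel hy.1 hy.2, mul_one]
        _ = W * G.av (μ.withDensity w) k H x := by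
            rw [av, withDensity_apply _ hQm, setLIntegral_withDensity_eq_setLIntegral_mul _ hwm hHm hQm,
              ← mul_assoc, ENNReal.mul_inv_cancel hW0 hWT, one_mul]
            rfl
        _ ≤ W * X := by gcongr; exact G.av_le_M _ _ _ _
    have hmp0 : m ^ p ≠ 0 := by
      intro h; rw [ENNReal.rpow_eq_zero_iff] at h
      rcases h with h | h
      · exact hm0 h.1
      · exact hmT h.1
    have hmpT : m ^ p ≠ ∞ := ENNReal.rpow_ne_top_of_nonneg hp0.le hmT
    rw [← ENNReal.mul_le_mul_iff_right hmp0 hmpT]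
    have hmp : m ^ p = m * m ^ (p - 1) := by
      nth_rewrite 2 [← ENNReal.rpow_one m]
      rw [← ENNReal.rpow_add _ _ hm0 hmT]; congr 1; ring
    calc m ^ p * (G.av μ k f x) ^ (p - 1)
        = m * (m * G.av μ k f x) ^ (p - 1) := by
          rw [ENNReal.mul_rpow_of_nonneg _ _ hp1.le, hmp, mul_assoc]
      _ = m * (S * a) ^ (p - 1) := by
          rw [av, ← mul_assoc, ENNReal.mul_inv_cancel hm0 hmT, one_mul, hfS]
      _ = S ^ (p - 1) * (m * a ^ (p - 1)) := by
          rw [ENNReal.mul_rpow_of_nonneg _ _ hp1.le]; ring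
      _ ≤ S ^ (p - 1) * (W * X) := by gcongr
      _ = (W * S ^ (p - 1)) * X := by ring
      _ ≤ (K * m ^ p) * X := by gcongr
      _ = _ := by ring
  have key2 : ∀ x, (G.M μ f x) ^ p ≤ K ^ p' * (G.M (μ.withDensity w) H x) ^ p' := by
    intro x
    rw [← ENNReal.mul_rpow_of_nonneg _ _ (by linarith)]
    have : G.M μ f x ≤ (K * G.M (μ.withDensity w) H x) ^ (1 / (p - 1)) := by
      refine iSup_le fun k => ?_
      rw [one_div, ENNReal.le_rpow_inv_iff hp1]
      exact key k x
    calc _ ≤ ((K * G.M (μ.withDensity w) H x) ^ (1 / (p - 1))) ^ p := by gcongr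
      _ = _ := by rw [← ENNReal.rpow_mul]; congr 1; rw [hp']; ring
  calc ∫⁻ x, (G.M μ f x) ^ p * w x ∂μ
      ≤ ∫⁻ x, K ^ p' * (w x * (G.M (μ.withDensity w) H x) ^ p') ∂μ := by
        refine lintegral_mono fun x => ?_
        calc _ ≤ (K ^ p' * (G.M (μ.withDensity w) H x) ^ p') * w x := by gcongr; exact key2 x
          _ = _ := by ring
    _ = K ^ p' * ∫⁻ x, (G.M (μ.withDensity w) H x) ^ p' ∂(μ.withDensity w) := by
        rw [lintegral_const_mul' _ _ (ENNReal.rpow_ne_top_of_nonneg (by linarith) hK),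
          lintegral_withDensity_eq_lintegral_mul _ hwm ((G.measurable_M _ _).pow_const _)]
        rfl
    _ ≤ K ^ p' * (MC p' * ∫⁻ x, (H x) ^ p' ∂(μ.withDensity w)) := by
        gcongr; exact G.strong _ hp'1 hHm
    _ = K ^ p' * (MC p' * ∫⁻ x, (g x) ^ p ∂(μ.withDensity σ)) := by
        rw [lintegral_withDensity_eq_lintegral_mul _ hwm (by fun_prop),
          lintegral_withDensity_eq_lintegral_mul _ hσm (by fun_prop)]
        congr 2
        refine lintegral_congr_ae ?_
        filter_upwards [hwae] with x hx
        simp only [Pi.mul_apply, hH, hσ]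
        rw [ENNReal.mul_rpow_of_nonneg _ _ (by linarith), ← ENNReal.rpow_mul,
          mul_comm (w x), mul_assoc, mul_comm]
        congr 1
        · rw [← ENNReal.rpow_neg_one, ← ENNReal.rpow_mul]
          nth_rewrite 2 [← ENNReal.rpow_one (w x)]
          rw [← ENNReal.rpow_add _ _ hx.1 hx.2]
          congr 1; rw [hp']; field_simp; ring
        · congr 1; rw [hp']; field_simp
    _ ≤ K ^ p' * (MC p' * (MC p * ∫⁻ x, (f x * (σ x)⁻¹) ^ p ∂(μ.withDensity σ))) := by
        gcongr; exact G.strong _ hp (by fun_prop)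
    _ = K ^ p' * (MC p' * (MC p * ∫⁻ x, (f x) ^ p * w x ∂μ)) := by
        rw [lintegral_withDensity_eq_lintegral_mul _ hσm (by fun_prop)]
        congr 3
        refine lintegral_congr_ae ?_
        filter_upwards [hwae] with x hx
        simp only [Pi.mul_apply, hσ]
        rw [ENNReal.mul_rpow_of_nonneg _ _ (by linarith), mul_comm, mul_assoc]
        congr 1
        rw [← ENNReal.rpow_neg_one, ← ENNReal.rpow_mul, ← ENNReal.rpow_mul,
          ← ENNReal.rpow_add _ _ hx.1 hx.2]
        nth_rewrite 2 [← ENNReal.rpow_one (w x)]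
        congr 1; field_simp; ring
    _ = _ := by unfold KC; ring

/-- dual weight -/
lemma Ap_dual {μ : Measure α} {p : ℝ} (hp : 1 < p) {K : ℝ≥0∞}
    {w : α → ℝ≥0∞} (hw : G.Ap μ p K w) :
    G.Ap μ (p / (p - 1)) (K ^ (1 / (p - 1))) (fun x => w x ^ (-(1 / (p - 1)))) := by
  obtain ⟨hwm, hwae, hA⟩ := hw
  have hp1 : 0 < p - 1 := by linarith
  have e1 : p / (p - 1) - 1 = 1 / (p - 1) := by field_simp; ring
  refine ⟨by fun_prop, ?_, fun k x => ?_⟩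
  · filter_upwards [hwae] with x hx
    refine ⟨fun h => ?_, fun h => ?_⟩
    · simp only [ENNReal.rpow_eq_zero_iff] at h
      rcases h with h | h
      · exact hx.1 h.1
      · exact hx.2 h.1
    · simp only [ENNReal.rpow_eq_top_iff] at h
      rcases h with h | h
      · exact hx.1 h.1
      · exact hx.2 h.1
  · have e2 : ∀ y, (w y ^ (-(1 / (p - 1)))) ^ (-(1 / (p / (p - 1) - 1))) = w y := by
      intro y
      rw [← ENNReal.rpow_mul, e1]
      nth_rewrite 2 [← ENNReal.rpow_one (w y)]
      congr 1; field_simp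
    simp_rw [e2]
    have h1 := ENNReal.rpow_le_rpow (hA k x) (show 0 ≤ 1 / (p - 1) by positivity)
    rw [ENNReal.mul_rpow_of_nonneg _ _ (by positivity), ENNReal.mul_rpow_of_nonneg _ _ (by positivity),
      ← ENNReal.rpow_mul, ← ENNReal.rpow_mul, mul_one_div_cancel hp1.ne', ENNReal.rpow_one, mul_one_div] at h1
    rw [e1, mul_comm]
    exact h1

end DGrid
end

noncomputable section

lemma ennreal_lim {X c a b : ℝ≥0∞} (hc : c ≠ ∞) (ha : a ≠ ∞) (hb : b ≠ ∞)
    (h : ∀ ε : ℝ≥0∞, ε ≠ 0 → ε ≠ ∞ → X ≤ c * ((a + ε) * (b + ε))) : X ≤ c * (a * b) := by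
  refine ENNReal.le_of_forall_pos_le_add fun ε hε _ => ?_
  set D := c * (a + b + 1) + 1 with hD
  have hDT : D ≠ ∞ := by
    simp [hD, ENNReal.mul_eq_top, hc, ha, hb]
  have hD0 : D ≠ 0 := by simp [hD]
  set η : ℝ≥0∞ := min 1 (ε / D) with hη
  have hη0 : η ≠ 0 := by
    rw [hη]; simp [hε.ne', hDT]
  have h1 := h η hη0 (ne_top_of_le_ne_top (by simp) (min_le_left _ _))
  have hη1 : η ≤ 1 := min_le_left _ _
  calc X ≤ c * ((a + η) * (b + η)) := h1
    _ = c * (a * b) + (c * (a + b + η)) * η := by ring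
    _ ≤ c * (a * b) + (c * (a + b + 1) + 1) * (ε / D) := by
        gcongr
        · exact (show c * (a + b + η) ≤ c * (a + b + 1) by gcongr).trans le_self_add
        · exact min_le_right _ _
    _ = c * (a * b) + ε := by rw [← hD, ENNReal.mul_div_cancel hD0 hDT]

variable {α : Type} [MeasurableSpace α]

/-- an abstract function norm -/
structure FNorm (Φ : (α → ℝ≥0∞) → ℝ≥0∞) : Prop where
  zero : Φ (fun _ => 0) = 0
  smul : ∀ c : ℝ≥0∞, c ≠ ∞ → ∀ g, Measurable g → Φ (fun x => c * g x) = c * Φ g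
  add : ∀ f g, Measurable f → Measurable g → Φ (fun x => f x + g x) ≤ Φ f + Φ g
  sup : ∀ g : ℕ → α → ℝ≥0∞, (∀ k, Measurable (g k)) → Monotone g →
    Φ (fun x => ⨆ k, g k x) ≤ ⨆ k, Φ (g k)

lemma FNorm.sum {Φ : (α → ℝ≥0∞) → ℝ≥0∞} (hΦ : FNorm Φ) (g : ℕ → α → ℝ≥0∞)
    (hg : ∀ k, Measurable (g k)) (n : ℕ) :
    Φ (fun x => ∑ k ∈ Finset.range n, g k x) ≤ ∑ k ∈ Finset.range n, Φ (g k) := by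
  induction n with
  | zero => simp [hΦ.zero]
  | succ n ih =>
    simp_rw [Finset.sum_range_succ]
    refine (hΦ.add _ _ (by fun_prop) (hg n)).trans ?_
    gcongr

lemma FNorm.tsum {Φ : (α → ℝ≥0∞) → ℝ≥0∞} (hΦ : FNorm Φ) (g : ℕ → α → ℝ≥0∞)
    (hg : ∀ k, Measurable (g k)) : Φ (fun x => ∑' k, g k x) ≤ ∑' k, Φ (g k) := by
  simp_rw [ENNReal.tsum_eq_iSup_nat]
  refine (hΦ.sup (fun n x => ∑ k ∈ Finset.range n, g k x) (fun n => by fun_prop) ?_).trans ?_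
  · intro n m hnm x
    exact Finset.sum_le_sum_of_subset (Finset.range_mono hnm)
  · exact iSup_mono fun n => hΦ.sum g hg n

namespace DGrid
variable (G : DGrid α)

lemma M_tsum (μ : Measure α) (g : ℕ → α → ℝ≥0∞) (hg : ∀ k, Measurable (g k)) (x : α) :
    G.M μ (fun x => ∑' k, g k x) x ≤ ∑' k, G.M μ (g k) x := by
  refine iSup_le fun k => ?_
  unfold av
  rw [lintegral_tsum (fun i => (hg i).aemeasurable), ← ENNReal.tsum_mul_left]
  exact ENNReal.tsum_le_tsum fun i => G.av_le_M μ k (g i) x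

lemma M_smul (μ : Measure α) (c : ℝ≥0∞) (hc : c ≠ ∞) (g : α → ℝ≥0∞) (x : α) :
    G.M μ (fun x => c * g x) x = c * G.M μ g x := by
  unfold M av
  rw [ENNReal.mul_iSup]
  congr 1; ext k
  rw [lintegral_const_mul' _ _ hc]; ring

lemma rdf (μ : Measure α) {Φ : (α → ℝ≥0∞) → ℝ≥0∞} (hΦ : FNorm Φ) {B : ℝ≥0∞} (hB : B ≠ ∞)
    (hB0 : B ≠ 0)
    (hM : ∀ g, Measurable g → Φ (G.M μ g) ≤ B * Φ g) {h : α → ℝ≥0∞} (hh : Measurable h) :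
    ∃ H, Measurable H ∧ h ≤ H ∧ Φ H ≤ 2 * Φ h ∧ ∀ x, G.M μ H x ≤ 2 * B * H x := by
  set It : ℕ → α → ℝ≥0∞ := fun k => (G.M μ)^[k] h with hIt
  have hItm : ∀ k, Measurable (It k) := by
    intro k
    cases k with
    | zero => exact hh
    | succ k => rw [hIt]; simp only [Function.iterate_succ_apply']; exact G.measurable_M _ _
  have hIts : ∀ k, It (k + 1) = G.M μ (It k) := fun k => by
    rw [hIt]; simp only [Function.iterate_succ_apply']
  have hItn : ∀ k, Φ (It k) ≤ B ^ k * Φ h := by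
    intro k
    induction k with
    | zero => simp [hIt]
    | succ k ih =>
      rw [hIts]
      refine (hM _ (hItm k)).trans ?_
      rw [pow_succ, mul_comm _ B, mul_assoc]; gcongr
  have h2B0 : 2 * B ≠ 0 := by simp [hB0]
  have h2BT : 2 * B ≠ ∞ := ENNReal.mul_ne_top (by simp) hB
  have hcT : ∀ k : ℕ, ((2 * B)⁻¹) ^ k ≠ ∞ := fun k => ENNReal.pow_ne_top (by simp [hB0])
  set gk : ℕ → α → ℝ≥0∞ := fun k x => ((2 * B)⁻¹) ^ k * It k x with hgk
  have hgkm : ∀ k, Measurable (gk k) := fun k => (hItm k).const_mul _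
  refine ⟨fun x => ∑' k, gk k x, Measurable.ennreal_tsum hgkm, ?_, ?_, ?_⟩
  · intro x
    refine le_trans ?_ (ENNReal.le_tsum 0)
    simp [hgk, hIt]
  · refine (hΦ.tsum gk hgkm).trans ?_
    calc ∑' k, Φ (gk k) ≤ ∑' k : ℕ, (2⁻¹ : ℝ≥0∞) ^ k * Φ h := by
          refine ENNReal.tsum_le_tsum fun k => ?_
          rw [hgk]; simp only
          rw [hΦ.smul _ (hcT k) _ (hItm k)]
          calc _ ≤ ((2 * B)⁻¹) ^ k * (B ^ k * Φ h) := by gcongr; exact hItn k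
            _ = ((2 * B)⁻¹ * B) ^ k * Φ h := by rw [mul_pow]; ring
            _ = _ := by
              rw [ENNReal.mul_inv (by simp) (by simp), mul_assoc, ENNReal.inv_mul_cancel hB0 hB, mul_one]
      _ = 2 * Φ h := by
          rw [ENNReal.tsum_mul_right, ENNReal.tsum_geometric]
          congr 1
          rw [ENNReal.one_sub_inv_two, inv_inv]
  · intro x
    refine (G.M_tsum μ gk hgkm x).trans ?_
    calc ∑' k, G.M μ (gk k) x = ∑' k, (2 * B) * gk (k + 1) x := by
          congr 1; ext k
          rw [hgk]; simp only
          rw [G.M_smul μ _ (hcT k), ← hIts, pow_succ', ← mul_assoc, ← mul_assoc,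
            ENNReal.mul_inv_cancel h2B0 h2BT, one_mul]
      _ = (2 * B) * ∑' k, gk (k + 1) x := ENNReal.tsum_mul_left
      _ ≤ _ := by
          gcongr
          exact ENNReal.tsum_comp_le_tsum_of_injective (add_left_injective 1) (fun k => gk k x)

end DGrid

/-- majorant property -/
def Maj (μ : Measure α) (Φ : (α → ℝ≥0∞) → ℝ≥0∞) (P : (α → ℝ≥0∞) → Prop) : Prop :=
  ∀ v, Measurable v → Φ v ≠ ∞ → ∀ ε : ℝ≥0∞, ε ≠ 0 → ε ≠ ∞ → ∃ V, Measurable V ∧ v ≤ V ∧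
    (∀ᵐ x ∂μ, V x ≠ 0 ∧ V x ≠ ∞) ∧ Φ V ≤ 2 * (Φ v + ε) ∧ P V

lemma DGrid.maj (G : DGrid α) {μ : Measure α} {Φ : (α → ℝ≥0∞) → ℝ≥0∞} (hΦ : FNorm Φ) {B : ℝ≥0∞}
    (hB : B ≠ ∞) (hB0 : B ≠ 0) (hM : ∀ g, Measurable g → Φ (G.M μ g) ≤ B * Φ g)
    (hpos : ∀ ε : ℝ≥0∞, ε ≠ 0 → ∃ φ : α → ℝ≥0∞, Measurable φ ∧ (∀ x, φ x ≠ 0) ∧ Φ φ ≤ ε)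
    (hfin : ∀ V, Measurable V → Φ V ≠ ∞ → ∀ᵐ x ∂μ, V x ≠ ∞) :
    Maj μ Φ (fun V => ∀ x, G.M μ V x ≤ 2 * B * V x) := by
  intro v hv hvT ε hε hεT
  obtain ⟨φ, hφm, hφ0, hφ⟩ := hpos ε hε
  obtain ⟨V, hVm, hV1, hV2, hV3⟩ := G.rdf μ hΦ hB hB0 hM (hv.add hφm)
  have h4 : Φ V ≤ 2 * (Φ v + ε) := by
    refine hV2.trans ?_
    gcongr
    exact (hΦ.add _ _ hv hφm).trans (by gcongr)
  refine ⟨V, hVm, fun x => le_self_add.trans (hV1 x), ?_, h4, hV3⟩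
  filter_upwards [hfin V hVm (ne_top_of_le_ne_top
    (ENNReal.mul_ne_top (by simp) (ENNReal.add_ne_top.2 ⟨hvT, hεT⟩)) h4)] with x hx
  refine ⟨fun h0 => ?_, hx⟩
  have := hV1 x
  rw [h0] at this
  simp at this
  exact hφ0 x this.2

lemma extrap_abs {μ : Measure α} {Φ Ψ : (α → ℝ≥0∞) → ℝ≥0∞} {PV PU : (α → ℝ≥0∞) → Prop}
    (majΦ : Maj μ Φ PV) (majΨ : Maj μ Ψ PU)
    (hold : ∀ V U, Measurable V → Measurable U → ∫⁻ x, V x * U x ∂μ ≤ Φ V * Ψ U)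
    {p : ℝ} (hp : 1 < p) {C : ℝ≥0∞} (hC : C ≠ ∞) {F g : α → ℝ≥0∞} (hF : Measurable F)
    (hg : Measurable g)
    (hyp : ∀ V U, Measurable V → Measurable U → (∀ᵐ x ∂μ, V x ≠ 0 ∧ V x ≠ ∞) →
      (∀ᵐ x ∂μ, U x ≠ 0 ∧ U x ≠ ∞) → PV V → PU U →
      ∫⁻ x, F x ^ p * (V x ^ (1 - p) * U x) ∂μ ≤ C * ∫⁻ x, g x ^ p * (V x ^ (1 - p) * U x) ∂μ)
    {u : α → ℝ≥0∞} (hu : Measurable u) (hgT : Φ g ≠ ∞) (huT : Ψ u ≠ ∞) :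
    ∫⁻ x, F x * u x ∂μ ≤ (C ^ (1 / p) * 4) * (Φ g * Ψ u) := by
  have hp0 : 0 < p := by linarith
  refine ennreal_lim (ENNReal.mul_ne_top (ENNReal.rpow_ne_top_of_nonneg (by positivity) hC) (by simp))
    hgT huT fun ε hε hεT => ?_
  obtain ⟨V, hVm, hV1, hV2, hV3, hV4⟩ := majΦ g hg hgT ε hε hεT
  obtain ⟨U, hUm, hU1, hU2, hU3, hU4⟩ := majΨ u hu huT ε hε hεT
  have hpq : p.HolderConjugate (p / (p - 1)) := Real.HolderConjugate.conjExponent hp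
  set p' := p / (p - 1) with hp'
  have hp'0 : 0 < p' := div_pos hp0 (by linarith)
  have e1 : 1 / p + 1 / p' = 1 := by
    rw [hp']; field_simp; ring
  have e2 : p - 1 = p / p' := by rw [hp']; field_simp
  set Z := ∫⁻ x, V x * U x ∂μ with hZ
  calc ∫⁻ x, F x * u x ∂μ
      ≤ ∫⁻ x, ((fun x => F x * (V x ^ (-(1 / p')) * U x ^ (1 / p))) *
          (fun x => V x ^ (1 / p') * U x ^ (1 / p'))) x ∂μ := by
        refine lintegral_mono_ae ?_
        filter_upwards [hV2, hU2] with x hVx hUx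
        simp only [Pi.mul_apply]
        have : F x * (V x ^ (-(1 / p')) * U x ^ (1 / p)) * (V x ^ (1 / p') * U x ^ (1 / p'))
          = F x * ((V x ^ (-(1 / p')) * V x ^ (1 / p')) * (U x ^ (1 / p) * U x ^ (1 / p'))) := by ring
        rw [this, ← ENNReal.rpow_add _ _ hVx.1 hVx.2, ← ENNReal.rpow_add _ _ hUx.1 hUx.2, e1]
        simp only [neg_add_cancel, ENNReal.rpow_zero, ENNReal.rpow_one, one_mul]
        gcongr; exact hU1 x
    _ ≤ (∫⁻ x, (F x * (V x ^ (-(1 / p')) * U x ^ (1 / p))) ^ p ∂μ) ^ (1 / p) *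
        (∫⁻ x, (V x ^ (1 / p') * U x ^ (1 / p')) ^ p' ∂μ) ^ (1 / p') :=
        ENNReal.lintegral_mul_le_Lp_mul_Lq μ hpq (by fun_prop) (by fun_prop)
    _ = (∫⁻ x, F x ^ p * (V x ^ (1 - p) * U x) ∂μ) ^ (1 / p) * Z ^ (1 / p') := by
        congr 3
        · ext x
          rw [ENNReal.mul_rpow_of_nonneg _ _ hp0.le, ENNReal.mul_rpow_of_nonneg _ _ hp0.le,
            ← ENNReal.rpow_mul, ← ENNReal.rpow_mul, one_div_mul_cancel hp0.ne', ENNReal.rpow_one]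
          congr 3
          have := e2; field_simp at this ⊢; linarith
        · ext x
          rw [ENNReal.mul_rpow_of_nonneg _ _ hp'0.le,
            ← ENNReal.rpow_mul, ← ENNReal.rpow_mul, one_div_mul_cancel hp'0.ne', ENNReal.rpow_one, ENNReal.rpow_one]
    _ ≤ (C * Z) ^ (1 / p) * Z ^ (1 / p') := by
        gcongr
        refine (hyp V U hVm hUm hV2 hU2 hV4 hU4).trans ?_
        gcongr
        refine lintegral_mono_ae ?_
        filter_upwards [hV2] with x hVx
        calc g x ^ p * (V x ^ (1 - p) * U x) ≤ V x ^ p * (V x ^ (1 - p) * U x) := by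
              gcongr; exact hV1 x
          _ = V x * U x := by
              rw [← mul_assoc, ← ENNReal.rpow_add _ _ hVx.1 hVx.2]
              simp
    _ = C ^ (1 / p) * Z := by
        rw [ENNReal.mul_rpow_of_nonneg _ _ (by positivity), mul_assoc,
          ← ENNReal.rpow_add_of_nonneg _ _ (by positivity) (by positivity), e1, ENNReal.rpow_one]
    _ ≤ C ^ (1 / p) * ((2 * (Φ g + ε)) * (2 * (Ψ u + ε))) := by
        gcongr
        exact (hold V U hVm hUm).trans (by gcongr)
    _ = _ := by ring

lemma DGrid.factA (G : DGrid α) {μ : Measure α} (hG : G.Good μ) {p : ℝ} (hp : 1 < p)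
    {A B : ℝ≥0∞} (hA : A ≠ ∞) (hB : B ≠ ∞)
    {V U : α → ℝ≥0∞} (hVm : Measurable V) (hUm : Measurable U)
    (hV : ∀ᵐ x ∂μ, V x ≠ 0 ∧ V x ≠ ∞) (hU : ∀ᵐ x ∂μ, U x ≠ 0 ∧ U x ≠ ∞)
    (hVA : ∀ x, G.M μ V x ≤ A * V x) (hUB : ∀ x, G.M μ U x ≤ B * U x) :
    G.Ap μ p (A ^ (p - 1) * B) (fun x => V x ^ (1 - p) * U x) := by
  have hp1 : 0 < p - 1 := by linarith
  have rpow_fin : ∀ (a : ℝ≥0∞) (r : ℝ), a ≠ 0 → a ≠ ∞ → a ^ r ≠ 0 ∧ a ^ r ≠ ∞ := by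
    intro a r h0 hT
    refine ⟨fun h => ?_, fun h => ?_⟩
    · simp only [ENNReal.rpow_eq_zero_iff] at h
      rcases h with h | h
      · exact h0 h.1
      · exact hT h.1
    · simp only [ENNReal.rpow_eq_top_iff] at h
      rcases h with h | h
      · exact h0 h.1
      · exact hT h.1
  refine ⟨by fun_prop, ?_, fun k x => ?_⟩
  · filter_upwards [hV, hU] with x hVx hUx
    have := rpow_fin (V x) (1 - p) hVx.1 hVx.2
    exact ⟨mul_ne_zero this.1 hUx.1, ENNReal.mul_ne_top this.2 hUx.2⟩
  · obtain ⟨hm0, hmT⟩ := hG k x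
    have hQm := G.measurableSet_cube k x
    -- general facts on A1 functions
    have gen : ∀ (Y : α → ℝ≥0∞) (D : ℝ≥0∞), D ≠ ∞ → Measurable Y → (∀ᵐ x ∂μ, Y x ≠ 0 ∧ Y x ≠ ∞) →
        (∀ x, G.M μ Y x ≤ D * Y x) → G.av μ k Y x ≠ 0 ∧ G.av μ k Y x ≠ ∞ ∧
        (∀ y ∈ G.cube k x, G.av μ k Y x ≤ D * Y y) ∧
        ∫⁻ y in G.cube k x, Y y ∂μ = μ (G.cube k x) * G.av μ k Y x := by
      intro Y D hD hYm hY hYD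
      have h3 : ∀ y ∈ G.cube k x, G.av μ k Y x ≤ D * Y y := by
        intro y hy
        rw [G.av_eq μ Y (show G.idx k x = G.idx k y from Eq.symm hy)]
        exact (G.av_le_M _ _ _ _).trans (hYD y)
      refine ⟨?_, ?_, h3, ?_⟩
      · exact mul_ne_zero (ENNReal.inv_ne_zero.2 hmT) (G.pos_lint hG hYm (hY.mono fun _ h => h.1) k x)
      · obtain ⟨y, hy, hy2⟩ : ∃ y ∈ G.cube k x, Y y ≠ ∞ := by
          by_contra hcon
          push Not at hcon
          apply hm0
          refine measure_mono_null (t := {y | ¬ (Y y ≠ 0 ∧ Y y ≠ ∞)}) (fun y hy => ?_) hY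
          intro h; exact h.2 (hcon y hy)
        exact ne_top_of_le_ne_top (ENNReal.mul_ne_top hD hy2) (h3 y hy)
      · rw [av, ← mul_assoc, ENNReal.mul_inv_cancel hm0 hmT, one_mul]
    obtain ⟨v0, vT, v1, v2⟩ := gen V A hA hVm hV hVA
    obtain ⟨u0, uT, u1, u2⟩ := gen U B hB hUm hU hUB
    set m := μ (G.cube k x)
    set v := G.av μ k V x
    set u := G.av μ k U x
    -- the pointwise reversed bounds
    have rev : ∀ (a b D : ℝ≥0∞) (r : ℝ), 0 < r → a ≠ 0 → a ≠ ∞ → D ≠ ∞ → b ≠ ∞ → a ≤ D * b →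
        b ^ (-r) ≤ D ^ r * a ^ (-r) := by
      intro a b D r hr ha haT hD hbT hab
      have hD0 : D ≠ 0 := by rintro rfl; simp at hab; exact ha hab
      have h1 : a ^ r ≤ D ^ r * b ^ r := by
        rw [← ENNReal.mul_rpow_of_nonneg _ _ hr.le]; gcongr
      have hb0 : b ≠ 0 := by rintro rfl; simp at hab; exact ha hab
      have har := rpow_fin a r ha haT
      have hbr := rpow_fin b r hb0 hbT
      rw [ENNReal.rpow_neg, ENNReal.rpow_neg, ← div_eq_mul_inv, ENNReal.le_div_iff_mul_le (Or.inl har.1) (Or.inl har.2)]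
      rw [mul_comm, ← div_eq_mul_inv]
      exact ENNReal.div_le_of_le_mul h1
    have I1 : ∫⁻ y in G.cube k x, V y ^ (1 - p) * U y ∂μ ≤ A ^ (p - 1) * v ^ (-(p - 1)) * (m * u) := by
      rw [← u2, ← lintegral_const_mul' _ _ (ENNReal.mul_ne_top
        (ENNReal.rpow_ne_top_of_nonneg hp1.le hA) (rpow_fin v _ v0 vT).2)]
      refine lintegral_mono_ae ?_
      filter_upwards [ae_restrict_mem hQm, ae_restrict_of_ae hV] with y hy hVy
      gcongr
      rw [show (1 - p) = -(p - 1) by ring]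
      exact rev _ _ _ _ hp1 v0 vT hA hVy.2 (v1 y hy)
    have I2 : ∫⁻ y in G.cube k x, (V y ^ (1 - p) * U y) ^ (-(1 / (p - 1))) ∂μ
        ≤ B ^ (1 / (p - 1)) * u ^ (-(1 / (p - 1))) * (m * v) := by
      rw [← v2, ← lintegral_const_mul' _ _ (ENNReal.mul_ne_top
        (ENNReal.rpow_ne_top_of_nonneg (by positivity) hB) (rpow_fin u _ u0 uT).2)]
      refine lintegral_mono_ae ?_
      filter_upwards [ae_restrict_mem hQm, ae_restrict_of_ae hV, ae_restrict_of_ae hU] with y hy hVy hUy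
      have hVp := rpow_fin (V y) (1 - p) hVy.1 hVy.2
      rw [ENNReal.mul_rpow_of_ne_zero hVp.1 hUy.1, ← ENNReal.rpow_mul, mul_comm]
      have : (1 - p) * (-(1 / (p - 1))) = 1 := by field_simp; ring
      rw [this, ENNReal.rpow_one]
      gcongr
      exact rev _ _ _ _ (by positivity) u0 uT hB hUy.2 (u1 y hy)
    calc _ ≤ (A ^ (p - 1) * v ^ (-(p - 1)) * (m * u)) * (B ^ (1 / (p - 1)) * u ^ (-(1 / (p - 1))) * (m * v)) ^ (p - 1) := by
          gcongr
      _ = A ^ (p - 1) * B * (m * m ^ (p - 1)) * (v ^ (-(p - 1)) * v ^ (p - 1)) * (u * u⁻¹) := by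
          rw [ENNReal.mul_rpow_of_nonneg _ _ hp1.le, ENNReal.mul_rpow_of_nonneg _ _ hp1.le,
            ENNReal.mul_rpow_of_nonneg _ _ hp1.le, ← ENNReal.rpow_mul, ← ENNReal.rpow_mul,
            one_div_mul_cancel hp1.ne', neg_mul, one_div_mul_cancel hp1.ne', ENNReal.rpow_one,
            ENNReal.rpow_neg_one]
          ring
      _ = A ^ (p - 1) * B * m ^ p := by
          rw [ENNReal.mul_inv_cancel u0 uT, ← ENNReal.rpow_add _ _ v0 vT]
          nth_rewrite 1 [← ENNReal.rpow_one m]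
          rw [← ENNReal.rpow_add _ _ hm0 hmT]
          simp
      _ ≤ _ := le_rfl
end

noncomputable section
variable {α : Type} [MeasurableSpace α]

/-- the Lebesgue norm with exponent p -/
def LpN (ν : Measure α) (p : ℝ) (h : α → ℝ≥0∞) : ℝ≥0∞ := (∫⁻ x, h x ^ p ∂ν) ^ (1 / p)

lemma LpN_pow (ν : Measure α) {p : ℝ} (hp : 0 < p) (h : α → ℝ≥0∞) :
    LpN ν p h ^ p = ∫⁻ x, h x ^ p ∂ν := by
  rw [LpN, ← ENNReal.rpow_mul, one_div_mul_cancel hp.ne', ENNReal.rpow_one]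

lemma LpN_fnorm (ν : Measure α) {p : ℝ} (hp : 1 ≤ p) : FNorm (LpN ν p) := by
  have hp0 : 0 < p := by linarith
  have hip : 0 < 1 / p := by positivity
  refine ⟨?_, ?_, ?_, ?_⟩
  · simp [LpN, hp0]
  · intro c hc g hg
    unfold LpN
    simp_rw [ENNReal.mul_rpow_of_nonneg _ _ hp0.le]
    rw [lintegral_const_mul _ (by fun_prop), ENNReal.mul_rpow_of_nonneg _ _ hip.le,
      ← ENNReal.rpow_mul, mul_one_div_cancel hp0.ne', ENNReal.rpow_one]
  · intro f g hf hg
    exact ENNReal.lintegral_Lp_add_le hf.aemeasurable hg.aemeasurable hp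
  · intro g hg hmono
    unfold LpN
    have : ∀ x, (⨆ k, g k x) ^ p = ⨆ k, (g k x) ^ p := fun x =>
      (ENNReal.orderIsoRpow p hp0).map_iSup _
    simp_rw [this]
    rw [lintegral_iSup (fun k => by fun_prop)
      (fun i j hij x => by dsimp only; gcongr; exact hmono hij x)]
    exact ((ENNReal.orderIsoRpow (1 / p) hip).map_iSup _).le

lemma LpN_pos (ν : Measure α) [SigmaFinite ν] {p : ℝ} (hp : 1 ≤ p) (ε : ℝ≥0∞) (hε : ε ≠ 0) :
    ∃ φ : α → ℝ≥0∞, Measurable φ ∧ (∀ x, φ x ≠ 0) ∧ LpN ν p φ ≤ ε := by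
  have hp0 : 0 < p := by linarith
  have hip : 0 < 1 / p := by positivity
  have : ε ^ p ≠ 0 := by simp [hε, hp0.le]
  obtain ⟨g, g0, gm, gi⟩ := exists_pos_lintegral_lt_of_sigmaFinite ν this
  refine ⟨fun x => (g x : ℝ≥0∞) ^ (1 / p), by fun_prop, fun x => ?_, ?_⟩
  · have := (g0 x).ne'
    simp [this, hp0.le]
  · unfold LpN
    rw [one_div, ENNReal.rpow_inv_le_iff hp0]
    refine le_trans (le_of_eq ?_) gi.le
    congr 1; ext x
    rw [← ENNReal.rpow_mul, inv_mul_cancel₀ hp0.ne', ENNReal.rpow_one]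

lemma LpN_fin (ν : Measure α) {p : ℝ} (hp : 1 ≤ p) (V : α → ℝ≥0∞) (hV : Measurable V)
    (h : LpN ν p V ≠ ∞) : ∀ᵐ x ∂ν, V x ≠ ∞ := by
  have hp0 : 0 < p := by linarith
  have h1 : ∫⁻ x, V x ^ p ∂ν ≠ ∞ := by
    rw [← LpN_pow ν hp0]; exact ENNReal.rpow_ne_top_of_nonneg hp0.le h
  filter_upwards [ae_lt_top (by fun_prop) h1] with x hx hx2
  rw [hx2] at hx
  simp [hp0] at hx

lemma lint_wd (μ : Measure α) {w : α → ℝ≥0∞} (hw : Measurable w) {f : α → ℝ≥0∞}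
    (hf : Measurable f) : ∫⁻ x, f x ∂(μ.withDensity w) = ∫⁻ x, f x * w x ∂μ := by
  rw [lintegral_withDensity_eq_lintegral_mul μ hw hf]
  simp [mul_comm]

namespace DGrid
variable (G : DGrid α)

/-- constant -/
def BC (p : ℝ) (K : ℝ≥0∞) : ℝ≥0∞ := 1 + KC p K ^ (1 / p)

lemma BC_ne_top {p : ℝ} (hp : 1 < p) {K : ℝ≥0∞} (hK : K ≠ ∞) : BC p K ≠ ∞ := by
  unfold BC
  exact ENNReal.add_ne_top.2 ⟨by simp, ENNReal.rpow_ne_top_of_nonneg (by positivity) (KC_ne_top hp hK)⟩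

lemma majL {μ : Measure α} [SigmaFinite μ] (hG : G.Good μ) {p : ℝ} (hp : 1 < p) {K : ℝ≥0∞}
    (hK : K ≠ ∞) {w : α → ℝ≥0∞} (hw : G.Ap μ p K w) :
    Maj μ (LpN (μ.withDensity w) p) (fun V => ∀ x, G.M μ V x ≤ 2 * BC p K * V x) := by
  have hp0 : 0 < p := by linarith
  have : SigmaFinite (μ.withDensity w) := SigmaFinite.withDensity_of_ne_top (hw.2.1.mono fun _ h => h.2)
  refine G.maj (LpN_fnorm _ hp.le) (BC_ne_top hp hK) (by simp [BC]) ?_ (LpN_pos _ hp.le) ?_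
  · intro g hg
    have h1 := G.muck hG hp hK hw hg
    unfold LpN
    rw [lint_wd μ hw.1 ((G.measurable_M μ g).pow_const p), lint_wd μ hw.1 (hg.pow_const p)]
    calc _ ≤ (KC p K * ∫⁻ x, g x ^ p * w x ∂μ) ^ (1 / p) := by gcongr
      _ = KC p K ^ (1 / p) * (∫⁻ x, g x ^ p * w x ∂μ) ^ (1 / p) :=
        ENNReal.mul_rpow_of_nonneg _ _ (by positivity)
      _ ≤ _ := by gcongr; exact le_add_self
  · intro V hV h
    exact (withDensity_absolutelyContinuous' hw.1.aemeasurable (hw.2.1.mono fun _ h => h.1)).ae_le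
      (LpN_fin _ hp.le V hV h)

lemma extrap {μ : Measure α} [SigmaFinite μ] (hG : G.Good μ) {p₀ p : ℝ} (hp₀ : 1 < p₀) (hp : 1 < p)
    (C₀ : ℝ≥0∞ → ℝ≥0∞) (hC₀ : ∀ K, K ≠ ∞ → C₀ K ≠ ∞) {K : ℝ≥0∞} (hK : K ≠ ∞) :
    ∃ C : ℝ≥0∞, C ≠ ∞ ∧ ∀ F g : α → ℝ≥0∞, Measurable F → Measurable g →
      (∀ K', K' ≠ ∞ → ∀ w, G.Ap μ p₀ K' w →
        ∫⁻ x, F x ^ p₀ * w x ∂μ ≤ C₀ K' * ∫⁻ x, g x ^ p₀ * w x ∂μ) →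
      ∀ w, G.Ap μ p K w → ∫⁻ x, F x ^ p * w x ∂μ ≤ C * ∫⁻ x, g x ^ p * w x ∂μ := by
  have hp0 : 0 < p := by linarith
  have hp1 : 0 < p - 1 := by linarith
  have hp00 : 0 < p₀ := by linarith
  have hpq : p.HolderConjugate (p / (p - 1)) := Real.HolderConjugate.conjExponent hp
  have hp'1 : 1 < p / (p - 1) := by rw [lt_div_iff₀ hp1]; linarith
  have e0 : (p - 1) * (p / (p - 1)) = p := by field_simp
  have e3 : 1 / p + 1 / (p / (p - 1)) = 1 := by field_simp; ring
  have e4 : 1 / (p - 1) = (p / (p - 1)) / p := by field_simp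
  set p' := p / (p - 1) with hp'
  have hp'0 : 0 < p' := by linarith
  set Ks := K ^ (1 / (p - 1)) with hKs
  have hKsT : Ks ≠ ∞ := ENNReal.rpow_ne_top_of_nonneg (by positivity) hK
  set A := 2 * BC p K
  set B := 2 * BC p' Ks
  have hA : A ≠ ∞ := ENNReal.mul_ne_top (by simp) (BC_ne_top hp hK)
  have hB : B ≠ ∞ := ENNReal.mul_ne_top (by simp) (BC_ne_top hp'1 hKsT)
  set K' := A ^ (p₀ - 1) * B
  have hK' : K' ≠ ∞ := ENNReal.mul_ne_top (ENNReal.rpow_ne_top_of_nonneg (by linarith) hA) hB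
  set c := C₀ K' ^ (1 / p₀) * 4
  have hc : c ≠ ∞ := ENNReal.mul_ne_top
    (ENNReal.rpow_ne_top_of_nonneg (by positivity) (hC₀ _ hK')) (by simp)
  refine ⟨1 + c ^ p, ENNReal.add_ne_top.2 ⟨by simp, ENNReal.rpow_ne_top_of_nonneg hp0.le hc⟩, ?_⟩
  intro F g hF hg hyp w hw
  set J := ∫⁻ x, g x ^ p * w x ∂μ with hJ
  by_cases hJT : J = ∞
  · rw [hJT, ENNReal.mul_top (by simp)]; exact le_top
  have hwm := hw.1
  set σ : α → ℝ≥0∞ := fun x => w x ^ (-(1 / (p - 1))) with hσ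
  have hσm : Measurable σ := by fun_prop
  have hσA : G.Ap μ p' Ks σ := G.Ap_dual hp hw
  have majΦ := G.majL hG hp hK hw
  have majΨ := G.majL hG hp'1 hKsT hσA
  have hold : ∀ V U, Measurable V → Measurable U → ∫⁻ x, V x * U x ∂μ ≤
      LpN (μ.withDensity w) p V * LpN (μ.withDensity σ) p' U := by
    intro V U hV hU
    unfold LpN
    rw [lint_wd μ hw.1 (hV.pow_const p), lint_wd μ hσm (hU.pow_const p')]
    calc ∫⁻ x, V x * U x ∂μ = ∫⁻ x, ((fun x => V x * w x ^ (1 / p)) * (fun x => U x * w x ^ (-(1 / p)))) x ∂μ := by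
          refine lintegral_congr_ae ?_
          filter_upwards [hw.2.1] with x hx
          simp only [Pi.mul_apply]
          have : V x * w x ^ (1 / p) * (U x * w x ^ (-(1 / p))) =
            V x * U x * (w x ^ (1 / p) * w x ^ (-(1 / p))) := by ring
          rw [this, ← ENNReal.rpow_add _ _ hx.1 hx.2]; simp
      _ ≤ _ := ENNReal.lintegral_mul_le_Lp_mul_Lq μ hpq (by fun_prop) (by fun_prop)
      _ = _ := by
        congr 3
        · ext x
          rw [ENNReal.mul_rpow_of_nonneg _ _ hp0.le, ← ENNReal.rpow_mul, one_div_mul_cancel hp0.ne', ENNReal.rpow_one]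
        · ext x
          rw [ENNReal.mul_rpow_of_nonneg _ _ hp'0.le, ← ENNReal.rpow_mul, hσ]
          simp only
          congr 2
          rw [e4]; ring
  -- truncation
  have : SigmaFinite (μ.withDensity w) := SigmaFinite.withDensity_of_ne_top (hw.2.1.mono fun _ h => h.2)
  set ν := μ.withDensity w with hν
  set Fn : ℕ → α → ℝ≥0∞ := fun n => (spanningSets ν n).indicator (fun x => min (F x) n) with hFn
  have hFnm : ∀ n, Measurable (Fn n) := fun n =>
    (hF.min measurable_const).indicator (measurableSet_spanningSets ν n)
  have hFnF : ∀ n x, Fn n x ≤ F x := fun n x =>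
    (indicator_le_self' (fun _ _ => zero_le) x).trans (min_le_left _ _)
  have hmono : Monotone Fn := by
    intro i j hij x
    refine indicator_le_indicator_of_subset (monotone_spanningSets ν hij) (fun _ => zero_le) x |>.trans ?_
    refine indicator_le_indicator ?_
    gcongr
  have hsup : ∀ x, ⨆ n, Fn n x = F x := by
    intro x
    refine le_antisymm (iSup_le fun n => hFnF n x) ?_
    refine le_of_forall_lt fun c hcF => ?_
    obtain ⟨m, hm⟩ := ENNReal.exists_nat_gt (ne_top_of_lt hcF)
    obtain ⟨l, hl⟩ := mem_iUnion.1 (show x ∈ ⋃ i, spanningSets ν i by rw [iUnion_spanningSets]; trivial)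
    refine lt_of_lt_of_le ?_ (le_iSup _ (max m l))
    simp only [hFn]
    rw [indicator_of_mem (monotone_spanningSets ν (le_max_right m l) hl)]
    refine lt_min hcF (hm.trans_le ?_)
    exact_mod_cast le_max_left m l
  have key : ∀ n, ∫⁻ x, Fn n x ^ p ∂ν ≤ c ^ p * J := by
    intro n
    set I := ∫⁻ x, Fn n x ^ p ∂ν with hI
    have hIT : I ≠ ∞ := by
      refine ne_top_of_le_ne_top ?_ (show I ≤ ∫⁻ x, (spanningSets ν n).indicator (fun _ => (n : ℝ≥0∞) ^ p) x ∂ν from ?_)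
      · rw [lintegral_indicator (measurableSet_spanningSets ν n), setLIntegral_const]
        exact ENNReal.mul_ne_top (ENNReal.rpow_ne_top_of_nonneg hp0.le (by simp)) (measure_spanningSets_lt_top ν n).ne
      · refine lintegral_mono fun x => ?_
        simp only [hFn]
        by_cases hx : x ∈ spanningSets ν n
        · simp only [indicator_of_mem hx]; gcongr; exact min_le_right _ _
        · simp [indicator_of_notMem hx, hp0]
    set u : α → ℝ≥0∞ := fun x => Fn n x ^ (p - 1) * w x with hu
    have hum : Measurable u := by have := hFnm n; fun_prop
    have hII : ∫⁻ x, Fn n x * u x ∂μ = I := by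
      rw [hI, hν, lint_wd μ hw.1 ((hFnm n).pow_const p)]
      congr 1; ext x
      simp only [hu]
      rw [← mul_assoc]
      congr 1
      nth_rewrite 1 [← ENNReal.rpow_one (Fn n x)]
      rw [← ENNReal.rpow_add_of_nonneg _ _ zero_le_one hp1.le]; ring_nf
    have huN : LpN (μ.withDensity σ) p' u = I ^ (1 / p') := by
      unfold LpN
      congr 1
      rw [lint_wd μ hσm (hum.pow_const p'), hI, hν, lint_wd μ hw.1 ((hFnm n).pow_const p)]
      refine lintegral_congr_ae ?_
      filter_upwards [hw.2.1] with x hx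
      simp only [hu, hσ]
      rw [ENNReal.mul_rpow_of_nonneg _ _ hp'0.le, ← ENNReal.rpow_mul, e0, mul_assoc,
        ← ENNReal.rpow_add _ _ hx.1 hx.2]
      have : p' + -(1 / (p - 1)) = 1 := by rw [hp']; field_simp; ring
      rw [this, ENNReal.rpow_one]
    have hgN : LpN ν p g = J ^ (1 / p) := by
      unfold LpN
      rw [hν, lint_wd μ hw.1 (hg.pow_const p)]
    have main := extrap_abs majΦ majΨ hold hp₀ (hC₀ K' hK') (hFnm n) hg
      (fun V U hVm hUm hV hU hPV hPU => ?_) hum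
      (by rw [hgN]; exact ENNReal.rpow_ne_top_of_nonneg (by positivity) hJT)
      (by rw [huN]; exact ENNReal.rpow_ne_top_of_nonneg (by positivity) hIT)
    · rw [hII, hgN, huN] at main
      by_cases hI0 : I = 0
      · rw [hI0]; exact zero_le
      have h1 : I ^ (1 / p) ≤ c * J ^ (1 / p) := by
        have hI1 : I ^ (1 / p') ≠ 0 := by simp [hI0, hIT]
        have hI2 : I ^ (1 / p') ≠ ∞ := ENNReal.rpow_ne_top_of_nonneg (by positivity) hIT
        rw [← ENNReal.mul_le_mul_iff_left hI1 hI2, ← ENNReal.rpow_add _ _ hI0 hIT, e3, ENNReal.rpow_one]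
        exact main.trans (le_of_eq (by ring))
      calc I = (I ^ (1 / p)) ^ p := by
            rw [← ENNReal.rpow_mul, one_div_mul_cancel hp0.ne', ENNReal.rpow_one]
        _ ≤ (c * J ^ (1 / p)) ^ p := by gcongr
        _ = _ := by
            rw [ENNReal.mul_rpow_of_nonneg _ _ hp0.le, ← ENNReal.rpow_mul, one_div_mul_cancel hp0.ne', ENNReal.rpow_one]
    · have hAp := G.factA hG hp₀ hA hB hVm hUm hV hU hPV hPU
      refine le_trans (lintegral_mono fun x => ?_) (hyp K' hK' _ hAp)
      gcongr
      exact hFnF n x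
  have : ∫⁻ x, F x ^ p * w x ∂μ = ⨆ n, ∫⁻ x, Fn n x ^ p ∂ν := by
    rw [← lint_wd μ hw.1 (hF.pow_const p), ← lintegral_iSup (fun n => (hFnm n).pow_const p)
      (fun i j hij x => by dsimp only; gcongr; exact hmono hij x)]
    congr 1; ext x
    rw [← hsup x]
    exact (ENNReal.orderIsoRpow p hp0).map_iSup _
  rw [this]
  refine iSup_le fun n => (key n).trans ?_
  gcongr
  exact le_add_self
end DGrid
end

noncomputable section

/-- nondependent snoc -/
def sn {n : ℕ} (y : Fin n → ℝ) (t : ℝ) : Fin (n + 1) → ℝ := Fin.snoc (α := fun _ => ℝ) y t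

lemma sn_castSucc {n : ℕ} (y : Fin n → ℝ) (t : ℝ) (i : Fin n) : sn y t i.castSucc = y i :=
  Fin.snoc_castSucc (α := fun _ => ℝ) t y i

lemma sn_last {n : ℕ} (y : Fin n → ℝ) (t : ℝ) : sn y t (Fin.last n) = t :=
  Fin.snoc_last (α := fun _ => ℝ) t y

@[fun_prop]
lemma measurable_sn {n : ℕ} : Measurable (fun z : (Fin n → ℝ) × ℝ => sn z.1 z.2) := by
  refine measurable_pi_iff.2 fun i => ?_
  refine Fin.lastCases ?_ (fun j => ?_) i
  · simp_rw [sn_last]; fun_prop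
  · simp_rw [sn_castSucc]; fun_prop

@[fun_prop]
lemma Measurable.sn' {γ : Type*} [MeasurableSpace γ] {n : ℕ} {f : γ → (Fin n → ℝ)} {g : γ → ℝ}
    (hf : Measurable f) (hg : Measurable g) : Measurable (fun c => sn (f c) (g c)) :=
  measurable_sn.comp (hf.prodMk hg)

lemma sn_mp (n : ℕ) : MeasurePreserving (fun z : ℝ × (Fin n → ℝ) => sn z.2 z.1)
    (volume.prod volume) volume := by
  have h := (volume_preserving_piFinSuccAbove (fun _ : Fin (n + 1) => ℝ) (Fin.last n)).symm
  have e : (fun z : ℝ × (Fin n → ℝ) => sn z.2 z.1) =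
      (MeasurableEquiv.piFinSuccAbove (fun _ : Fin (n + 1) => ℝ) (Fin.last n)).symm := by
    funext z
    exact (Fin.insertNth_last' (β := ℝ) z.1 z.2).symm
  rw [e]
  exact h

lemma lint_succ {n : ℕ} {F : (Fin (n + 1) → ℝ) → ℝ≥0∞} (hF : Measurable F) :
    ∫⁻ x, F x = ∫⁻ t : ℝ, ∫⁻ y : Fin n → ℝ, F (sn y t) := by
  rw [← (sn_mp n).lintegral_comp hF, lintegral_prod _ (by fun_prop)]

lemma lint_zero {F : (Fin 0 → ℝ) → ℝ≥0∞} : ∫⁻ x, F x = F (fun i => i.elim0) := by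
  have : (volume : Measure (Fin 0 → ℝ)) = Measure.dirac (fun i : Fin 0 => (i.elim0 : ℝ)) :=
    Measure.volume_pi_eq_dirac (ι := Fin 0) (α := fun _ => ℝ) _
  rw [this, lintegral_dirac]

lemma mixed_zero (q : Fin 0 → ℝ) (g : (Fin 0 → ℝ) → ℝ≥0∞) :
    mixedLnorm 0 q g = g (fun i => i.elim0) := rfl

/-- initial exponents -/
def qi {n : ℕ} (q : Fin (n + 1) → ℝ) : Fin n → ℝ := fun i => q i.castSucc

lemma mixed_succ {n : ℕ} (q : Fin (n + 1) → ℝ) (g : (Fin (n + 1) → ℝ) → ℝ≥0∞) :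
    mixedLnorm (n + 1) q g
      = LpN volume (q (Fin.last n)) (fun t => mixedLnorm n (qi q) (fun y => g (sn y t))) := rfl

lemma LpN_mono {α : Type} [MeasurableSpace α] {ν : Measure α} {p : ℝ} (hp : 0 < p) {f g : α → ℝ≥0∞}
    (h : ∀ᵐ x ∂ν, f x ≤ g x) : LpN ν p f ≤ LpN ν p g := by
  unfold LpN
  gcongr ?_ ^ _
  refine lintegral_mono_ae ?_
  filter_upwards [h] with x hx
  gcongr

lemma mixed_mono_ae {n : ℕ} {q : Fin n → ℝ} (hq : ∀ i, 0 < q i) {g h : (Fin n → ℝ) → ℝ≥0∞}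
    (hgh : ∀ᵐ x, g x ≤ h x) : mixedLnorm n q g ≤ mixedLnorm n q h := by
  induction n with
  | zero =>
    rw [mixed_zero, mixed_zero]
    have h2 : (∀ᵐ x ∂(Measure.dirac (fun i : Fin 0 => (i.elim0 : ℝ))), g x ≤ h x) := by
      have e : (volume : Measure (Fin 0 → ℝ)) = Measure.dirac (fun i : Fin 0 => (i.elim0 : ℝ)) :=
        Measure.volume_pi_eq_dirac (ι := Fin 0) (α := fun _ => ℝ) _
      rwa [e] at hgh
    rw [ae_dirac_eq] at h2
    exact h2
  | succ n ih =>
    rw [mixed_succ, mixed_succ]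
    refine LpN_mono (hq _) ?_
    have h1 := (sn_mp n).quasiMeasurePreserving.ae hgh
    filter_upwards [Measure.ae_ae_of_ae_prod h1] with t ht
    exact ih (fun i => hq _) ht

lemma mixed_mono {n : ℕ} {q : Fin n → ℝ} (hq : ∀ i, 0 < q i) {g h : (Fin n → ℝ) → ℝ≥0∞}
    (hgh : ∀ x, g x ≤ h x) : mixedLnorm n q g ≤ mixedLnorm n q h :=
  mixed_mono_ae hq (Filter.Eventually.of_forall hgh)

lemma mixed_congr {n : ℕ} {q : Fin n → ℝ} (hq : ∀ i, 0 < q i) {g h : (Fin n → ℝ) → ℝ≥0∞}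
    (hgh : ∀ᵐ x, g x = h x) : mixedLnorm n q g = mixedLnorm n q h :=
  le_antisymm (mixed_mono_ae hq (hgh.mono fun _ h => h.le)) (mixed_mono_ae hq (hgh.mono fun _ h => h.ge))

lemma mixed_meas : ∀ {n : ℕ} (q : Fin n → ℝ) {β : Type} [MeasurableSpace β]
    {F : β → (Fin n → ℝ) → ℝ≥0∞}, Measurable (fun z : β × (Fin n → ℝ) => F z.1 z.2) →
    Measurable (fun a => mixedLnorm n q (F a)) := by
  intro n
  induction n with
  | zero =>
    intro q β _ F hF
    simp_rw [mixed_zero]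
    exact hF.comp (measurable_id.prodMk measurable_const)
  | succ n ih =>
    intro q β _ F hF
    simp_rw [mixed_succ]
    unfold LpN
    have h1 : Measurable (fun z : β × ℝ => mixedLnorm n (qi q) (fun y => F z.1 (sn y z.2))) :=
      ih (qi q) (β := β × ℝ) (F := fun z y => F z.1 (sn y z.2))
        (hF.comp (show Measurable (fun z : (β × ℝ) × (Fin n → ℝ) => (z.1.1, sn z.2 z.1.2)) by fun_prop))
    exact ((h1.pow_const _).lintegral_prod_right').pow_const _

lemma mixed_meas_slice {n : ℕ} (q : Fin (n + 1) → ℝ) {g : (Fin (n + 1) → ℝ) → ℝ≥0∞} (hg : Measurable g) :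
    Measurable (fun t => mixedLnorm n (qi q) (fun y => g (sn y t))) :=
  mixed_meas _ (F := fun t y => g (sn y t)) (by fun_prop)

lemma mixed_fnorm {n : ℕ} {q : Fin n → ℝ} (hq : ∀ i, 1 ≤ q i) : FNorm (mixedLnorm n q) := by
  induction n with
  | zero =>
    refine ⟨rfl, fun c hc g hg => rfl, fun f g hf hg => le_rfl, fun g hg hm => le_rfl⟩
  | succ n ih =>
    have H := ih (q := qi q) (fun i => hq _)
    have L := LpN_fnorm (volume : Measure ℝ) (hq (Fin.last n))
    have hq0 : 0 < q (Fin.last n) := by linarith [hq (Fin.last n)]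
    refine ⟨?_, ?_, ?_, ?_⟩
    · rw [mixed_succ]; simp_rw [H.zero]; exact L.zero
    · intro c hc g hg
      rw [mixed_succ, mixed_succ]
      have : ∀ t, mixedLnorm n (qi q) (fun y => c * g (sn y t)) = c * mixedLnorm n (qi q) (fun y => g (sn y t)) :=
        fun t => H.smul c hc _ (by fun_prop)
      simp_rw [this]
      exact L.smul c hc _ (mixed_meas_slice q hg)
    · intro f g hf hg
      rw [mixed_succ, mixed_succ, mixed_succ]
      refine le_trans (LpN_mono hq0 (Filter.Eventually.of_forall fun t => ?_))
        (L.add _ _ (mixed_meas_slice q hf) (mixed_meas_slice q hg))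
      exact H.add _ _ (by fun_prop) (by fun_prop)
    · intro g hg hm
      rw [mixed_succ]
      simp_rw [mixed_succ]
      refine le_trans (LpN_mono hq0 (Filter.Eventually.of_forall fun t => ?_))
        (L.sup (fun k t => mixedLnorm n (qi q) (fun y => g k (sn y t))) (fun k => mixed_meas_slice q (hg k)) ?_)
      · exact H.sup (fun k y => g k (sn y t)) (fun k => by have := hg k; fun_prop) (fun i j hij y => hm hij _)
      · intro i j hij t
        exact mixed_mono (fun i => by have := hq i.castSucc; simp only [qi]; linarith) (fun y => hm hij _)

lemma mixed_pow {n : ℕ} {q : Fin n → ℝ} (hq : ∀ i, 0 < q i) {s : ℝ} (hs : 0 < s)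
    (f : (Fin n → ℝ) → ℝ≥0∞) :
    mixedLnorm n (fun i => q i / s) (fun x => f x ^ s) = mixedLnorm n q f ^ s := by
  induction n with
  | zero => rfl
  | succ n ih =>
    rw [mixed_succ, mixed_succ]
    have : ∀ t, mixedLnorm n (qi (fun i => q i / s)) (fun y => f (sn y t) ^ s) =
        mixedLnorm n (qi q) (fun y => f (sn y t)) ^ s := fun t => ih (q := qi q) (fun i => hq _) _
    simp_rw [this]
    unfold LpN
    simp_rw [← ENNReal.rpow_mul]
    have h := hq (Fin.last n)
    congr 1
    · congr 1; ext t; congr 1; field_simp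
    · field_simp

/-- conjugate exponents -/
def cj {n : ℕ} (q : Fin n → ℝ) : Fin n → ℝ := fun i => q i / (q i - 1)

lemma cj_gt {n : ℕ} {q : Fin n → ℝ} (hq : ∀ i, 1 < q i) (i : Fin n) : 1 < cj q i := by
  have := hq i
  rw [cj, lt_div_iff₀ (by linarith)]; linarith

lemma mixed_holder {n : ℕ} {q : Fin n → ℝ} (hq : ∀ i, 1 < q i) {f g : (Fin n → ℝ) → ℝ≥0∞}
    (hf : Measurable f) (hg : Measurable g) :
    ∫⁻ x, f x * g x ≤ mixedLnorm n q f * mixedLnorm n (cj q) g := by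
  induction n with
  | zero => rw [lint_zero]; rfl
  | succ n ih =>
    rw [lint_succ (F := fun x => f x * g x) (hf.mul hg), mixed_succ, mixed_succ]
    refine le_trans (lintegral_mono fun t => ih (q := qi q) (fun i => hq _) (f := fun y => f (sn y t))
      (g := fun y => g (sn y t)) (by fun_prop) (by fun_prop)) ?_
    exact ENNReal.lintegral_mul_le_Lp_mul_Lq volume (Real.HolderConjugate.conjExponent (hq (Fin.last n)))
      (mixed_meas_slice q hf).aemeasurable (mixed_meas_slice (cj q) hg).aemeasurable

/-- extremizer -/
def dualF : (n : ℕ) → (q : Fin n → ℝ) → ((Fin n → ℝ) → ℝ≥0∞) → (Fin n → ℝ) → ℝ≥0∞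
  | 0, _, _ => fun _ => 1
  | (n + 1), q, F => fun x =>
      (mixedLnorm n (qi q) (fun y => F (sn y (x (Fin.last n)))) ^ (q (Fin.last n) - 1)
        * mixedLnorm (n + 1) q F ^ (-(q (Fin.last n) - 1)))
      * dualF n (qi q) (fun y => F (sn y (x (Fin.last n)))) (fun i => x i.castSucc)

lemma dualF_sn {n : ℕ} (q : Fin (n + 1) → ℝ) (F : (Fin (n + 1) → ℝ) → ℝ≥0∞) (y : Fin n → ℝ) (t : ℝ) :
    dualF (n + 1) q F (sn y t) = (mixedLnorm n (qi q) (fun y => F (sn y t)) ^ (q (Fin.last n) - 1)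
        * mixedLnorm (n + 1) q F ^ (-(q (Fin.last n) - 1))) * dualF n (qi q) (fun y => F (sn y t)) y := by
  simp only [dualF, sn_last, sn_castSucc]

lemma dualF_meas : ∀ {n : ℕ} (q : Fin n → ℝ) {β : Type} [MeasurableSpace β]
    {F : β → (Fin n → ℝ) → ℝ≥0∞}, Measurable (fun z : β × (Fin n → ℝ) => F z.1 z.2) →
    Measurable (fun z : β × (Fin n → ℝ) => dualF n q (F z.1) z.2) := by
  intro n
  induction n with
  | zero => intro q β _ F hF; exact measurable_const
  | succ n ih =>
    intro q β _ F hF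
    simp only [dualF]
    have h0 : Measurable (fun z : (β × ℝ) × (Fin n → ℝ) => F z.1.1 (sn z.2 z.1.2)) :=
      hF.comp (show Measurable (fun z : (β × ℝ) × (Fin n → ℝ) => (z.1.1, sn z.2 z.1.2)) by fun_prop)
    have h1 := ih (qi q) (β := β × ℝ) (F := fun z y => F z.1 (sn y z.2)) h0
    have h2 := mixed_meas (qi q) (β := β × ℝ) (F := fun z y => F z.1 (sn y z.2)) h0
    have h3 := mixed_meas q hF
    refine (Measurable.mul ?_ ?_).mul ?_
    · exact (h2.comp (show Measurable (fun z : β × (Fin (n + 1) → ℝ) => (z.1, z.2 (Fin.last n))) by fun_prop)).pow_const _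
    · exact (h3.comp measurable_fst).pow_const _
    · exact h1.comp (show Measurable (fun z : β × (Fin (n + 1) → ℝ) =>
        ((z.1, z.2 (Fin.last n)), fun i : Fin n => z.2 i.castSucc)) by fun_prop)

lemma dualF_meas1 {n : ℕ} (q : Fin n → ℝ) {F : (Fin n → ℝ) → ℝ≥0∞} (hF : Measurable F) :
    Measurable (dualF n q F) :=
  (dualF_meas q (β := Unit) (F := fun _ => F) (by fun_prop)).comp ((measurable_const (a := ())).prodMk measurable_id)

end

noncomputable section

lemma dualF_norm {n : ℕ} {q : Fin n → ℝ} (hq : ∀ i, 1 < q i) {F : (Fin n → ℝ) → ℝ≥0∞}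
    (hF : Measurable F) : mixedLnorm n (cj q) (dualF n q F) ≤ 1 := by
  induction n with
  | zero => exact le_rfl
  | succ n ih =>
    have hql := hq (Fin.last n)
    set r := q (Fin.last n) with hr
    have hr0 : 0 < r := by linarith
    have hr1 : 0 < r - 1 := by linarith
    have hcj : cj q (Fin.last n) = r / (r - 1) := rfl
    have hcj0 : 0 < r / (r - 1) := by positivity
    set I := mixedLnorm (n + 1) q F with hI
    set N : ℝ → ℝ≥0∞ := fun t => mixedLnorm n (qi q) (fun y => F (sn y t)) with hN
    have hNm : Measurable N := mixed_meas_slice q hF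
    have hIN : I ^ r = ∫⁻ t, N t ^ r := by
      rw [hI, mixed_succ, LpN_pow _ hr0]
    have hslice : ∀ t, N t ^ (r - 1) * I ^ (-(r - 1)) ≠ ∞ →
        mixedLnorm n (qi (cj q)) (fun y => dualF (n + 1) q F (sn y t)) ≤ N t ^ (r - 1) * I ^ (-(r - 1)) := by
      intro t ht
      simp_rw [dualF_sn]
      have hm : Measurable (fun y => F (sn y t)) := by fun_prop
      have hfn := mixed_fnorm (q := qi (cj q)) (fun i => (cj_gt hq _).le)
      rw [hfn.smul _ ht _ (dualF_meas1 _ hm)]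
      refine mul_le_of_le_one_right' ?_
      exact ih (q := qi q) (fun i => hq _) hm
    rw [mixed_succ, hcj]
    by_cases hI0 : I = 0
    · have h0 : ∀ᵐ t, N t = 0 := by
        rw [hI0, ENNReal.zero_rpow_of_pos hr0] at hIN
        have := (lintegral_eq_zero_iff (hNm.pow_const r)).1 hIN.symm
        filter_upwards [this] with t ht
        simpa [hr0, hr0.not_gt] using ht
      have : ∀ᵐ t, mixedLnorm n (qi (cj q)) (fun y => dualF (n + 1) q F (sn y t)) ≤ (fun _ => 0) t := by
        filter_upwards [h0] with t ht
        have h1 := hslice t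
        rw [ht, ENNReal.zero_rpow_of_pos hr1, zero_mul] at h1
        exact h1 (by simp)
      refine (LpN_mono hcj0 this).trans ?_
      simp [LpN, hcj0, hr0, hr1]
    have hfin : ∀ᵐ t, N t ^ (r - 1) * I ^ (-(r - 1)) ≠ ∞ := by
      by_cases hIT : I = ∞
      · refine Filter.Eventually.of_forall fun t => ?_
        rw [hIT, ENNReal.top_rpow_of_neg (by linarith), mul_zero]; simp
      · have : ∫⁻ t, N t ^ r ≠ ∞ := by
          rw [← hIN]; exact ENNReal.rpow_ne_top_of_nonneg hr0.le hIT
        filter_upwards [ae_lt_top (by fun_prop) this] with t ht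
        have hNT : N t ≠ ∞ := by intro h; rw [h] at ht; simp [hr0] at ht
        refine ENNReal.mul_ne_top (ENNReal.rpow_ne_top_of_nonneg hr1.le hNT) ?_
        simp [hI0, hIT, hr1.le, ENNReal.rpow_eq_top_iff]
    refine (LpN_mono hcj0 (hfin.mono hslice)).trans ?_
    unfold LpN
    refine ENNReal.rpow_le_one ?_ (by positivity)
    have e : ∀ t, (N t ^ (r - 1) * I ^ (-(r - 1))) ^ (r / (r - 1)) = N t ^ r * I ^ (-r) := by
      intro t
      rw [ENNReal.mul_rpow_of_nonneg _ _ hcj0.le, ← ENNReal.rpow_mul, ← ENNReal.rpow_mul]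
      congr 2 <;> field_simp
    simp_rw [e]
    rw [lintegral_mul_const _ (by fun_prop), ← hIN, ENNReal.rpow_neg]
    exact ENNReal.mul_inv_le_one _

lemma dualF_int {n : ℕ} {q : Fin n → ℝ} (hq : ∀ i, 1 < q i) {F : (Fin n → ℝ) → ℝ≥0∞}
    (hF : Measurable F) (hT : mixedLnorm n q F ≠ ∞) : mixedLnorm n q F ≤ ∫⁻ x, F x * dualF n q F x := by
  induction n with
  | zero => rw [lint_zero, mixed_zero]; simp [dualF]
  | succ n ih =>
    have hql := hq (Fin.last n)
    set r := q (Fin.last n) with hr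
    have hr0 : 0 < r := by linarith
    have hr1 : 0 < r - 1 := by linarith
    set I := mixedLnorm (n + 1) q F with hI
    set N : ℝ → ℝ≥0∞ := fun t => mixedLnorm n (qi q) (fun y => F (sn y t)) with hN
    have hNm : Measurable N := mixed_meas_slice q hF
    have hIN : I ^ r = ∫⁻ t, N t ^ r := by
      rw [hI, mixed_succ, LpN_pow _ hr0]
    by_cases hI0 : I = 0
    · rw [hI0]; exact zero_le
    have hNI : ∫⁻ t, N t ^ r ≠ ∞ := by
      rw [← hIN]; exact ENNReal.rpow_ne_top_of_nonneg hr0.le hT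
    rw [lint_succ (F := fun x => F x * dualF (n + 1) q F x) (hF.mul (dualF_meas1 q hF))]
    calc I = I ^ r * I ^ (-(r - 1)) := by
          rw [← ENNReal.rpow_add _ _ hI0 hT]; simp
      _ = ∫⁻ t, N t ^ r * I ^ (-(r - 1)) := by
          rw [lintegral_mul_const _ (by fun_prop), ← hIN]
      _ ≤ _ := by
          refine lintegral_mono_ae ?_
          filter_upwards [ae_lt_top (by fun_prop) hNI] with t ht
          have hNT : N t ≠ ∞ := by intro h; rw [h] at ht; simp [hr0] at ht
          simp_rw [dualF_sn]
          have hm : Measurable (fun y => F (sn y t)) := by fun_prop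
          have := ih (q := qi q) (fun i => hq _) hm hNT
          have e : ∀ y, F (sn y t) * (N t ^ (r - 1) * I ^ (-(r - 1)) * dualF n (qi q) (fun y => F (sn y t)) y)
            = (N t ^ (r - 1) * I ^ (-(r - 1))) * (F (sn y t) * dualF n (qi q) (fun y => F (sn y t)) y) := by
            intro y; ring
          change _ ≤ ∫⁻ y, F (sn y t) * (N t ^ (r - 1) * I ^ (-(r - 1)) * dualF n (qi q) (fun y => F (sn y t)) y)
          simp_rw [e]
          have hm2 : Measurable (fun y => F (sn y t) * dualF n (qi q) (fun y => F (sn y t)) y) :=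
            hm.mul (dualF_meas1 _ hm)
          rw [lintegral_const_mul _ hm2]
          calc N t ^ r * I ^ (-(r - 1)) = (N t ^ (r - 1) * I ^ (-(r - 1))) * N t := by
                have : N t ^ r = N t ^ (r - 1) * N t := by
                  nth_rewrite 3 [← ENNReal.rpow_one (N t)]
                  rw [← ENNReal.rpow_add_of_nonneg _ _ hr1.le zero_le_one]; ring_nf
                rw [this]; ring
            _ ≤ _ := by gcongr

lemma mixed_pos {n : ℕ} {q : Fin n → ℝ} (hq : ∀ i, 1 ≤ q i) (ε : ℝ≥0∞) (hε : ε ≠ 0) :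
    ∃ φ : (Fin n → ℝ) → ℝ≥0∞, Measurable φ ∧ (∀ x, φ x ≠ 0) ∧ mixedLnorm n q φ ≤ ε := by
  induction n generalizing ε with
  | zero => exact ⟨fun _ => ε, measurable_const, fun _ => hε, le_rfl⟩
  | succ n ih =>
    have hq0 : 0 < q (Fin.last n) := by linarith [hq (Fin.last n)]
    obtain ⟨φ, hφm, hφ0, hφ⟩ := ih (q := qi q) (fun i => hq _) 1 (by simp)
    obtain ⟨ψ', hψm', hψ0', hψ'⟩ := LpN_pos (volume : Measure ℝ) (hq (Fin.last n)) ε hε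
    set ψ : ℝ → ℝ≥0∞ := fun t => min (ψ' t) 1
    have hψT : ∀ t, ψ t ≠ ∞ := fun t => ne_top_of_le_ne_top (by simp) (min_le_right _ _)
    have hψm : Measurable ψ := hψm'.min measurable_const
    refine ⟨fun x => ψ (x (Fin.last n)) * φ (fun i => x i.castSucc), by fun_prop, fun x => ?_, ?_⟩
    · refine mul_ne_zero ?_ (hφ0 _)
      simp [ψ, hψ0']
    · rw [mixed_succ]
      refine le_trans (LpN_mono hq0 (Filter.Eventually.of_forall fun t => ?_)) hψ'
      simp only [sn_last, sn_castSucc]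
      have hfn := mixed_fnorm (q := qi q) (fun i => hq _)
      rw [hfn.smul _ (hψT t) (fun y => φ y) hφm]
      calc _ ≤ ψ t * 1 := by gcongr
        _ ≤ _ := by rw [mul_one]; exact min_le_left _ _

lemma mixed_fin {n : ℕ} {q : Fin n → ℝ} (hq : ∀ i, 1 < q i) (V : (Fin n → ℝ) → ℝ≥0∞)
    (hV : Measurable V) (hT : mixedLnorm n q V ≠ ∞) : ∀ᵐ x, V x ≠ ∞ := by
  obtain ⟨φ, hφm, hφ0, hφ⟩ := mixed_pos (q := cj q) (fun i => (cj_gt hq i).le) 1 (by simp)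
  have h := mixed_holder hq hV hφm
  have h2 := ae_lt_top (hV.mul hφm) (ne_top_of_le_ne_top (ENNReal.mul_ne_top hT
    (ne_top_of_le_ne_top (by simp) hφ)) h)
  filter_upwards [h2] with x hx hVx
  simp [hVx, hφ0 x] at hx

lemma mixed_dual {n : ℕ} {q : Fin n → ℝ} (hq : ∀ i, 1 < q i) {F : (Fin n → ℝ) → ℝ≥0∞}
    (hF : Measurable F) {c : ℝ≥0∞}
    (h : ∀ u, Measurable u → mixedLnorm n (cj q) u ≤ 1 → ∫⁻ x, F x * u x ≤ c) :
    mixedLnorm n q F ≤ c := by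
  obtain ⟨φ, hφm, hφ0, hφ⟩ := mixed_pos (q := q) (fun i => (hq i).le) 1 (by simp)
  have hfn := mixed_fnorm (q := q) (fun i => (hq i).le)
  have hq0 : ∀ i, 0 < q i := fun i => by linarith [hq i]
  set Fk : ℕ → (Fin n → ℝ) → ℝ≥0∞ := fun k x => min (F x) (k * φ x) with hFk
  have hFkm : ∀ k, Measurable (Fk k) := fun k => hF.min (hφm.const_mul _)
  have hmono : Monotone Fk := by
    intro i j hij x; simp only [hFk]; gcongr
  have hsup : ∀ x, ⨆ k, Fk k x = F x := by
    intro x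
    refine le_antisymm (iSup_le fun n => min_le_left _ _) ?_
    refine le_of_forall_lt fun c hcF => ?_
    obtain ⟨m, hm⟩ := ENNReal.exists_nat_mul_gt (hφ0 x) (ne_top_of_lt hcF)
    exact lt_of_lt_of_le (lt_min hcF hm) (le_iSup (fun k => Fk k x) m)
  have hFkT : ∀ k, mixedLnorm n q (Fk k) ≠ ∞ := by
    intro k
    have : mixedLnorm n q (Fk k) ≤ k * mixedLnorm n q φ := by
      rw [← hfn.smul k (by simp) φ hφm]
      exact mixed_mono hq0 (fun x => min_le_right _ _)
    exact ne_top_of_le_ne_top (ENNReal.mul_ne_top (by simp) (ne_top_of_le_ne_top (by simp) hφ)) this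
  have h1 := hfn.sup Fk hFkm hmono
  simp_rw [hsup] at h1
  refine h1.trans (iSup_le fun k => (dualF_int hq (hFkm k) (hFkT k)).trans ?_)
  refine le_trans (lintegral_mono fun x => ?_) (h (dualF n q (Fk k)) (dualF_meas1 _ (hFkm k)) (dualF_norm hq (hFkm k)))
  gcongr
  exact min_le_left _ _
end

noncomputable section

namespace DGrid
variable {α : Type} [MeasurableSpace α] (G : DGrid α)

lemma measurable_M_joint (μ : Measure α) [SFinite μ] {β : Type} [MeasurableSpace β] {f : β → α → ℝ≥0∞}
    (hf : Measurable (fun z : β × α => f z.1 z.2)) :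
    Measurable (fun z : β × α => G.M μ (f z.1) z.2) := by
  unfold M
  refine Measurable.iSup fun k => ?_
  unfold av
  refine Measurable.mul ?_ ?_
  · have : Measurable (fun x => (μ (G.cube k x))⁻¹) :=
      G.measurable_of_idx k _ (fun x y h => by rw [G.cube_eq h])
    exact this.comp measurable_snd
  · have := G.cnt
    have hS : MeasurableSet {z : (β × α) × α | G.idx k z.2 = G.idx k z.1.2} := by
      have : {z : (β × α) × α | G.idx k z.2 = G.idx k z.1.2} =
          ⋃ i, ((fun z : (β × α) × α => z.2) ⁻¹' (G.idx k ⁻¹' {i})) ∩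
            ((fun z : (β × α) × α => z.1.2) ⁻¹' (G.idx k ⁻¹' {i})) := by
        ext z; simp [eq_comm]
      rw [this]
      exact MeasurableSet.iUnion fun i => ((measurable_snd (G.meas k i))).inter
        ((measurable_snd.comp measurable_fst) (G.meas k i))
    have e : ∀ z : β × α, ∫⁻ y in G.cube k z.2, f z.1 y ∂μ =
        ∫⁻ y, ({z : (β × α) × α | G.idx k z.2 = G.idx k z.1.2}.indicator (fun z => f z.1.1 z.2)) (z, y) ∂μ := by
      intro z
      rw [← lintegral_indicator (G.measurableSet_cube k z.2)]
      rfl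
    simp_rw [e]
    refine Measurable.lintegral_prod_right' (Measurable.indicator ?_ hS)
    exact hf.comp (show Measurable (fun z : (β × α) × α => (z.1.1, z.2)) by fun_prop)

end DGrid

lemma ladder (G : DGrid ℝ) (hG : G.Good volume) : ∀ (k : ℕ) (r : Fin k → ℝ), (∀ i, 1 < r i) →
    ∀ p : ℝ, 1 < p → ∀ K : ℝ≥0∞, K ≠ ∞ → ∃ C : ℝ≥0∞, C ≠ ∞ ∧ ∀ w, G.Ap volume p K w →
      ∀ f : (Fin k → ℝ) → ℝ → ℝ≥0∞, Measurable (fun z : (Fin k → ℝ) × ℝ => f z.1 z.2) →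
      ∫⁻ t, (mixedLnorm k r (fun y => G.M volume (f y) t)) ^ p * w t
        ≤ C * ∫⁻ t, (mixedLnorm k r (fun y => f y t)) ^ p * w t := by
  intro k
  induction k with
  | zero =>
    intro r hr p hp K hK
    refine ⟨DGrid.KC p K, DGrid.KC_ne_top hp hK, fun w hw f hf => ?_⟩
    simp_rw [mixed_zero]
    exact G.muck hG hp hK hw (hf.comp (measurable_const.prodMk measurable_id))
  | succ k ih =>
    intro r hr p hp K hK
    have hp₀ := hr (Fin.last k)
    set p₀ := r (Fin.last k) with hp₀'
    have hp₀0 : 0 < p₀ := by linarith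
    have IH := ih (qi r) (fun i => hr _) p₀ hp₀
    choose! C₀ hC₀ hC₁ using IH
    obtain ⟨C, hC, H⟩ := G.extrap (μ := volume) hG hp₀ hp C₀ hC₀ hK
    refine ⟨C, hC, fun w hw f hf => ?_⟩
    have hMf := G.measurable_M_joint volume hf
    have hsw : ∀ {h : (Fin (k + 1) → ℝ) → ℝ → ℝ≥0∞}, Measurable (fun z : (Fin (k + 1) → ℝ) × ℝ => h z.1 z.2) →
        Measurable (fun t => mixedLnorm (k + 1) r (fun y => h y t)) := fun {h} hh =>
      mixed_meas r (F := fun t y => h y t) (hh.comp measurable_swap)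
    have hton : ∀ {h : (Fin (k + 1) → ℝ) → ℝ → ℝ≥0∞}, Measurable (fun z : (Fin (k + 1) → ℝ) × ℝ => h z.1 z.2) →
        ∀ {w : ℝ → ℝ≥0∞}, Measurable w →
        ∫⁻ t, (mixedLnorm (k + 1) r (fun y => h y t)) ^ p₀ * w t =
        ∫⁻ s, ∫⁻ t, (mixedLnorm k (qi r) (fun y => h (sn y s) t)) ^ p₀ * w t := by
      intro h hh w hw
      have hm : Measurable (fun z : ℝ × ℝ => mixedLnorm k (qi r) (fun y => h (sn y z.2) z.1)) :=
        mixed_meas (qi r) (F := fun (z : ℝ × ℝ) y => h (sn y z.2) z.1)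
          (hh.comp (show Measurable (fun z : (ℝ × ℝ) × (Fin k → ℝ) => (sn z.2 z.1.2, z.1.1)) by fun_prop))
      rw [← lintegral_lintegral_swap (f := fun t s => mixedLnorm k (qi r) (fun y => h (sn y s) t) ^ p₀ * w t)
        ((hm.pow_const p₀).mul (hw.comp measurable_fst)).aemeasurable]
      refine lintegral_congr fun t => ?_
      rw [mixed_succ, LpN_pow _ hp₀0, lintegral_mul_const]
      exact (hm.comp (measurable_const.prodMk measurable_id)).pow_const p₀
    refine H _ _ (hsw (h := fun y t => G.M volume (f y) t) hMf) (hsw hf) ?_ w hw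
    intro K' hK' w' hw'
    rw [hton (h := fun y t => G.M volume (f y) t) hMf hw'.1, hton hf hw'.1]
    have hm2 : Measurable (fun z : ℝ × ℝ => mixedLnorm k (qi r) (fun y => f (sn y z.1) z.2) ^ p₀ * w' z.2) :=
      ((mixed_meas (qi r) (F := fun (z : ℝ × ℝ) y => f (sn y z.1) z.2)
          (hf.comp (show Measurable (fun z : (ℝ × ℝ) × (Fin k → ℝ) => (sn z.2 z.1.1, z.1.2)) by fun_prop))).pow_const _).mul
        (hw'.1.comp measurable_snd)
    rw [← lintegral_const_mul' _ _ (hC₀ K' hK')]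
    refine lintegral_mono fun s => ?_
    exact hC₁ K' hK' w' hw' (fun y t => f (sn y s) t)
      (hf.comp (show Measurable (fun z : (Fin k → ℝ) × ℝ => (sn z.1 s, z.2)) by fun_prop))
end

noncomputable section

/-- shifts, in thirds -/
def sh (s : Bool) (k : ℤ) : ℤ := if s then (if Even k then 1 else -1) else 0

lemma sh_succ (s : Bool) (k : ℤ) : sh s (k + 1) = - sh s k := by
  unfold sh
  cases s
  · simp
  · by_cases h : Even k <;> simp [h, Int.even_add_one]

/-- index of a point in one dimension -/
def ix (s : Bool) (k : ℤ) (x : ℝ) : ℤ := ⌊x / 2 ^ k - (sh s k : ℝ) / 3⌋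

lemma floor_half {u v : ℝ} (h : ⌊u⌋ = ⌊v⌋) (c : ℤ) : ⌊(u + c) / 2⌋ = ⌊(v + c) / 2⌋ := by
  have key : ∀ u : ℝ, ⌊(u + c) / 2⌋ = (⌊u⌋ + c) / 2 := by
    intro u
    have h1 := Int.floor_le u
    have h2 := Int.lt_floor_add_one u
    have h3 : ((⌊u⌋ + c) / 2) * 2 ≤ ⌊u⌋ + c := by omega
    have h4 : ⌊u⌋ + c + 1 ≤ ((⌊u⌋ + c) / 2) * 2 + 2 := by omega
    rw [Int.floor_eq_iff]
    have h3' : (((⌊u⌋ + c) / 2 : ℤ) : ℝ) * 2 ≤ ⌊u⌋ + c := by exact_mod_cast h3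
    have h4' : (⌊u⌋ : ℝ) + c + 1 ≤ (((⌊u⌋ + c) / 2 : ℤ) : ℝ) * 2 + 2 := by exact_mod_cast h4
    constructor <;> linarith
  rw [key, key, h]

lemma ix_nest (s : Bool) (k : ℤ) (x y : ℝ) (h : ix s k x = ix s k y) : ix s (k + 1) x = ix s (k + 1) y := by
  have e : ∀ x : ℝ, ix s (k + 1) x = ⌊((x / 2 ^ k - (sh s k : ℝ) / 3) + (sh s k : ℤ)) / 2⌋ := by
    intro x
    unfold ix
    rw [sh_succ, zpow_add_one₀ (by norm_num)]
    congr 1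
    push_cast
    field_simp
    ring
  rw [e, e]
  exact floor_half h _

lemma ix_iff (s : Bool) (k : ℤ) (x : ℝ) (m : ℤ) :
    ix s k x = m ↔ x ∈ Ico ((2 : ℝ) ^ k * (m + (sh s k : ℝ) / 3)) ((2 : ℝ) ^ k * (m + (sh s k : ℝ) / 3) + 2 ^ k) := by
  have h2 : (0 : ℝ) < 2 ^ k := by positivity
  rw [ix, Int.floor_eq_iff, mem_Ico]
  have e : x = 2 ^ k * (x / 2 ^ k) := by field_simp
  constructor
  · rintro ⟨h1, h3⟩
    constructor
    · rw [e]; gcongr; linarith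
    · rw [e]; nlinarith
  · rintro ⟨h1, h3⟩
    rw [e] at h1 h3
    have h1' := le_of_mul_le_mul_left h1 h2
    have h3' : 2 ^ k * (x / 2 ^ k) < 2 ^ k * (m + (sh s k : ℝ) / 3 + 1) := by linarith
    have h3'' := lt_of_mul_lt_mul_left h3' h2.le
    constructor <;> linarith

lemma ix_meas (s : Bool) (k : ℤ) (m : ℤ) : MeasurableSet (ix s k ⁻¹' {m}) := by
  have : ix s k ⁻¹' {m} = Ico ((2 : ℝ) ^ k * (m + (sh s k : ℝ) / 3)) ((2 : ℝ) ^ k * (m + (sh s k : ℝ) / 3) + 2 ^ k) := by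
    ext x; exact ix_iff s k x m
  rw [this]; exact measurableSet_Ico

/-- one dimensional grid -/
def g1 (s : Bool) : DGrid ℝ where
  ι := ℤ
  cnt := inferInstance
  idx := ix s
  meas := ix_meas s
  nest := ix_nest s

/-- product grid -/
def pg {n : ℕ} (s : Fin n → Bool) : DGrid (Fin n → ℝ) where
  ι := Fin n → ℤ
  cnt := inferInstance
  idx := fun k x i => ix (s i) k (x i)
  meas := fun k m => by
    have : (fun x : Fin n → ℝ => fun i => ix (s i) k (x i)) ⁻¹' {m}
        = ⋂ i, (fun x : Fin n → ℝ => x i) ⁻¹' (ix (s i) k ⁻¹' {m i}) := by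
      ext x
      simp only [mem_preimage, mem_singleton_iff, mem_iInter]
      exact funext_iff
    rw [this]
    exact MeasurableSet.iInter fun i => (measurable_pi_apply i) (ix_meas _ _ _)
  nest := fun k x y h => funext fun i => ix_nest _ _ _ _ (congrFun h i)

/-- lower corner -/
def lo (s : Bool) (k : ℤ) (x : ℝ) : ℝ := (2 : ℝ) ^ k * (ix s k x + (sh s k : ℝ) / 3)

lemma g1_cube (s : Bool) (k : ℤ) (x : ℝ) : (g1 s).cube k x = Ico (lo s k x) (lo s k x + 2 ^ k) := by
  ext y; exact ix_iff s k y _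

lemma mem_pg_cube {n : ℕ} (s : Fin n → Bool) (k : ℤ) (x y : Fin n → ℝ) :
    y ∈ (pg s).cube k x ↔ ∀ i, y i ∈ (g1 (s i)).cube k (x i) := funext_iff

lemma pg_cube {n : ℕ} (s : Fin n → Bool) (k : ℤ) (x : Fin n → ℝ) :
    (pg s).cube k x = pi univ (fun i => Ico (lo (s i) k (x i)) (lo (s i) k (x i) + 2 ^ k)) := by
  ext y
  rw [mem_pg_cube]
  simp only [g1_cube, mem_pi, mem_univ, true_imp_iff]

lemma g1_vol (s : Bool) (k : ℤ) (x : ℝ) : volume ((g1 s).cube k x) = ENNReal.ofReal (2 ^ k) := by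
  rw [g1_cube, Real.volume_Ico]; simp

lemma pg_vol {n : ℕ} (s : Fin n → Bool) (k : ℤ) (x : Fin n → ℝ) :
    volume ((pg s).cube k x) = ENNReal.ofReal (2 ^ k) ^ n := by
  rw [pg_cube, Real.volume_pi_Ico]; simp

lemma o2_ne (k : ℤ) : ENNReal.ofReal ((2 : ℝ) ^ k) ≠ 0 := by
  have : (0 : ℝ) < 2 ^ k := by positivity
  simp [this]

lemma g1_good (s : Bool) : (g1 s).Good volume := fun k x => by
  rw [g1_vol]; exact ⟨o2_ne k, by simp⟩

lemma pg_good {n : ℕ} (s : Fin n → Bool) : (pg s).Good volume := fun k x => by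
  rw [pg_vol]; exact ⟨pow_ne_zero _ (o2_ne k), ENNReal.pow_ne_top (by simp)⟩

lemma pg_sn {n : ℕ} (s : Fin (n + 1) → Bool) (k : ℤ) (y y' : Fin n → ℝ) (t t' : ℝ) :
    sn y' t' ∈ (pg s).cube k (sn y t) ↔ y' ∈ (pg (fun i => s i.castSucc)).cube k y ∧
      t' ∈ (g1 (s (Fin.last n))).cube k t := by
  rw [mem_pg_cube, mem_pg_cube, Fin.forall_fin_succ']
  simp only [sn_castSucc, sn_last]

lemma pg_M_le {n : ℕ} (s : Fin (n + 1) → Bool) {f : (Fin (n + 1) → ℝ) → ℝ≥0∞} (hf : Measurable f)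
    (y : Fin n → ℝ) (t : ℝ) :
    (pg s).M volume f (sn y t) ≤ (pg (fun i => s i.castSucc)).M volume
      (fun y' => (g1 (s (Fin.last n))).M volume (fun t' => f (sn y' t')) t) y := by
  refine iSup_le fun k => ?_
  refine le_trans ?_ (DGrid.av_le_M _ volume k _ y)
  set Q := (pg (fun i => s i.castSucc)).cube k y with hQ
  set J := (g1 (s (Fin.last n))).cube k t with hJ
  have hQm : MeasurableSet Q := DGrid.measurableSet_cube _ _ _
  have hJm : MeasurableSet J := DGrid.measurableSet_cube _ _ _
  have hfm : Measurable (fun z : ℝ × (Fin n → ℝ) => f (sn z.2 z.1)) := by fun_prop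
  have e : ∫⁻ x in (pg s).cube k (sn y t), f x = ∫⁻ y' in Q, ∫⁻ t' in J, f (sn y' t') := by
    rw [← lintegral_indicator (DGrid.measurableSet_cube _ _ _),
      lint_succ (hf.indicator (DGrid.measurableSet_cube _ _ _))]
    rw [← lintegral_lintegral_swap (f := fun t' y' => f (sn y' t')) (μ := volume.restrict J)
      (ν := volume.restrict Q) hfm.aemeasurable, ← lintegral_indicator hJm]
    refine lintegral_congr fun t' => ?_
    by_cases ht : t' ∈ J
    · rw [indicator_of_mem ht, ← lintegral_indicator hQm]
      refine lintegral_congr fun y' => ?_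
      by_cases hy : y' ∈ Q
      · rw [indicator_of_mem hy, indicator_of_mem ((pg_sn s k y y' t t').2 ⟨hy, ht⟩)]
      · rw [indicator_of_notMem hy, indicator_of_notMem (fun h => hy ((pg_sn s k y y' t t').1 h).1)]
    · rw [indicator_of_notMem ht]
      rw [lintegral_eq_zero_of_ae_eq_zero]
      refine Filter.Eventually.of_forall fun y' => ?_
      simp only [Pi.zero_apply]
      rw [indicator_of_notMem (fun h => ht ((pg_sn s k y y' t t').1 h).2)]
  unfold DGrid.av
  rw [e, pg_vol, pg_vol, pow_succ,
    ENNReal.mul_inv (Or.inr (by simp)) (Or.inr (o2_ne k)), mul_assoc]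
  gcongr
  rw [← lintegral_const_mul' _ _ (ENNReal.inv_ne_top.2 (o2_ne k))]
  refine lintegral_mono fun y' => ?_
  refine le_trans (le_of_eq ?_) (DGrid.av_le_M _ volume k _ t)
  rw [DGrid.av, g1_vol]

lemma pg_bdd : ∀ {n : ℕ} (s : Fin n → Bool) {q : Fin n → ℝ}, (∀ i, 1 < q i) →
    ∃ C : ℝ≥0∞, C ≠ ∞ ∧ ∀ f, Measurable f →
      mixedLnorm n q ((pg s).M volume f) ≤ C * mixedLnorm n q f := by
  intro n
  induction n with
  | zero =>
    intro s q hq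
    refine ⟨1, by simp, fun f hf => ?_⟩
    rw [mixed_zero, mixed_zero, one_mul]
    refine iSup_le fun k => ?_
    rw [DGrid.av, pg_vol]
    simp only [pow_zero, inv_one, one_mul]
    rw [← lint_zero (F := f)]
    exact setLIntegral_le_lintegral _ _
  | succ n ih =>
    intro s q hq
    have hp := hq (Fin.last n)
    set p := q (Fin.last n) with hp'
    have hp0 : 0 < p := by linarith
    obtain ⟨C₁, hC₁, H₁⟩ := ih (fun i => s i.castSucc) (q := qi q) (fun i => hq _)
    have hAp : (g1 (s (Fin.last n))).Ap volume p 1 (fun _ => 1) := by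
      refine ⟨measurable_const, by simp, fun k x => ?_⟩
      obtain ⟨h0, hT⟩ := g1_good (s (Fin.last n)) k x
      simp only [ENNReal.one_rpow, lintegral_const, Measure.restrict_apply_univ, one_mul]
      nth_rewrite 1 [← ENNReal.rpow_one (volume _)]
      rw [← ENNReal.rpow_add _ _ h0 hT]
      simp
    obtain ⟨C₂, hC₂, H₂⟩ := ladder (g1 (s (Fin.last n))) (g1_good _) n (qi q) (fun i => hq _) p hp 1 (by simp)
    refine ⟨C₁ * C₂ ^ (1 / p), ENNReal.mul_ne_top hC₁ (ENNReal.rpow_ne_top_of_nonneg (by positivity) hC₂), fun f hf => ?_⟩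
    rw [mixed_succ, mixed_succ]
    have hfm : Measurable (fun z : (Fin n → ℝ) × ℝ => f (sn z.1 z.2)) := by fun_prop
    have hMm := DGrid.measurable_M_joint (g1 (s (Fin.last n))) volume (f := fun y t => f (sn y t)) hfm
    have hqi : ∀ i, 0 < qi q i := fun i => by have := hq i.castSucc; simp only [qi]; linarith
    have h3 := H₂ _ hAp (fun y t => f (sn y t)) hfm
    simp only [mul_one] at h3
    obtain ⟨H, hH⟩ : ∃ H : (Fin n → ℝ) → ℝ → ℝ≥0∞,
        ∀ y t, H y t = (g1 (s (Fin.last n))).M volume (fun t' => f (sn y t')) t := ⟨_, fun _ _ => rfl⟩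
    have hHm : Measurable (fun z : (Fin n → ℝ) × ℝ => H z.1 z.2) := by
      simp_rw [hH]; exact hMm
    simp_rw [← hH] at h3
    have hNm : Measurable (fun t => mixedLnorm n (qi q) fun y => H y t) :=
      mixed_meas (qi q) (F := fun t y => H y t) (hHm.comp measurable_swap)
    obtain ⟨N, hN⟩ : ∃ N : ℝ → ℝ≥0∞, ∀ t, N t = mixedLnorm n (qi q) fun y => H y t := ⟨_, fun _ => rfl⟩
    simp_rw [← hN] at h3 hNm
    calc LpN volume p (fun t => mixedLnorm n (qi q) fun y => (pg s).M volume f (sn y t))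
        ≤ LpN volume p (fun t => C₁ * N t) := by
          refine LpN_mono hp0 (Filter.Eventually.of_forall fun t => ?_)
          have h5 : ∀ y, (pg s).M volume f (sn y t) ≤
              (pg (fun i => s i.castSucc)).M volume (fun y' => H y' t) y := by
            intro y; simp_rw [hH]; exact pg_M_le s hf y t
          rw [hN]
          exact (mixed_mono hqi h5).trans (H₁ _ (hHm.comp (measurable_id.prodMk measurable_const)))
      _ = C₁ * LpN volume p N := (LpN_fnorm volume hp.le).smul C₁ hC₁ N hNm
      _ ≤ C₁ * (C₂ ^ (1 / p) * LpN volume p fun t => mixedLnorm n (qi q) fun y => f (sn y t)) := by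
          gcongr
          unfold LpN
          rw [← ENNReal.mul_rpow_of_nonneg _ _ (by positivity)]
          gcongr
      _ = _ := by rw [mul_assoc]
end

noncomputable section

lemma avg_dev {α : Type} [MeasurableSpace α] {μ : Measure α} {P : Set α} (h0 : μ P ≠ 0) (hT : μ P ≠ ∞)
    {b : α → ℝ} (hb : IntegrableOn b P μ) (c : ℝ) :
    ENNReal.ofReal |(⨍ y in P, b y ∂μ) - c| * μ P ≤ ∫⁻ y in P, ENNReal.ofReal |b y - c| ∂μ := by
  have hr : 0 < μ.real P := ENNReal.toReal_pos h0 hT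
  have h1 : ∫ y in P, (b y - c) ∂μ = μ.real P * ((⨍ y in P, b y ∂μ) - c) := by
    rw [integral_sub hb (by exact integrableOn_const hT), setAverage_eq, setIntegral_const]
    simp only [smul_eq_mul]
    field_simp
  have h2 := enorm_integral_le_lintegral_enorm (μ := μ.restrict P) (fun y => b y - c)
  rw [h1] at h2
  have e : ∀ r : ℝ, ‖r‖ₑ = ENNReal.ofReal |r| := fun r => by rw [← Real.norm_eq_abs, ofReal_norm]
  simp only [e] at h2
  rw [abs_mul, abs_of_pos hr, ENNReal.ofReal_mul hr.le, measureReal_def, ENNReal.ofReal_toReal hT] at h2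
  rwa [mul_comm]

namespace DGrid
variable {α : Type} [MeasurableSpace α] (G : DGrid α)

/-- mean values -/
def mn (μ : Measure α) (b : α → ℝ) (k : ℤ) (x : α) : ℝ := ⨍ y in G.cube k x, b y ∂μ

lemma mn_eq (μ : Measure α) (b : α → ℝ) {k : ℤ} {x y : α} (h : G.idx k x = G.idx k y) :
    G.mn μ b k x = G.mn μ b k y := by rw [mn, mn, G.cube_eq h]

lemma jn {μ : Measure α} (hG : G.Good μ) {D : ℝ} (hD : 1 ≤ D)
    (hdoub : ∀ k x, μ (G.cube (k + 1) x) ≤ ENNReal.ofReal D * μ (G.cube k x))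
    {b : α → ℝ} (hb : Measurable b) (hbi : ∀ k x, IntegrableOn b (G.cube k x) μ)
    (hosc : ∀ k x, ∫⁻ y in G.cube k x, ENNReal.ofReal |b y - G.mn μ b k x| ∂μ ≤ μ (G.cube k x))
    (hdiff : ∀ᵐ x ∂μ, Filter.Tendsto (fun k : ℕ => G.mn μ b (-(k : ℤ)) x) Filter.atTop (nhds (b x)))
    {lam : ℝ} (hlam : 0 < lam) (hlam2 : Real.exp (lam * (D + 2)) ≤ 3 / 2) (k₀ : ℤ) (x₀ : α) :
    ∫⁻ y in G.cube k₀ x₀, ENNReal.ofReal (Real.exp (lam * |b y - G.mn μ b k₀ x₀|)) ∂μ ≤ 6 * μ (G.cube k₀ x₀) := by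
  set φ : ℕ → ℝ → ℝ≥0∞ := fun N r => min (ENNReal.ofReal (Real.exp (lam * r))) N with hφ
  have hφm : ∀ N, Measurable (φ N) := fun N => by fun_prop
  have hφmono : ∀ N r r', r ≤ r' → φ N r ≤ φ N r' := by
    intro N r r' h
    simp only [hφ]
    gcongr
  have main : ∀ N : ℕ, ∀ k x, ∫⁻ y in G.cube k x, φ N |b y - G.mn μ b k x| ∂μ ≤ 6 * μ (G.cube k x) := by
    intro N
    set A : ℝ≥0∞ := ⨆ k, ⨆ x, (μ (G.cube k x))⁻¹ * ∫⁻ y in G.cube k x, φ N |b y - G.mn μ b k x| ∂μ with hA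
    have hAle : ∀ k x, ∫⁻ y in G.cube k x, φ N |b y - G.mn μ b k x| ∂μ ≤ A * μ (G.cube k x) := by
      intro k x
      have : (μ (G.cube k x))⁻¹ * ∫⁻ y in G.cube k x, φ N |b y - G.mn μ b k x| ∂μ ≤ A :=
        le_iSup_of_le k (le_iSup_of_le x le_rfl)
      rwa [mul_comm, ← div_eq_mul_inv, ENNReal.div_le_iff (hG k x).1 (hG k x).2] at this
    have hAT : A ≠ ∞ := by
      refine ne_top_of_le_ne_top (b := (N : ℝ≥0∞)) (by simp) (iSup_le fun k => iSup_le fun x => ?_)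
      rw [mul_comm, ← div_eq_mul_inv, ENNReal.div_le_iff (hG k x).1 (hG k x).2]
      calc _ ≤ ∫⁻ y in G.cube k x, (N : ℝ≥0∞) ∂μ := lintegral_mono fun y => min_le_right _ _
        _ = _ := by simp
    have step : ∀ k₀ x₀, ∫⁻ y in G.cube k₀ x₀, φ N |b y - G.mn μ b k₀ x₀| ∂μ
        ≤ (3 / 4 * A + 3 / 2) * μ (G.cube k₀ x₀) := by
      intro k₀ x₀
      set m₀ := G.mn μ b k₀ x₀ with hm₀
      set Q := G.cube k₀ x₀ with hQ
      have hQm : MeasurableSet Q := G.measurableSet_cube _ _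
      set bad : ℤ → α → Prop := fun k x => k ≤ k₀ ∧ x ∈ Q ∧ 2 < |G.mn μ b k x - m₀| with hbad
      have hbadc : ∀ k x y, G.idx k x = G.idx k y → bad k x → bad k y := by
        rintro k x y h ⟨h1, h2, h3⟩
        refine ⟨h1, ?_, by rwa [← G.mn_eq μ b h]⟩
        exact (G.nest_le h1 _ _ h).symm.trans h2
      set E := {x | ∃ k ≤ k₀, bad k x} with hE
      have hEm : MeasurableSet E := by
        have : E = ⋃ k : ℤ, {x | k ≤ k₀ ∧ bad k x} := by
          ext x; simp [hE]
        rw [this]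
        refine MeasurableSet.iUnion fun k => ?_
        refine measurableSet_setOfPred.2 (G.measurable_of_idx k _ fun x y h => ?_)
        exact propext ⟨fun h' => ⟨h'.1, hbadc k x y h h'.2⟩, fun h' => ⟨h'.1, hbadc k y x h.symm h'.2⟩⟩
      have hEQ : E ⊆ Q := by rintro x ⟨k, _, _, h, _⟩; exact h
      have hE1 : ∫⁻ x in E, 1 ∂μ ≤ ∫⁻ x in E, 2⁻¹ * ENNReal.ofReal |b x - m₀| ∂μ := by
        refine G.stopping_bound μ bad hbadc k₀ _ _ fun k hk x hx _ => ?_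
        rw [lintegral_const_mul _ (by fun_prop)]
        have h1 := avg_dev (hG k x).1 (hG k x).2 (hbi k x) m₀
        have h2 : (2 : ℝ≥0∞) ≤ ENNReal.ofReal |G.mn μ b k x - m₀| := by
          rw [← ENNReal.ofReal_ofNat]; exact ENNReal.ofReal_le_ofReal hx.2.2.le
        calc ∫⁻ y in G.cube k x, 1 ∂μ = 2⁻¹ * (2 * μ (G.cube k x)) := by
              rw [← mul_assoc, ENNReal.inv_mul_cancel (by simp) (by simp)]; simp
          _ ≤ 2⁻¹ * ∫⁻ y in G.cube k x, ENNReal.ofReal |b y - m₀| ∂μ := by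
              gcongr
              refine le_trans ?_ h1
              gcongr
              exact h2
      have hEμ : μ E ≤ 2⁻¹ * μ Q := by
        rw [lintegral_const_mul _ (by fun_prop)] at hE1
        simp only [lintegral_const, Measure.restrict_apply_univ, one_mul] at hE1
        refine hE1.trans ?_
        gcongr
        exact (lintegral_mono_set hEQ).trans (hosc k₀ x₀)
      have hE2 : ∫⁻ x in E, φ N |b x - m₀| ∂μ ≤ ∫⁻ x in E, 3 / 2 * A ∂μ := by
        refine G.stopping_bound μ bad hbadc k₀ _ _ fun k hk x hx hmax => ?_
        have hk' : k < k₀ := by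
          rcases hk.lt_or_eq with h | h
          · exact h
          · exfalso
            have h3 := hx.2.2
            rw [h, G.mn_eq μ b (show G.idx k₀ x = G.idx k₀ x₀ from hx.2.1), ← hm₀] at h3
            simp at h3
            linarith
        have hpar : |G.mn μ b (k + 1) x - m₀| ≤ 2 := by
          by_contra hcon
          push Not at hcon
          exact hmax (k + 1) (by omega) (by omega) ⟨by omega, hx.2.1, hcon⟩
        have hch : |G.mn μ b k x - G.mn μ b (k + 1) x| ≤ D := by
          have h1 := avg_dev (hG k x).1 (hG k x).2 (hbi k x) (G.mn μ b (k + 1) x)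
          have h2 : ∫⁻ y in G.cube k x, ENNReal.ofReal |b y - G.mn μ b (k + 1) x| ∂μ
              ≤ ENNReal.ofReal D * μ (G.cube k x) :=
            (lintegral_mono_set (G.cube_subset (by omega) x)).trans ((hosc (k + 1) x).trans (hdoub k x))
          have h3 := h1.trans h2
          rw [ENNReal.mul_le_mul_iff_left (hG k x).1 (hG k x).2] at h3
          exact (ENNReal.ofReal_le_ofReal_iff (by linarith)).1 h3
        have hc : |G.mn μ b k x - m₀| ≤ D + 2 := by
          calc _ ≤ |G.mn μ b k x - G.mn μ b (k + 1) x| + |G.mn μ b (k + 1) x - m₀| := abs_sub_le _ _ _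
            _ ≤ _ := by linarith
        have hpt : ∀ y, φ N |b y - m₀| ≤ 3 / 2 * φ N |b y - G.mn μ b k x| := by
          intro y
          have h1 : |b y - m₀| ≤ |b y - G.mn μ b k x| + (D + 2) := by
            calc _ ≤ |b y - G.mn μ b k x| + |G.mn μ b k x - m₀| := abs_sub_le _ _ _
              _ ≤ _ := by linarith
          have h32 : (3 / 2 : ℝ≥0∞) = ENNReal.ofReal (3 / 2) := by
            rw [ENNReal.ofReal_div_of_pos (by norm_num)]; simp
          simp only [hφ]
          rw [h32]
          rcases le_total (ENNReal.ofReal (Real.exp (lam * |b y - G.mn μ b k x|))) N with h | h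
          · rw [min_eq_left h, ← ENNReal.ofReal_mul (by norm_num)]
            refine (min_le_left _ _).trans (ENNReal.ofReal_le_ofReal ?_)
            calc Real.exp (lam * |b y - m₀|) ≤ Real.exp (lam * (D + 2) + lam * |b y - G.mn μ b k x|) := by
                  apply Real.exp_le_exp.2; nlinarith
              _ ≤ _ := by rw [Real.exp_add]; gcongr
          · rw [min_eq_right h]
            refine (min_le_right _ _).trans ?_
            nth_rewrite 1 [← one_mul (N : ℝ≥0∞)]
            gcongr
            rw [← ENNReal.ofReal_one]; exact ENNReal.ofReal_le_ofReal (by norm_num)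
        calc ∫⁻ y in G.cube k x, φ N |b y - m₀| ∂μ
            ≤ ∫⁻ y in G.cube k x, 3 / 2 * φ N |b y - G.mn μ b k x| ∂μ := lintegral_mono hpt
          _ = 3 / 2 * ∫⁻ y in G.cube k x, φ N |b y - G.mn μ b k x| ∂μ :=
              lintegral_const_mul _ ((hφm N).comp (by fun_prop))
          _ ≤ 3 / 2 * (A * μ (G.cube k x)) := by gcongr; exact hAle k x
          _ = _ := by simp [mul_assoc]
      have hE3 : ∫⁻ x in Q \ E, φ N |b x - m₀| ∂μ ≤ 3 / 2 * μ Q := by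
        calc ∫⁻ x in Q \ E, φ N |b x - m₀| ∂μ ≤ ∫⁻ x in Q \ E, 3 / 2 ∂μ := by
              refine lintegral_mono_ae ?_
              filter_upwards [ae_restrict_mem (hQm.diff hEm), ae_restrict_of_ae hdiff] with x hx hd
              have h1 : |b x - m₀| ≤ 2 := by
                refine le_of_tendsto ((hd.sub_const m₀).abs) ?_
                filter_upwards [Filter.eventually_ge_atTop (-k₀).toNat] with j hj
                by_contra hcon
                push Not at hcon
                have hjk : -(j : ℤ) ≤ k₀ := by omega
                exact hx.2 ⟨-(j : ℤ), hjk, hjk, hx.1, hcon⟩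
              refine (hφmono N _ _ h1).trans ((min_le_left _ _).trans ?_)
              have h32 : (3 / 2 : ℝ≥0∞) = ENNReal.ofReal (3 / 2) := by
                rw [ENNReal.ofReal_div_of_pos (by norm_num)]; simp
              rw [h32]
              refine ENNReal.ofReal_le_ofReal (le_trans (Real.exp_le_exp.2 ?_) hlam2)
              nlinarith
          _ = 3 / 2 * μ (Q \ E) := by simp
          _ ≤ _ := by gcongr; exact sdiff_subset
      calc ∫⁻ y in Q, φ N |b y - m₀| ∂μ = ∫⁻ y in E, φ N |b y - m₀| ∂μ + ∫⁻ y in Q \ E, φ N |b y - m₀| ∂μ := by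
            rw [← lintegral_inter_add_sdiff (μ := μ) _ Q hEm, inter_eq_self_of_subset_right hEQ]
        _ ≤ 3 / 2 * A * (2⁻¹ * μ Q) + 3 / 2 * μ Q := by
            gcongr
            refine hE2.trans ?_
            rw [lintegral_const, Measure.restrict_apply_univ]
            gcongr
        _ = _ := by
            have : (3 / 4 : ℝ≥0∞) = 3 / 2 * 2⁻¹ := by
              rw [div_eq_mul_inv, div_eq_mul_inv, mul_assoc, ← ENNReal.mul_inv (by simp) (by simp)]; norm_num
            rw [this]; ring
    have hA1 : A ≤ 3 / 4 * A + 3 / 2 := by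
      refine iSup_le fun k => iSup_le fun x => ?_
      rw [mul_comm, ← div_eq_mul_inv, ENNReal.div_le_iff (hG k x).1 (hG k x).2]
      exact step k x
    have hA6 : A ≤ 6 := by
      clear_value A
      lift A to NNReal using hAT
      have h34 : (3 / 4 : ℝ≥0∞) = ((3 / 4 : NNReal) : ℝ≥0∞) := by
        rw [ENNReal.coe_div (by norm_num)]; simp
      have h32 : (3 / 2 : ℝ≥0∞) = ((3 / 2 : NNReal) : ℝ≥0∞) := by
        rw [ENNReal.coe_div (by norm_num)]; simp
      rw [h34, h32] at hA1
      norm_cast at hA1 ⊢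
      rw [← NNReal.coe_le_coe] at hA1 ⊢
      push_cast at hA1 ⊢
      linarith
    intro k x
    exact (hAle k x).trans (by gcongr)
  have hsup : ∀ y, ENNReal.ofReal (Real.exp (lam * |b y - G.mn μ b k₀ x₀|)) = ⨆ N, φ N |b y - G.mn μ b k₀ x₀| := by
    intro y
    refine le_antisymm ?_ (iSup_le fun N => min_le_left _ _)
    obtain ⟨N, hN⟩ := ENNReal.exists_nat_gt (r := ENNReal.ofReal (Real.exp (lam * |b y - G.mn μ b k₀ x₀|))) (by simp)
    exact le_iSup_of_le N (le_min le_rfl hN.le)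
  simp_rw [hsup]
  have hmm : ∀ N, Measurable (fun y => φ N |b y - G.mn μ b k₀ x₀|) := fun N => (hφm N).comp (by fun_prop)
  rw [lintegral_iSup hmm]
  · exact iSup_le fun N => main N k₀ x₀
  · intro i j hij y
    simp only [hφ]
    gcongr
end DGrid
end

noncomputable section

lemma pg_doub {n : ℕ} (s : Fin n → Bool) (k : ℤ) (x : Fin n → ℝ) :
    volume ((pg s).cube (k + 1) x) ≤ ENNReal.ofReal (2 ^ n) * volume ((pg s).cube k x) := by
  rw [pg_vol, pg_vol, ENNReal.ofReal_pow (by norm_num), ← mul_pow, ← ENNReal.ofReal_mul (by norm_num),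
    zpow_add_one₀ (by norm_num), mul_comm]

lemma pg_mem_dist {n : ℕ} (s : Fin n → Bool) (k : ℤ) (x y : Fin n → ℝ) (h : y ∈ (pg s).cube k x) (i : Fin n) :
    |x i - y i| < 2 ^ k := by
  have h1 : y i ∈ (g1 (s i)).cube k (x i) := (mem_pg_cube s k x y).1 h i
  have h2 : x i ∈ (g1 (s i)).cube k (x i) := DGrid.mem_cube _ _ _
  rw [g1_cube, mem_Ico] at h1 h2
  rw [abs_lt]; constructor <;> linarith [h1.1, h1.2, h2.1, h2.2]

lemma pg_int {n : ℕ} (s : Fin n → Bool) {b : (Fin n → ℝ) → ℝ} (hb : LocallyIntegrable b) (k : ℤ) (x : Fin n → ℝ) :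
    IntegrableOn b ((pg s).cube k x) := by
  refine (hb.integrableOn_isCompact (isCompact_closedBall x (2 ^ k))).mono_set fun y hy => ?_
  rw [Metric.mem_closedBall, dist_pi_le_iff (by positivity)]
  intro i
  rw [dist_comm, Real.dist_eq]
  exact (pg_mem_dist s k x y hy i).le

lemma pg_diff {n : ℕ} (s : Fin n → Bool) {b : (Fin n → ℝ) → ℝ} (hb : LocallyIntegrable b) :
    ∀ᵐ x, Filter.Tendsto (fun k : ℕ => (pg s).mn volume b (-(k : ℤ)) x) Filter.atTop (nhds (b x)) := by
  filter_upwards [IsUnifLocDoublingMeasure.ae_tendsto_average (μ := volume) hb 1] with x hx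
  set w : ℕ → Fin n → ℝ := fun k i => lo (s i) (-(k : ℤ)) (x i) + 2 ^ (-(k : ℤ)) / 2 with hw
  set δ : ℕ → ℝ := fun k => 2 ^ (-(k : ℤ)) / 2 with hδ
  have hδp : ∀ k, 0 < δ k := fun k => by simp only [hδ]; positivity
  have hδ0 : Filter.Tendsto δ Filter.atTop (nhdsWithin 0 (Ioi 0)) := by
    rw [tendsto_nhdsWithin_iff]
    refine ⟨?_, Filter.Eventually.of_forall hδp⟩
    have h1 : Filter.Tendsto (fun k : ℕ => (1 / 2 : ℝ) ^ k / 2) Filter.atTop (nhds (0 / 2)) :=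
      (_root_.tendsto_pow_atTop_nhds_zero_of_lt_one (by norm_num) (by norm_num)).div_const 2
    rw [zero_div] at h1
    refine h1.congr fun k => ?_
    simp [hδ]
  have hmem : ∀ k : ℕ, (pg s).cube (-(k : ℤ)) x ⊆ Metric.closedBall (w k) (1 * δ k) := by
    intro k y hy
    rw [one_mul, Metric.mem_closedBall, dist_pi_le_iff (hδp k).le]
    intro i
    have h1 := (mem_pg_cube s _ x y).1 hy i
    rw [g1_cube, mem_Ico] at h1
    rw [Real.dist_eq, abs_le]
    simp only [hw, hδ]
    constructor <;> linarith [h1.1, h1.2]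
  have h := hx w δ hδ0 (Filter.Eventually.of_forall fun k => hmem k (DGrid.mem_cube _ _ _))
  refine h.congr fun k => ?_
  unfold DGrid.mn
  refine (setAverage_congr ?_).symm
  have e0 := closedBall_pi (w k) (hδp k).le
  have e : (fun i => Metric.closedBall (w k i) (δ k)) = fun i =>
      Icc (lo (s i) (-(k : ℤ)) (x i)) (lo (s i) (-(k : ℤ)) (x i) + 2 ^ (-(k : ℤ))) := by
    funext i
    rw [Real.closedBall_eq_Icc]
    simp only [hw, hδ]
    congr 1 <;> ring
  rw [e0, e, pg_cube]
  refine Measure.univ_pi_Ico_ae_eq_Icc.trans ?_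
  rw [pi_univ_Icc]
  exact Filter.EventuallyEq.rfl

lemma eball_sub {n : ℕ} (x : Fin n → ℝ) (r : ℝ) (hr : 0 < r) : eball n x r ⊆ Metric.ball x r := by
  intro y hy
  rw [Metric.mem_ball, dist_pi_lt_iff hr]
  intro i
  have h1 : Real.sqrt (∑ i, (x i - y i) ^ 2) < r := hy
  rw [Real.sqrt_lt' hr] at h1
  rw [dist_comm, Real.dist_eq]
  refine abs_lt_of_sq_lt_sq (lt_of_le_of_lt ?_ h1) hr.le
  exact Finset.single_le_sum (f := fun i => (x i - y i) ^ 2) (fun j _ => sq_nonneg _) (Finset.mem_univ i)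

lemma sub_eball {n : ℕ} (hn : 0 < n) (x : Fin n → ℝ) (r : ℝ) (hr : 0 < r) : Metric.ball x (r / n) ⊆ eball n x r := by
  intro y hy
  have hn' : (1 : ℝ) ≤ n := by exact_mod_cast hn
  rw [Metric.mem_ball] at hy
  show Real.sqrt (∑ i, (x i - y i) ^ 2) < r
  rw [Real.sqrt_lt' hr]
  have h1 : ∑ i, (x i - y i) ^ 2 ≤ ∑ _i : Fin n, (dist y x) ^ 2 := by
    refine Finset.sum_le_sum fun i _ => ?_
    refine sq_le_sq' ?_ ?_
    all_goals
      have := dist_le_pi_dist y x i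
      rw [Real.dist_eq, abs_le] at this
      linarith [this.1, this.2]
  have h2 : dist y x * n < r := by rwa [lt_div_iff₀ (by linarith)] at hy
  simp at h1
  have h0 : 0 ≤ dist y x := dist_nonneg
  nlinarith [mul_nonneg h0 h0, mul_nonneg h0 (by linarith : (0:ℝ) ≤ n)]

lemma eball_open (n : ℕ) (x : Fin n → ℝ) (r : ℝ) : IsOpen (eball n x r) := by
  unfold eball eudist
  exact isOpen_lt (by fun_prop) continuous_const

lemma eball_vol_le {n : ℕ} (x : Fin n → ℝ) (r : ℝ) (hr : 0 < r) :
    volume (eball n x r) ≤ ENNReal.ofReal (2 * r) ^ n := by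
  refine (measure_mono (eball_sub x r hr)).trans ?_
  rw [Real.volume_pi_ball _ hr, ENNReal.ofReal_pow (by positivity)]; simp

lemma le_eball_vol {n : ℕ} (hn : 0 < n) (x : Fin n → ℝ) (r : ℝ) (hr : 0 < r) :
    ENNReal.ofReal (2 * (r / n)) ^ n ≤ volume (eball n x r) := by
  have hn' : (0 : ℝ) < n := by exact_mod_cast hn
  refine le_trans ?_ (measure_mono (sub_eball hn x r hr))
  rw [Real.volume_pi_ball _ (by positivity), ENNReal.ofReal_pow (by positivity)]; simp

lemma eball_vol_ne {n : ℕ} (hn : 0 < n) (x : Fin n → ℝ) (r : ℝ) (hr : 0 < r) :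
    volume (eball n x r) ≠ 0 ∧ volume (eball n x r) ≠ ∞ := by
  have hn' : (0 : ℝ) < n := by exact_mod_cast hn
  constructor
  · refine ne_of_gt (lt_of_lt_of_le ?_ (le_eball_vol hn x r hr))
    have : (0:ℝ) < 2 * (r / n) := by positivity
    exact ENNReal.pow_pos (by simpa using this) _
  · exact ne_top_of_le_ne_top (ENNReal.pow_ne_top ENNReal.ofReal_ne_top) (eball_vol_le x r hr)

lemma eball_int {n : ℕ} {b : (Fin n → ℝ) → ℝ} (hb : LocallyIntegrable b) (x : Fin n → ℝ) (r : ℝ) (hr : 0 < r) :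
    IntegrableOn b (eball n x r) :=
  (hb.integrableOn_isCompact (isCompact_closedBall x r)).mono_set
    ((eball_sub x r hr).trans Metric.ball_subset_closedBall)

lemma bmo_eball {n : ℕ} (hn : 0 < n) {b : (Fin n → ℝ) → ℝ} (hb : LocallyIntegrable b) {β : ℝ≥0∞}
    (h : bmoNorm n b ≤ β) (x : Fin n → ℝ) (r : ℝ) (hr : 0 < r) :
    ∫⁻ y in eball n x r, ENNReal.ofReal |b y - ⨍ z in eball n x r, b z| ≤ β * volume (eball n x r) := by
  have hv := eball_vol_ne hn x r hr
  have h1 : ENNReal.ofReal ((volume (eball n x r)).toReal⁻¹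
      * ∫ y in eball n x r, |b y - ⨍ z in eball n x r, b z|) ≤ β := by
    refine le_trans ?_ h
    exact le_iSup_of_le x (le_iSup_of_le r (le_iSup_of_le hr le_rfl))
  have hi : IntegrableOn (fun y => |b y - ⨍ z in eball n x r, b z|) (eball n x r) :=
    ((eball_int hb x r hr).sub (integrableOn_const hv.2)).abs
  rw [ENNReal.ofReal_mul (by positivity), ENNReal.ofReal_inv_of_pos (ENNReal.toReal_pos hv.1 hv.2),
    ENNReal.ofReal_toReal hv.2,
    ofReal_integral_eq_lintegral_ofReal hi (Filter.Eventually.of_forall fun y => abs_nonneg _),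
    mul_comm, ← div_eq_mul_inv, ENNReal.div_le_iff hv.1 hv.2] at h1
  exact h1

lemma pg_osc {n : ℕ} (hn : 0 < n) (s : Fin n → Bool) {b : (Fin n → ℝ) → ℝ} (hb : LocallyIntegrable b)
    {β : ℝ≥0∞} (h : bmoNorm n b ≤ β) (k : ℤ) (x : Fin n → ℝ) :
    ∫⁻ y in (pg s).cube k x, ENNReal.ofReal |b y - (pg s).mn volume b k x|
      ≤ 2 * (4 * n) ^ n * β * volume ((pg s).cube k x) := by
  have hn' : (1 : ℝ) ≤ n := by exact_mod_cast hn
  have h2k : (0 : ℝ) < 2 ^ k := by positivity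
  set Q := (pg s).cube k x with hQ
  have hR : (0 : ℝ) < 2 * n * 2 ^ k := by positivity
  set R : ℝ := 2 * n * 2 ^ k with hRd
  have hQB : Q ⊆ eball n x R := by
    refine Subset.trans ?_ (sub_eball hn x R hR)
    intro y hy
    rw [Metric.mem_ball, dist_pi_lt_iff (by positivity)]
    intro i
    rw [dist_comm, Real.dist_eq]
    have h1 := pg_mem_dist s k x y hy i
    have : R / n = 2 * 2 ^ k := by rw [hRd]; field_simp
    rw [this]; linarith
  set m := ⨍ z in eball n x R, b z with hm
  set m' := (pg s).mn volume b k x with hm'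
  have hBv : volume (eball n x R) ≤ (4 * n) ^ n * volume Q := by
    refine (eball_vol_le x R hR).trans ?_
    rw [hQ, pg_vol, ← mul_pow]
    refine pow_le_pow_left' ?_ n
    have : 2 * R = (4 * n) * 2 ^ k := by rw [hRd]; ring
    rw [this, ENNReal.ofReal_mul (by positivity), ENNReal.ofReal_mul (by norm_num)]
    simp
  have h1 := avg_dev (pg_good s k x).1 (pg_good s k x).2 (pg_int s hb k x) m
  have h2 : ∫⁻ y in Q, ENNReal.ofReal |b y - m| ≤ β * ((4 * n) ^ n * volume Q) :=
    (lintegral_mono_set hQB).trans ((bmo_eball hn hb h x R hR).trans (by gcongr))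
  calc ∫⁻ y in Q, ENNReal.ofReal |b y - m'|
      ≤ ∫⁻ y in Q, (ENNReal.ofReal |b y - m| + ENNReal.ofReal |m' - m|) := by
        refine lintegral_mono fun y => ?_
        rw [← ENNReal.ofReal_add (abs_nonneg _) (abs_nonneg _)]
        refine ENNReal.ofReal_le_ofReal ?_
        rw [abs_sub_comm m' m]
        exact abs_sub_le _ _ _
    _ = (∫⁻ y in Q, ENNReal.ofReal |b y - m|) + ENNReal.ofReal |m' - m| * volume Q := by
        rw [lintegral_add_right _ measurable_const]; simp
    _ ≤ β * ((4 * n) ^ n * volume Q) + β * ((4 * n) ^ n * volume Q) := by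
        exact add_le_add h2 (h1.trans h2)
    _ = _ := by ring
end

noncomputable section
namespace DGrid
variable {α : Type} [MeasurableSpace α] (G : DGrid α)
set_option linter.unusedSectionVars false

/-- dyadic maximal commutator -/
def cm (μ : Measure α) (b : α → ℝ) (f : α → ℝ≥0∞) (x : α) : ℝ≥0∞ :=
  ⨆ k : ℤ, (μ (G.cube k x))⁻¹ * ∫⁻ y in G.cube k x, ENNReal.ofReal |b x - b y| * f y ∂μ

/-- exponential weight -/
def ew (b : α → ℝ) (θ : ℝ) (x : α) : ℝ≥0∞ := ENNReal.ofReal (Real.exp (θ * b x))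

lemma ew_meas {b : α → ℝ} (hb : Measurable b) (θ : ℝ) : Measurable (ew b θ) := by
  unfold ew; fun_prop

lemma ew_ne (b : α → ℝ) (θ : ℝ) (x : α) : ew b θ x ≠ 0 ∧ ew b θ x ≠ ∞ := by
  unfold ew; simp [Real.exp_pos]

lemma ew_mul (b : α → ℝ) (θ η : ℝ) (x : α) : ew b θ x * ew b η x = ew b (θ + η) x := by
  unfold ew
  rw [← ENNReal.ofReal_mul (Real.exp_pos _).le, ← Real.exp_add]; ring_nf

lemma ew_zero (b : α → ℝ) (x : α) : ew b 0 x = 1 := by simp [ew]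

lemma ew_inv (b : α → ℝ) (θ : ℝ) (x : α) : (ew b θ x)⁻¹ = ew b (-θ) x := by
  unfold ew
  rw [← ENNReal.ofReal_inv_of_pos (Real.exp_pos _), ← Real.exp_neg]; ring_nf

/-- the majorant of the dyadic commutator -/
def cF (μ : Measure α) (b : α → ℝ) (ε : ℝ) (f : α → ℝ≥0∞) (x : α) : ℝ≥0∞ :=
  ew b ε x * G.M μ (fun y => ew b (-ε) y * f y) x + ew b (-ε) x * G.M μ (fun y => ew b ε y * f y) x

lemma cF_meas (μ : Measure α) {b : α → ℝ} (hb : Measurable b) (ε : ℝ) (f : α → ℝ≥0∞) :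
    Measurable (G.cF μ b ε f) := by
  unfold cF
  exact ((ew_meas hb ε).mul (G.measurable_M _ _)).add ((ew_meas hb (-ε)).mul (G.measurable_M _ _))

lemma cm_le {μ : Measure α} {b : α → ℝ} (hb : Measurable b) {ε : ℝ} (hε : 0 < ε) {f : α → ℝ≥0∞}
    (hf : Measurable f) (x : α) :
    G.cm μ b f x ≤ ENNReal.ofReal ε⁻¹ * G.cF μ b ε f x := by
  refine iSup_le fun k => ?_
  have hm1 : Measurable fun y => ew b (-ε) y * f y := (ew_meas hb _).mul hf
  have hm2 : Measurable fun y => ew b ε y * f y := (ew_meas hb _).mul hf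
  have hpt : ∀ y, ENNReal.ofReal |b x - b y| * f y ≤ ENNReal.ofReal ε⁻¹ *
      (ew b ε x * (ew b (-ε) y * f y) + ew b (-ε) x * (ew b ε y * f y)) := by
    intro y
    have h1 : |b x - b y| ≤ ε⁻¹ * (Real.exp (ε * b x) * Real.exp (-ε * b y) +
        Real.exp (-ε * b x) * Real.exp (ε * b y)) := by
      rw [← Real.exp_add, ← Real.exp_add]
      have a1 := Real.add_one_le_exp (ε * b x + -ε * b y)
      have a2 := Real.add_one_le_exp (-ε * b x + ε * b y)
      have p1 := Real.exp_pos (ε * b x + -ε * b y)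
      have p2 := Real.exp_pos (-ε * b x + ε * b y)
      rw [inv_mul_eq_div, le_div_iff₀ hε]
      rcases abs_cases (b x - b y) with h | h <;> rw [h.1] <;> nlinarith
    calc ENNReal.ofReal |b x - b y| * f y ≤ (ENNReal.ofReal ε⁻¹ * (ew b ε x * ew b (-ε) y + ew b (-ε) x * ew b ε y)) * f y := by
          gcongr
          unfold ew
          rw [← ENNReal.ofReal_mul (Real.exp_pos _).le, ← ENNReal.ofReal_mul (Real.exp_pos _).le,
            ← ENNReal.ofReal_add (by positivity) (by positivity), ← ENNReal.ofReal_mul (by positivity)]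
          exact ENNReal.ofReal_le_ofReal h1
      _ = _ := by ring
  calc (μ (G.cube k x))⁻¹ * ∫⁻ y in G.cube k x, ENNReal.ofReal |b x - b y| * f y ∂μ
      ≤ (μ (G.cube k x))⁻¹ * ∫⁻ y in G.cube k x, ENNReal.ofReal ε⁻¹ *
      (ew b ε x * (ew b (-ε) y * f y) + ew b (-ε) x * (ew b ε y * f y)) ∂μ := by
        exact mul_le_mul_right (lintegral_mono hpt) _
    _ = ENNReal.ofReal ε⁻¹ * (ew b ε x * G.av μ k (fun y => ew b (-ε) y * f y) x +
        ew b (-ε) x * G.av μ k (fun y => ew b ε y * f y) x) := by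
        rw [lintegral_const_mul' _ _ ENNReal.ofReal_ne_top,
          lintegral_add_left (by exact hm1.const_mul _), lintegral_const_mul _ hm1, lintegral_const_mul _ hm2]
        unfold av
        ring
    _ ≤ _ := by
        unfold cF
        gcongr
        · exact G.av_le_M μ k _ x
        · exact G.av_le_M μ k _ x

lemma A1gen {μ : Measure α} (hG : G.Good μ) (k : ℤ) (x : α) (Y : α → ℝ≥0∞) (D : ℝ≥0∞) (hD : D ≠ ∞)
    (hYm : Measurable Y) (hY : ∀ᵐ x ∂μ, Y x ≠ 0 ∧ Y x ≠ ∞)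
    (hYD : ∀ x, G.M μ Y x ≤ D * Y x) : G.av μ k Y x ≠ 0 ∧ G.av μ k Y x ≠ ∞ ∧
        (∀ y ∈ G.cube k x, G.av μ k Y x ≤ D * Y y) ∧
        ∫⁻ y in G.cube k x, Y y ∂μ = μ (G.cube k x) * G.av μ k Y x := by
  obtain ⟨hm0, hmT⟩ := hG k x
  have h3 : ∀ y ∈ G.cube k x, G.av μ k Y x ≤ D * Y y := by
    intro y hy
    rw [G.av_eq μ Y (show G.idx k x = G.idx k y from Eq.symm hy)]
    exact (G.av_le_M _ _ _ _).trans (hYD y)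
  refine ⟨?_, ?_, h3, ?_⟩
  · exact mul_ne_zero (ENNReal.inv_ne_zero.2 hmT) (G.pos_lint hG hYm (hY.mono fun _ h => h.1) k x)
  · obtain ⟨y, hy, hy2⟩ : ∃ y ∈ G.cube k x, Y y ≠ ∞ := by
      by_contra hcon
      push Not at hcon
      apply hm0
      refine measure_mono_null (t := {y | ¬ (Y y ≠ 0 ∧ Y y ≠ ∞)}) (fun y hy => ?_) hY
      intro h; exact h.2 (hcon y hy)
    exact ne_top_of_le_ne_top (ENNReal.mul_ne_top hD hy2) (h3 y hy)
  · rw [av, ← mul_assoc, ENNReal.mul_inv_cancel hm0 hmT, one_mul]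

lemma half {μ : Measure α} {Q : Set α} (hQm : MeasurableSet Q) {V U X : α → ℝ≥0∞} (hUm : Measurable U)
    (hXm : Measurable X) {s s' : ℝ} (hs : s.HolderConjugate s')
    {A v u m : ℝ≥0∞} (hv0 : v ≠ 0) (hA : A ≠ ∞)
    (hVv : ∀ y ∈ Q, v ≤ A * V y ^ s) (hUu : ∫⁻ y in Q, U y ^ s ∂μ = m * u)
    (hX : ∫⁻ y in Q, X y ^ s' ∂μ ≤ 6 * m) :
    ∫⁻ y in Q, (V y)⁻¹ * U y * X y ∂μ ≤ (A / v) ^ (1 / s) * ((m * u) ^ (1 / s) * (6 * m) ^ (1 / s')) := by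
  have hs0 : 0 < s := hs.pos
  have hs0' : 0 < s' := hs.symm.pos
  have hAv : (A / v) ^ (1 / s) ≠ ∞ :=
    ENNReal.rpow_ne_top_of_nonneg (by positivity) (ENNReal.div_ne_top hA hv0)
  calc ∫⁻ y in Q, (V y)⁻¹ * U y * X y ∂μ ≤ ∫⁻ y in Q, (A / v) ^ (1 / s) * (U y * X y) ∂μ := by
        refine setLIntegral_mono' hQm fun y hy => ?_
        rw [mul_assoc]
        gcongr
        rw [ENNReal.inv_le_iff_inv_le, ← ENNReal.inv_rpow, ENNReal.inv_div (Or.inr hA) (Or.inr ?_), one_div, ENNReal.rpow_inv_le_iff hs0]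
        · exact ENNReal.div_le_of_le_mul' (hVv y hy)
        · rintro rfl
          have := hVv y hy
          simp at this
          exact hv0 this
    _ = (A / v) ^ (1 / s) * ∫⁻ y in Q, U y * X y ∂μ := lintegral_const_mul' _ _ hAv
    _ ≤ _ := by
        gcongr
        refine (ENNReal.lintegral_mul_le_Lp_mul_Lq (μ.restrict Q) hs hUm.aemeasurable hXm.aemeasurable).trans ?_
        rw [hUu]
        gcongr

lemma wAp {μ : Measure α} (hG : G.Good μ) {b : α → ℝ} (hb : Measurable b) {lam : ℝ}
    (hJ : ∀ k x, ∫⁻ y in G.cube k x, ENNReal.ofReal (Real.exp (lam * |b y - G.mn μ b k x|)) ∂μ ≤ 6 * μ (G.cube k x))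
    {s s' : ℝ} (hs : s.HolderConjugate s') {θ : ℝ} (hθ : |θ| * s' = lam)
    {A B : ℝ≥0∞} (hA : A ≠ ∞) (hB : B ≠ ∞)
    {V U : α → ℝ≥0∞} (hVm : Measurable V) (hUm : Measurable U)
    (hV : ∀ᵐ x ∂μ, V x ≠ 0 ∧ V x ≠ ∞) (hU : ∀ᵐ x ∂μ, U x ≠ 0 ∧ U x ≠ ∞)
    (hVA : ∀ x, G.M μ (fun y => V y ^ s) x ≤ A * V x ^ s) (hUB : ∀ x, G.M μ (fun y => U y ^ s) x ≤ B * U x ^ s) :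
    G.Ap μ 2 ((A * B) ^ (1 / s) * 36 ^ (1 / s')) (fun x => (V x)⁻¹ * U x * ew b θ x) := by
  have hs0 : 0 < s := hs.pos
  have hs0' : 0 < s' := hs.symm.pos
  have aeS : ∀ Y : α → ℝ≥0∞, (∀ᵐ x ∂μ, Y x ≠ 0 ∧ Y x ≠ ∞) → ∀ᵐ x ∂μ, Y x ^ s ≠ 0 ∧ Y x ^ s ≠ ∞ := by
    intro Y hY
    filter_upwards [hY] with x hx
    exact ⟨by simp [ENNReal.rpow_eq_zero_iff, hx.1, hx.2], by simp [ENNReal.rpow_eq_top_iff, hx.1, hx.2]⟩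
  refine ⟨(hVm.inv.mul hUm).mul (ew_meas hb θ), ?_, fun k x => ?_⟩
  · filter_upwards [hV, hU] with x hVx hUx
    exact ⟨mul_ne_zero (mul_ne_zero (ENNReal.inv_ne_zero.2 hVx.2) hUx.1) (ew_ne b θ x).1,
      ENNReal.mul_ne_top (ENNReal.mul_ne_top (ENNReal.inv_ne_top.2 hVx.1) hUx.2) (ew_ne b θ x).2⟩
  · obtain ⟨hm0, hmT⟩ := hG k x
    have hQm := G.measurableSet_cube k x
    obtain ⟨v0, vT, v1, v2⟩ := G.A1gen hG k x _ A hA (hVm.pow_const s) (aeS V hV) hVA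
    obtain ⟨u0, uT, u1, u2⟩ := G.A1gen hG k x _ B hB (hUm.pow_const s) (aeS U hU) hUB
    have hJk := hJ k x
    set m := μ (G.cube k x)
    set v := G.av μ k (fun y => V y ^ s) x
    set u := G.av μ k (fun y => U y ^ s) x
    set c := G.mn μ b k x
    set Q := G.cube k x
    set X : α → ℝ≥0∞ := fun y => ENNReal.ofReal (Real.exp (|θ| * |b y - c|)) with hXd
    have hXm : Measurable X := by fun_prop
    have hX : ∫⁻ y in Q, X y ^ s' ∂μ ≤ 6 * m := by
      refine le_of_eq_of_le (lintegral_congr fun y => ?_) hJk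
      simp only [hXd]
      rw [ENNReal.ofReal_rpow_of_pos (Real.exp_pos _), ← Real.exp_mul, ← hθ]
      ring_nf
    have H1 := half (μ := μ) hQm hUm hXm hs v0 hA v1 u2 hX
    have H2 := half (μ := μ) hQm hVm hXm hs u0 hB u1 v2 hX
    -- remove the mean
    have E : ∀ η : ℝ, |η| = |θ| → ∀ y, ew b η y ≤ ENNReal.ofReal (Real.exp (η * c)) * X y := by
      intro η hη y
      simp only [hXd, ew]
      rw [← ENNReal.ofReal_mul (Real.exp_pos _).le, ← Real.exp_add]
      refine ENNReal.ofReal_le_ofReal (Real.exp_le_exp.2 ?_)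
      have := le_abs_self (η * (b y - c))
      rw [abs_mul, hη] at this
      linarith
    have I1 : ∫⁻ y in Q, (V y)⁻¹ * U y * ew b θ y ∂μ ≤ ENNReal.ofReal (Real.exp (θ * c)) *
        ((A / v) ^ (1 / s) * ((m * u) ^ (1 / s) * (6 * m) ^ (1 / s'))) := by
      refine le_trans ?_ (mul_le_mul_right H1 _)
      rw [← lintegral_const_mul' _ _ ENNReal.ofReal_ne_top]
      refine lintegral_mono fun y => ?_
      calc (V y)⁻¹ * U y * ew b θ y ≤ (V y)⁻¹ * U y * (ENNReal.ofReal (Real.exp (θ * c)) * X y) := by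
            gcongr; exact E θ rfl y
        _ = _ := by ring
    have I2 : ∫⁻ y in Q, ((V y)⁻¹ * U y * ew b θ y) ^ (-(1 / (2 - 1)) : ℝ) ∂μ ≤ ENNReal.ofReal (Real.exp (-θ * c)) *
        ((B / u) ^ (1 / s) * ((m * v) ^ (1 / s) * (6 * m) ^ (1 / s'))) := by
      refine le_trans ?_ (mul_le_mul_right H2 _)
      rw [← lintegral_const_mul' _ _ ENNReal.ofReal_ne_top]
      refine lintegral_mono_ae ?_
      filter_upwards [ae_restrict_of_ae hV, ae_restrict_of_ae hU] with y hVy hUy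
      have e1 : ((V y)⁻¹ * U y * ew b θ y) ^ (-(1 / (2 - 1)) : ℝ) = (U y)⁻¹ * V y * ew b (-θ) y := by
        rw [show (-(1 / (2 - 1)) : ℝ) = -1 by norm_num, ENNReal.rpow_neg_one,
          ENNReal.mul_inv (Or.inr (ew_ne b θ y).2) (Or.inr (ew_ne b θ y).1),
          ENNReal.mul_inv (Or.inr hUy.2) (Or.inr hUy.1), inv_inv, ew_inv, mul_comm (V y)]
      rw [e1]
      calc (U y)⁻¹ * V y * ew b (-θ) y ≤ (U y)⁻¹ * V y * (ENNReal.ofReal (Real.exp (-θ * c)) * X y) := by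
            gcongr; exact E (-θ) (abs_neg θ) y
        _ = _ := by ring
    rw [show (2 : ℝ) - 1 = 1 by norm_num, ENNReal.rpow_one] at *
    have hexp : ENNReal.ofReal (Real.exp (θ * c)) * ENNReal.ofReal (Real.exp (-θ * c)) = 1 := by
      rw [← ENNReal.ofReal_mul (Real.exp_pos _).le, ← Real.exp_add]; simp
    have mr : ∀ a b : ℝ≥0∞, ∀ r : ℝ, 0 < r → a ^ r * b ^ r = (a * b) ^ r := fun a b r hr =>
      (ENNReal.mul_rpow_of_nonneg _ _ hr.le).symm
    have i1 : 0 < 1 / s := by positivity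
    have i2 : 0 < 1 / s' := by positivity
    have hsum : 1 / s + 1 / s' = 1 := by have := hs.inv_add_inv_eq_one; simpa using this
    calc _ ≤ (ENNReal.ofReal (Real.exp (θ * c)) *
        ((A / v) ^ (1 / s) * ((m * u) ^ (1 / s) * (6 * m) ^ (1 / s')))) * (ENNReal.ofReal (Real.exp (-θ * c)) *
        ((B / u) ^ (1 / s) * ((m * v) ^ (1 / s) * (6 * m) ^ (1 / s')))) := by
          gcongr
      _ = (ENNReal.ofReal (Real.exp (θ * c)) * ENNReal.ofReal (Real.exp (-θ * c))) *
          ((((A / v) ^ (1 / s) * (B / u) ^ (1 / s)) * ((m * u) ^ (1 / s) * (m * v) ^ (1 / s))) *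
            ((6 * m) ^ (1 / s') * (6 * m) ^ (1 / s'))) := by ring
      _ = ((A * B) * (m * m)) ^ (1 / s) * (36 * (m * m)) ^ (1 / s') := by
          rw [hexp, one_mul, mr _ _ _ i1, mr _ _ _ i1, mr _ _ _ i1, mr _ _ _ i2]
          congr 2
          · calc A / v * (B / u) * (m * u * (m * v)) = A * B * (m * m) * ((v * v⁻¹) * (u * u⁻¹)) := by
                  rw [div_eq_mul_inv, div_eq_mul_inv]; ring
              _ = _ := by
                  rw [ENNReal.mul_inv_cancel v0 vT, ENNReal.mul_inv_cancel u0 uT]; ring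
          · ring
      _ = (A * B) ^ (1 / s) * 36 ^ (1 / s') * ((m * m) ^ (1 / s) * (m * m) ^ (1 / s')) := by
          rw [← mr _ _ _ i1, ← mr _ _ _ i2]; ring
      _ = _ := by
          rw [← ENNReal.rpow_add_of_nonneg _ _ i1.le i2.le, hsum, ENNReal.rpow_one, ← pow_two]
          congr 1
          exact (ENNReal.rpow_two _).symm

/-- weighted bound for the majorant -/
lemma cF_wt {μ : Measure α} [SFinite μ] (hG : G.Good μ) {b : α → ℝ} (hb : Measurable b) {lam : ℝ}
    (hJ : ∀ k x, ∫⁻ y in G.cube k x, ENNReal.ofReal (Real.exp (lam * |b y - G.mn μ b k x|)) ∂μ ≤ 6 * μ (G.cube k x))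
    {s s' : ℝ} (hs : s.HolderConjugate s') {ε : ℝ} (hε : 0 < ε) (hεl : 2 * ε * s' = lam)
    {A B : ℝ≥0∞} (hA : A ≠ ∞) (hB : B ≠ ∞)
    {V U : α → ℝ≥0∞} (hVm : Measurable V) (hUm : Measurable U)
    (hV : ∀ᵐ x ∂μ, V x ≠ 0 ∧ V x ≠ ∞) (hU : ∀ᵐ x ∂μ, U x ≠ 0 ∧ U x ≠ ∞)
    (hVA : ∀ x, G.M μ (fun y => V y ^ s) x ≤ A * V x ^ s) (hUB : ∀ x, G.M μ (fun y => U y ^ s) x ≤ B * U x ^ s)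
    {f : α → ℝ≥0∞} (hf : Measurable f) :
    ∫⁻ x, G.cF μ b ε f x ^ (2 : ℝ) * (V x ^ (1 - 2 : ℝ) * U x) ∂μ
      ≤ 4 * KC 2 ((A * B) ^ (1 / s) * 36 ^ (1 / s')) * ∫⁻ x, f x ^ (2 : ℝ) * (V x ^ (1 - 2 : ℝ) * U x) ∂μ := by
  have hs0 : 0 < s := hs.pos
  have hs0' : 0 < s' := hs.symm.pos
  set K := (A * B) ^ (1 / s) * 36 ^ (1 / s') with hK
  have hKT : K ≠ ∞ := ENNReal.mul_ne_top (ENNReal.rpow_ne_top_of_nonneg (by positivity) (ENNReal.mul_ne_top hA hB))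
    (ENNReal.rpow_ne_top_of_nonneg (by positivity) (by simp))
  simp only [show (1 - 2 : ℝ) = -1 by norm_num, ENNReal.rpow_neg_one]
  -- a single term
  have T : ∀ η : ℝ, |η| = ε → ∫⁻ x, (ew b η x * G.M μ (fun y => ew b (-η) y * f y) x) ^ (2 : ℝ) * ((V x)⁻¹ * U x) ∂μ
      ≤ KC 2 K * ∫⁻ x, f x ^ (2 : ℝ) * ((V x)⁻¹ * U x) ∂μ := by
    intro η hη
    have hθ : |2 * η| * s' = lam := by rw [abs_mul, hη, ← hεl]; simp
    have hW := G.wAp hG hb hJ hs hθ hA hB hVm hUm hV hU hVA hUB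
    have hm1 : Measurable fun y => ew b (-η) y * f y := (ew_meas hb _).mul hf
    have h := G.muck hG (by norm_num : (1 : ℝ) < 2) hKT hW hm1
    have sq : ∀ (ζ : ℝ) y, ew b ζ y ^ (2 : ℝ) = ew b (2 * ζ) y := by
      intro ζ y
      rw [ENNReal.rpow_two, pow_two, ew_mul]; ring_nf
    refine le_of_eq_of_le (lintegral_congr fun y => ?_) (h.trans_eq ?_)
    · rw [ENNReal.mul_rpow_of_nonneg _ _ (by norm_num), sq]; ring
    · congr 1
      refine lintegral_congr fun y => ?_
      rw [ENNReal.mul_rpow_of_nonneg _ _ (by norm_num), sq]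
      have : ew b (2 * -η) y * ew b (2 * η) y = 1 := by
        rw [ew_mul, show 2 * -η + 2 * η = 0 by ring, ew_zero]
      calc _ = f y ^ (2 : ℝ) * ((V y)⁻¹ * U y) * (ew b (2 * -η) y * ew b (2 * η) y) := by ring
        _ = _ := by rw [this, mul_one]
  have T1 := T ε (abs_of_pos hε)
  have T2 := T (-ε) (by rw [abs_neg, abs_of_pos hε])
  rw [neg_neg] at T2
  have sqle : ∀ a c : ℝ≥0∞, (a + c) ^ (2 : ℝ) ≤ 2 * (a ^ (2 : ℝ) + c ^ (2 : ℝ)) := by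
    intro a c
    have := ENNReal.rpow_add_le_mul_rpow_add_rpow a c (by norm_num : (1 : ℝ) ≤ 2)
    rwa [show (2 : ℝ) - 1 = 1 by norm_num, ENNReal.rpow_one] at this
  have hmm : Measurable fun x => (ew b ε x * G.M μ (fun y => ew b (-ε) y * f y) x) ^ (2 : ℝ) * ((V x)⁻¹ * U x) :=
    (((ew_meas hb ε).mul (G.measurable_M _ _)).pow_const _).mul (hVm.inv.mul hUm)
  calc ∫⁻ x, G.cF μ b ε f x ^ (2 : ℝ) * ((V x)⁻¹ * U x) ∂μ
      ≤ ∫⁻ x, 2 * ((ew b ε x * G.M μ (fun y => ew b (-ε) y * f y) x) ^ (2 : ℝ) * ((V x)⁻¹ * U x) +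
          (ew b (-ε) x * G.M μ (fun y => ew b ε y * f y) x) ^ (2 : ℝ) * ((V x)⁻¹ * U x)) ∂μ := by
        refine lintegral_mono fun x => ?_
        unfold cF
        refine le_trans (mul_le_mul' (sqle _ _) le_rfl) (le_of_eq ?_)
        ring
    _ ≤ 2 * (KC 2 K * ∫⁻ x, f x ^ (2 : ℝ) * ((V x)⁻¹ * U x) ∂μ + KC 2 K * ∫⁻ x, f x ^ (2 : ℝ) * ((V x)⁻¹ * U x) ∂μ) := by
        rw [lintegral_const_mul' _ _ (by simp), lintegral_add_left hmm]
        gcongr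
    _ = _ := by ring
end DGrid
end

noncomputable section

lemma majS {n : ℕ} (σ : Fin n → Bool) {q : Fin n → ℝ} {r : ℝ} (hr : 1 < r) (hq : ∀ i, r < q i) :
    ∃ A : ℝ≥0∞, A ≠ ∞ ∧ Maj volume (mixedLnorm n q)
      (fun V => ∀ x, (pg σ).M volume (fun y => V y ^ r) x ≤ A * V x ^ r) := by
  have hr0 : 0 < r := by linarith
  have hq0 : ∀ i, 0 < q i := fun i => by linarith [hq i]
  have hq' : ∀ i, 1 < q i / r := fun i => by rw [lt_div_iff₀ hr0]; linarith [hq i]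
  obtain ⟨C, hC, hM⟩ := pg_bdd σ hq'
  have hmaj := (pg σ).maj (μ := volume) (mixed_fnorm (fun i => (hq' i).le)) (B := C + 1)
    (ENNReal.add_ne_top.2 ⟨hC, by simp⟩) (by simp) (fun g hg => (hM g hg).trans (by gcongr; exact le_self_add))
    (fun ε hε => mixed_pos (fun i => (hq' i).le) ε hε) (fun V hV hT => mixed_fin hq' V hV hT)
  refine ⟨2 * (C + 1), ENNReal.mul_ne_top (by simp) (ENNReal.add_ne_top.2 ⟨hC, by simp⟩), ?_⟩
  intro v hv hvT ε hε hεT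
  have e1 := mixed_pow hq0 hr0 v
  obtain ⟨V, hVm, hvV, hVae, hVn, hVP⟩ := hmaj (fun x => v x ^ r) (hv.pow_const r)
    (by rw [e1]; exact ENNReal.rpow_ne_top_of_nonneg hr0.le hvT) (ε ^ r)
    (by simp [ENNReal.rpow_eq_zero_iff, hε, hεT]) (ENNReal.rpow_ne_top_of_nonneg hr0.le hεT)
  have eV : ∀ x, (V x ^ (1 / r)) ^ r = V x := fun x => by
    rw [← ENNReal.rpow_mul, one_div, inv_mul_cancel₀ hr0.ne', ENNReal.rpow_one]
  refine ⟨fun x => V x ^ (1 / r), hVm.pow_const _, fun x => ?_, ?_, ?_, ?_⟩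
  · rw [one_div]
    exact (ENNReal.le_rpow_inv_iff hr0).2 (hvV x)
  · filter_upwards [hVae] with x hx
    exact ⟨by simp [ENNReal.rpow_eq_zero_iff, hx.1, hx.2], by simp [ENNReal.rpow_eq_top_iff, hx.1, hx.2]⟩
  · have e2 := mixed_pow hq0 hr0 (fun x => V x ^ (1 / r))
    simp only [eV] at e2
    rw [e1, e2] at hVn
    rw [← ENNReal.rpow_le_rpow_iff hr0]
    refine hVn.trans ?_
    rw [ENNReal.mul_rpow_of_nonneg _ _ hr0.le]
    gcongr
    · nth_rewrite 1 [← ENNReal.rpow_one 2]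
      exact ENNReal.rpow_le_rpow_of_exponent_le (by norm_num) hr.le
    · exact ENNReal.add_rpow_le_rpow_add _ _ hr.le
  · simp only [eV]
    exact hVP

lemma exists_r {n : ℕ} {q : Fin n → ℝ} (hq : ∀ i, 1 < q i) : ∃ r : ℝ, 1 < r ∧ ∀ i, r < q i ∧ r < cj q i := by
  have h1 : ∀ i, ∀ᶠ r in nhdsWithin (1 : ℝ) (Ioi 1), r < q i ∧ r < cj q i := fun i =>
    ((eventually_lt_nhds (hq i)).and (eventually_lt_nhds (cj_gt hq i))).filter_mono nhdsWithin_le_nhds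
  have h2 := (Filter.eventually_all.2 h1).and (self_mem_nhdsWithin : Ioi (1 : ℝ) ∈ _)
  obtain ⟨r, hr, hr1⟩ := h2.exists
  exact ⟨r, hr1, hr⟩

lemma pg_cF_bdd {n : ℕ} (σ : Fin n → Bool) {q : Fin n → ℝ} (hq : ∀ i, 1 < q i) :
    ∃ C : ℝ≥0∞, C ≠ ∞ ∧ ∀ b, Measurable b → LocallyIntegrable b →
      (∀ k x, ∫⁻ y in (pg σ).cube k x, ENNReal.ofReal |b y - (pg σ).mn volume b k x| ≤ volume ((pg σ).cube k x)) →
      ∀ f, Measurable f → mixedLnorm n q f ≠ ∞ → ∃ H, Measurable H ∧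
        (∀ x, (pg σ).cm volume b f x ≤ H x) ∧ mixedLnorm n q H ≤ C * mixedLnorm n q f := by
  obtain ⟨r, hr1, hr⟩ := exists_r hq
  obtain ⟨A, hA, majA⟩ := majS σ hr1 (fun i => (hr i).1)
  obtain ⟨B, hB, majB⟩ := majS σ hr1 (fun i => (hr i).2)
  set r' := r.conjExponent with hr'
  have hrr : r.HolderConjugate r' := Real.HolderConjugate.conjExponent hr1
  have hr0' : 0 < r' := hrr.symm.pos
  set D : ℝ := 2 ^ n with hD
  have hD1 : 1 ≤ D := one_le_pow₀ (by norm_num)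
  set lam : ℝ := Real.log (3 / 2) / (D + 2) with hlamd
  have hlam : 0 < lam := div_pos (Real.log_pos (by norm_num)) (by linarith)
  have hlam2 : Real.exp (lam * (D + 2)) ≤ 3 / 2 := by
    rw [hlamd, div_mul_cancel₀ _ (by linarith), Real.exp_log (by norm_num)]
  set ε : ℝ := lam / (2 * r') with hε
  have hε0 : 0 < ε := by positivity
  have hεl : 2 * ε * r' = lam := by rw [hε]; field_simp
  set C1 := 4 * DGrid.KC 2 ((A * B) ^ (1 / r) * 36 ^ (1 / r')) with hC1
  have hr0 : 0 < r := by linarith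
  have hC1T : C1 ≠ ∞ := ENNReal.mul_ne_top (by simp) (DGrid.KC_ne_top (by norm_num)
    (ENNReal.mul_ne_top (ENNReal.rpow_ne_top_of_nonneg (by positivity) (ENNReal.mul_ne_top hA hB))
    (ENNReal.rpow_ne_top_of_nonneg (by positivity) (by simp))))
  refine ⟨ENNReal.ofReal ε⁻¹ * (C1 ^ (1 / 2 : ℝ) * 4), ENNReal.mul_ne_top ENNReal.ofReal_ne_top
    (ENNReal.mul_ne_top (ENNReal.rpow_ne_top_of_nonneg (by norm_num) hC1T) (by simp)), ?_⟩
  intro b hb hbl hosc f hf hfT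
  have hJ := fun k x => (pg σ).jn (pg_good σ) hD1 (pg_doub σ) hb (pg_int σ hbl) hosc (pg_diff σ hbl) hlam hlam2 k x
  have hFm := (pg σ).cF_meas volume hb ε f
  refine ⟨fun x => ENNReal.ofReal ε⁻¹ * (pg σ).cF volume b ε f x, hFm.const_mul _,
    fun x => (pg σ).cm_le hb hε0 hf x, ?_⟩
  rw [(mixed_fnorm (fun i => (hq i).le)).smul _ ENNReal.ofReal_ne_top _ hFm, mul_assoc]
  gcongr
  refine mixed_dual hq hFm fun u hu hu1 => ?_
  have h := extrap_abs majA majB (fun V U hV hU => mixed_holder hq hV hU) (by norm_num : (1 : ℝ) < 2) hC1T hFm hf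
    (fun V U hV hU hVae hUae hPV hPU =>
      (pg σ).cF_wt (pg_good σ) hb hJ hrr hε0 hεl hA hB hV hU hVae hUae hPV hPU hf)
    hu hfT (ne_top_of_le_ne_top (by simp) hu1)
  refine h.trans ?_
  gcongr
  calc mixedLnorm n q f * mixedLnorm n (cj q) u ≤ mixedLnorm n q f * 1 := by gcongr
    _ = _ := mul_one _

lemma pg_cF_bdd2 {n : ℕ} (σ : Fin n → Bool) {q : Fin n → ℝ} (hq : ∀ i, 1 < q i) :
    ∃ C : ℝ≥0∞, C ≠ ∞ ∧ ∀ b, Measurable b → LocallyIntegrable b → ∀ τ : ℝ, 0 < τ →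
      (∀ k x, ∫⁻ y in (pg σ).cube k x, ENNReal.ofReal |b y - (pg σ).mn volume b k x|
        ≤ ENNReal.ofReal τ * volume ((pg σ).cube k x)) →
      ∀ f, Measurable f → mixedLnorm n q f ≠ ∞ → ∃ H, Measurable H ∧
        (∀ x, (pg σ).cm volume b f x ≤ H x) ∧ mixedLnorm n q H ≤ ENNReal.ofReal τ * C * mixedLnorm n q f := by
  obtain ⟨C, hC, h⟩ := pg_cF_bdd σ hq
  refine ⟨C, hC, fun b hb hbl τ hτ hosc f hf hfT => ?_⟩
  have hmn : ∀ k x, (pg σ).mn volume (fun y => τ⁻¹ * b y) k x = τ⁻¹ * (pg σ).mn volume b k x := by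
    intro k x
    unfold DGrid.mn
    rw [setAverage_eq, setAverage_eq, integral_const_mul]
    simp only [smul_eq_mul]; ring
  have hτ1 : ENNReal.ofReal τ * ENNReal.ofReal τ⁻¹ = 1 := by
    rw [← ENNReal.ofReal_mul hτ.le, mul_inv_cancel₀ hτ.ne', ENNReal.ofReal_one]
  have habs : ∀ u v : ℝ, ENNReal.ofReal |τ⁻¹ * u - τ⁻¹ * v| = ENNReal.ofReal τ⁻¹ * ENNReal.ofReal |u - v| := by
    intro u v
    rw [← mul_sub, abs_mul, abs_of_pos (inv_pos.2 hτ), ENNReal.ofReal_mul (inv_pos.2 hτ).le]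
  obtain ⟨H, hHm, hH1, hH2⟩ := h (fun y => τ⁻¹ * b y) (hb.const_mul _) (hbl.smul τ⁻¹) (by
    intro k x
    rw [hmn]
    simp only [habs]
    rw [lintegral_const_mul' _ _ ENNReal.ofReal_ne_top]
    refine (mul_le_mul_right (hosc k x) _).trans ?_
    rw [← mul_assoc, mul_comm (ENNReal.ofReal τ⁻¹), hτ1, one_mul]) f hf hfT
  refine ⟨fun x => ENNReal.ofReal τ * H x, hHm.const_mul _, fun x => ?_, ?_⟩
  · refine le_trans ?_ (mul_le_mul_right (hH1 x) _)
    refine iSup_le fun k => ?_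
    refine le_trans (le_of_eq ?_) (mul_le_mul_right (le_iSup _ k) _)
    simp only [habs, mul_assoc]
    rw [lintegral_const_mul' _ _ ENNReal.ofReal_ne_top, mul_left_comm, ← mul_assoc (ENNReal.ofReal τ), hτ1, one_mul]
  · rw [(mixed_fnorm (fun i => (hq i).le)).smul _ ENNReal.ofReal_ne_top _ hHm, mul_assoc]
    gcongr

lemma third1 (u v : ℝ) (m : ℤ) (h1 : m + 1 / 6 ≤ u) (h2 : u ≤ m + 5 / 6) (h : |u - v| < 1 / 6) : ⌊v⌋ = ⌊u⌋ := by
  rw [abs_lt] at h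
  have e1 : ⌊v⌋ = m := by rw [Int.floor_eq_iff]; constructor <;> linarith [h.1, h.2]
  have e2 : ⌊u⌋ = m := by rw [Int.floor_eq_iff]; constructor <;> linarith
  rw [e1, e2]

lemma third2 (k : ℤ) (x ρ : ℝ) (h : 6 * ρ ≤ 2 ^ k) : ∃ s, ∀ y, |x - y| < ρ → y ∈ (g1 s).cube k x := by
  have h2 : (0 : ℝ) < 2 ^ k := by positivity
  suffices ∃ s, ∃ m : ℤ, m + 1 / 6 ≤ x / 2 ^ k - (sh s k : ℝ) / 3 ∧ x / 2 ^ k - (sh s k : ℝ) / 3 ≤ m + 5 / 6 by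
    obtain ⟨s, m, hm1, hm2⟩ := this
    refine ⟨s, fun y hy => ?_⟩
    show ix s k y = ix s k x
    refine third1 _ _ m hm1 hm2 ?_
    have : x / 2 ^ k - (sh s k : ℝ) / 3 - (y / 2 ^ k - (sh s k : ℝ) / 3) = (x - y) / 2 ^ k := by ring
    rw [this, abs_div, abs_of_pos h2, div_lt_iff₀ h2]
    linarith
  set u := x / 2 ^ k
  have f1 := Int.floor_le u
  have f2 := Int.lt_floor_add_one u
  by_cases c1 : u < ⌊u⌋ + 1 / 6
  · refine ⟨true, ?_⟩
    by_cases hk : Even k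
    · refine ⟨⌊u⌋ - 1, ?_⟩; simp [sh, hk]; constructor <;> linarith
    · refine ⟨⌊u⌋, ?_⟩; simp [sh, hk]; constructor <;> linarith
  by_cases c2 : ⌊u⌋ + 5 / 6 < u
  · refine ⟨true, ?_⟩
    by_cases hk : Even k
    · refine ⟨⌊u⌋, ?_⟩; simp [sh, hk]; constructor <;> linarith
    · refine ⟨⌊u⌋ + 1, ?_⟩; simp [sh, hk]; constructor <;> linarith
  refine ⟨false, ⌊u⌋, ?_⟩
  simp [sh]; constructor <;> linarith

lemma maxComm_le {n : ℕ} (hn : 0 < n) (b f : (Fin n → ℝ) → ℝ) (x : Fin n → ℝ) :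
    maxComm n b f x ≤ (6 * n) ^ n * ∑ σ : Fin n → Bool, (pg σ).cm volume b (fun y => ENNReal.ofReal |f y|) x := by
  have hn' : (0 : ℝ) < n := by exact_mod_cast hn
  refine iSup_le fun r => iSup_le fun hr => ?_
  obtain ⟨j, hj1, hj2⟩ := exists_mem_Ioc_zpow (show 0 < 6 * r by positivity) (show (1 : ℝ) < 2 by norm_num)
  set k := j + 1 with hk
  have hk2 : (2 : ℝ) ^ k ≤ 12 * r := by
    rw [hk, zpow_add_one₀ (by norm_num)]; linarith
  choose σ hσ using fun i => third2 k (x i) r hj2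
  have hsub : eball n x r ⊆ (pg σ).cube k x := by
    intro y hy
    rw [mem_pg_cube]
    intro i
    refine hσ i _ ?_
    have := eball_sub x r hr hy
    rw [Metric.mem_ball, dist_pi_lt_iff hr] at this
    have h3 := this i
    rwa [dist_comm, Real.dist_eq] at h3
  have hv := eball_vol_ne hn x r hr
  have hvol : volume ((pg σ).cube k x) ≤ (6 * n) ^ n * volume (eball n x r) := by
    rw [pg_vol]
    refine le_trans ?_ (mul_le_mul_right (le_eball_vol hn x r hr) _)
    rw [← mul_pow]
    refine pow_le_pow_left' ?_ n
    have : (6 * n : ℝ≥0∞) = ENNReal.ofReal (6 * n) := by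
      rw [ENNReal.ofReal_mul (by norm_num)]; simp
    rw [this, ← ENNReal.ofReal_mul (by positivity)]
    refine ENNReal.ofReal_le_ofReal ?_
    have : 6 * n * (2 * (r / n)) = 12 * r := by field_simp; ring
    rw [this]; exact hk2
  have hinv : (volume (eball n x r))⁻¹ ≤ (6 * n) ^ n * (volume ((pg σ).cube k x))⁻¹ := by
    rw [← div_eq_mul_inv, ENNReal.le_div_iff_mul_le (Or.inl (pg_good σ k x).1) (Or.inl (pg_good σ k x).2),
      mul_comm, ← div_eq_mul_inv]
    exact ENNReal.div_le_of_le_mul hvol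
  calc (volume (eball n x r))⁻¹ * ∫⁻ y in eball n x r, ENNReal.ofReal (|b x - b y| * |f y|)
      ≤ ((6 * n) ^ n * (volume ((pg σ).cube k x))⁻¹) *
        ∫⁻ y in (pg σ).cube k x, ENNReal.ofReal |b x - b y| * ENNReal.ofReal |f y| := by
        refine mul_le_mul' hinv ((lintegral_mono_set hsub).trans (le_of_eq ?_))
        refine lintegral_congr fun y => ?_
        rw [ENNReal.ofReal_mul (abs_nonneg _)]
    _ = (6 * n) ^ n * ((volume ((pg σ).cube k x))⁻¹ *
        ∫⁻ y in (pg σ).cube k x, ENNReal.ofReal |b x - b y| * ENNReal.ofReal |f y|) := mul_assoc _ _ _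
    _ ≤ (6 * n) ^ n * (pg σ).cm volume b (fun y => ENNReal.ofReal |f y|) x := by
        refine mul_le_mul_right ?_ _
        exact le_iSup (fun k => (volume ((pg σ).cube k x))⁻¹ *
          ∫⁻ y in (pg σ).cube k x, ENNReal.ofReal |b x - b y| * ENNReal.ofReal |f y|) k
    _ ≤ _ := by
        refine mul_le_mul_right ?_ _
        exact Finset.single_le_sum (f := fun σ => (pg σ).cm volume b (fun y => ENNReal.ofReal |f y|) x)
          (fun _ _ => by simp) (Finset.mem_univ σ)

lemma mixed_sum {n : ℕ} {q : Fin n → ℝ} (hq : ∀ i, 1 ≤ q i) {ι : Type} (t : Finset ι) (H : ι → (Fin n → ℝ) → ℝ≥0∞)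
    (hH : ∀ i, Measurable (H i)) : mixedLnorm n q (fun x => ∑ i ∈ t, H i x) ≤ ∑ i ∈ t, mixedLnorm n q (H i) := by
  classical
  induction t using Finset.induction_on with
  | empty => simp [(mixed_fnorm hq).zero]
  | insert a t ha ih =>
    simp only [Finset.sum_insert ha]
    exact ((mixed_fnorm hq).add _ _ (hH a) (by fun_prop)).trans (by gcongr)

lemma bmo_congr {n : ℕ} {b b' : (Fin n → ℝ) → ℝ} (h : b =ᵐ[volume] b') : bmoNorm n b = bmoNorm n b' := by
  unfold bmoNorm
  refine iSup_congr fun x => iSup_congr fun r => iSup_congr fun hr => ?_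
  have e : (⨍ z in eball n x r, b z) = ⨍ z in eball n x r, b' z := average_congr (ae_restrict_of_ae h)
  rw [e]
  congr 2
  refine integral_congr_ae ?_
  filter_upwards [ae_restrict_of_ae h] with y hy
  rw [hy]

lemma maxComm_congr {n : ℕ} {b b' : (Fin n → ℝ) → ℝ} (h : b =ᵐ[volume] b') (f : (Fin n → ℝ) → ℝ) :
    ∀ᵐ x, maxComm n b f x = maxComm n b' f x := by
  filter_upwards [h] with x hx
  unfold maxComm
  refine iSup_congr fun r => iSup_congr fun hr => ?_
  congr 1
  refine lintegral_congr_ae ?_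
  filter_upwards [ae_restrict_of_ae h] with y hy
  rw [hx, hy]

theorem main_bdd (n : ℕ) (hn : 0 < n) (q : Fin n → ℝ) (hq : ∀ j, 1 < q j) :
    ∃ C : ℝ≥0∞, C ≠ ∞ ∧ ∀ b, LocallyIntegrable b → bmoNorm n b ≠ ⊤ →
      ∀ f, Measurable f → mixedNorm n q f ≠ ⊤ →
      mixedLnorm n q (maxComm n b f) ≤ C * bmoNorm n b * mixedNorm n q f := by
  have hq0 : ∀ i, 0 < q i := fun i => by linarith [hq i]
  have hq1 : ∀ i, 1 ≤ q i := fun i => (hq i).le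
  choose Cσ hCT hCσ using fun σ : Fin n → Bool => pg_cF_bdd2 σ hq
  set K : ℝ≥0∞ := 2 * (4 * n) ^ n with hK
  have hKT : K ≠ ∞ := ENNReal.mul_ne_top (by simp) (ENNReal.pow_ne_top (ENNReal.mul_ne_top (by simp) (by simp)))
  have hn0 : (n : ℝ≥0∞) ≠ 0 := by exact_mod_cast hn.ne'
  have hK0 : K ≠ 0 := mul_ne_zero (by simp) (pow_ne_zero _ (mul_ne_zero (by simp) hn0))
  set C : ℝ≥0∞ := (6 * n) ^ n * (K * ∑ σ, Cσ σ) with hC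
  have h6T : ((6 * n) ^ n : ℝ≥0∞) ≠ ∞ := ENNReal.pow_ne_top (ENNReal.mul_ne_top (by simp) (by simp))
  have hCTop : C ≠ ∞ := ENNReal.mul_ne_top h6T
    (ENNReal.mul_ne_top hKT (ENNReal.sum_ne_top.2 fun σ _ => hCT σ))
  refine ⟨C, hCTop, ?_⟩
  intro b hb hbT f hf hfT
  obtain ⟨b', hb'm, hbb⟩ := hb.aestronglyMeasurable
  have hb' : LocallyIntegrable b' := hb.congr hbb
  rw [bmo_congr hbb] at hbT ⊢
  rw [mixed_congr hq0 (maxComm_congr hbb f)]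
  set g : (Fin n → ℝ) → ℝ≥0∞ := fun y => ENNReal.ofReal |f y| with hg
  have hgm : Measurable g := by fun_prop
  have hgT : mixedLnorm n q g ≠ ∞ := hfT
  show _ ≤ C * bmoNorm n b' * mixedLnorm n q g
  -- with a positive parameter
  have key : ∀ β : ℝ≥0∞, β ≠ 0 → β ≠ ∞ → bmoNorm n b' ≤ β →
      mixedLnorm n q (maxComm n b' f) ≤ C * β * mixedLnorm n q g := by
    intro β hβ0 hβT hβ
    set τ : ℝ := (K * β).toReal with hτ
    have hKβ : K * β ≠ ∞ := ENNReal.mul_ne_top hKT hβT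
    have hτ0 : 0 < τ := ENNReal.toReal_pos (mul_ne_zero hK0 hβ0) hKβ
    have hτe : ENNReal.ofReal τ = K * β := ENNReal.ofReal_toReal hKβ
    choose H hHm hH1 hH2 using fun σ => hCσ σ b' hb'm.measurable hb' τ hτ0
      (fun k x => by rw [hτe]; exact pg_osc hn σ hb' hβ k x) g hgm hgT
    calc mixedLnorm n q (maxComm n b' f) ≤ mixedLnorm n q (fun x => (6 * n) ^ n * ∑ σ, H σ x) := by
          refine mixed_mono hq0 fun x => (maxComm_le hn b' f x).trans ?_
          gcongr with σ
          exact hH1 σ x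
      _ = (6 * n) ^ n * mixedLnorm n q (fun x => ∑ σ, H σ x) :=
          (mixed_fnorm hq1).smul _ h6T _ (by fun_prop)
      _ ≤ (6 * n) ^ n * ∑ σ, ENNReal.ofReal τ * Cσ σ * mixedLnorm n q g := by
          gcongr
          refine (mixed_sum hq1 _ _ hHm).trans ?_
          gcongr with σ
          exact hH2 σ
      _ = C * β * mixedLnorm n q g := by
          rw [← Finset.sum_mul, ← Finset.mul_sum, hτe, hC]; ring
  refine ENNReal.le_of_forall_pos_le_add fun ε hε _ => ?_
  set D := C * mixedLnorm n q g with hD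
  have hDT : D ≠ ∞ := ENNReal.mul_ne_top hCTop hgT
  have hD1 : D + 1 ≠ ∞ := ENNReal.add_ne_top.2 ⟨hDT, by simp⟩
  have hδ0 : (ε : ℝ≥0∞) / (D + 1) ≠ 0 := by
    rw [Ne, ENNReal.div_eq_zero_iff]
    push Not
    exact ⟨by exact_mod_cast hε.ne', hD1⟩
  have hδT : (ε : ℝ≥0∞) / (D + 1) ≠ ∞ := ENNReal.div_ne_top (by simp) (by simp)
  refine (key (bmoNorm n b' + ε / (D + 1)) (by simp only [ne_eq, add_eq_zero]; exact fun h => hδ0 h.2)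
    (ENNReal.add_ne_top.2 ⟨hbT, hδT⟩) le_self_add).trans ?_
  calc C * (bmoNorm n b' + ε / (D + 1)) * mixedLnorm n q g
      = C * bmoNorm n b' * mixedLnorm n q g + D * (ε / (D + 1)) := by rw [hD]; ring
    _ ≤ C * bmoNorm n b' * mixedLnorm n q g + (D + 1) * (ε / (D + 1)) := by gcongr; exact le_self_add
    _ = _ := by rw [ENNReal.mul_div_cancel (by simp) hD1]

theorem stmtX (n : ℕ) (hn : 0 < n) (q : Fin n → ℝ) (hq : ∀ j, 1 < q j) :
    ∃ C : ℝ, 0 < C ∧ ∀ b, LocallyIntegrable b → bmoNorm n b ≠ ⊤ →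
      ∀ f, Measurable f → mixedNorm n q f ≠ ⊤ →
      mixedLnorm n q (maxComm n b f) ≤ ENNReal.ofReal C * bmoNorm n b * mixedNorm n q f := by
  obtain ⟨C, hC, h⟩ := main_bdd n hn q hq
  refine ⟨C.toReal + 1, by positivity, fun b hb hbT f hf hfT => (h b hb hbT f hf hfT).trans ?_⟩
  gcongr
  calc C = ENNReal.ofReal C.toReal := (ENNReal.ofReal_toReal hC).symm
    _ ≤ _ := ENNReal.ofReal_le_ofReal (by linarith)
end

theorem stmt10 (n : ℕ) (hn : 0 < n) (q : Fin n → ℝ) (hq : ∀ j, 1 < q j) :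
    ∃ C : ℝ, 0 < C ∧ ∀ b : (Fin n → ℝ) → ℝ, LocallyIntegrable b →
      bmoNorm n b ≠ ⊤ →
      ∀ f : (Fin n → ℝ) → ℝ, Measurable f → mixedNorm n q f ≠ ⊤ →
      mixedLnorm n q (maxComm n b f)
        ≤ ENNReal.ofReal C * bmoNorm n b * mixedNorm n q f := by
  exact stmtX n hn q hq
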